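/- (Heath–Brown) Let k be a positive integer and let L_i(x) = a_i·x + b_i (1 ≤ i ≤ k) be linear functions with integer coefficients and a_i > 0. Suppose that for every prime p there exists an integer n_p such that p divides none of the values L_1(n_p), …, L_k(n_p). Set G_k = ⌊log₂⌊(3k² + 4k + 4)/2⌋⌋. Then there exist a constant c > 0 and x₀ > 0 such that for all real x ≥ x₀, the number of positive integers n ≤ x with max_{1 ≤ i ≤ k} Ω(L_i(n)) ≤ G_k is at least c·x/(log x)^k. -/

import Mathlib

open Finset

/-- `Ω(n)`: the number of prime factors of `n` counted with multiplicity,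
evaluated on an integer via its nonnegative part. -/
def bigOmegaZ (x : ℤ) : ℕ := x.toNat.primeFactorsList.length

namespace AlmostPrime

/-- The integers in `[1, n]` coprime to `W`. -/
def cop (W n : ℕ) : Finset ℕ := (Icc 1 n).filter (Nat.Coprime W)

lemma mem_cop {W n e : ℕ} : e ∈ cop W n ↔ (1 ≤ e ∧ e ≤ n) ∧ W.Coprime e := by
  simp [cop]

/-- The harmonic sum over integers up to `y` coprime to `W`. -/
noncomputable def copHarm (W : ℕ) (y : ℝ) : ℝ := ∑ e ∈ cop W ⌊y⌋₊, (e : ℝ)⁻¹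

lemma abs_harmonic_floor_sub_log_le {t : ℝ} (ht : 0 < t) :
    |copHarm 1 t - Real.log t - Real.eulerMascheroniConstant| ≤ 4 / t := by
  have hH : copHarm 1 t = (harmonic ⌊t⌋₊ : ℝ) := by
    rw [harmonic_eq_sum_Icc, copHarm, cop]
    push_cast
    refine sum_congr ?_ fun _ _ => rfl
    ext; simp
  have h1 := Real.eulerMascheroniSeq_lt_eulerMascheroniConstant ⌊t⌋₊
  have h2 := Real.eulerMascheroniConstant_lt_eulerMascheroniSeq' ⌊t⌋₊
  have h3 := Real.eulerMascheroniConstant_lt_two_thirds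
  have h4 := Real.one_half_lt_eulerMascheroniConstant
  rw [Real.eulerMascheroniSeq] at h1
  rw [Real.eulerMascheroniSeq'] at h2
  rw [hH]
  have hlt := Nat.lt_floor_add_one t
  rcases Nat.eq_zero_or_pos ⌊t⌋₊ with h0 | h0
  · have ht1 : t < 1 := by simpa [h0] using hlt
    rw [h0] at *
    have hl : Real.log t < 0 := Real.log_neg ht ht1
    have hl2 : Real.log t⁻¹ ≤ t⁻¹ - 1 := Real.log_le_sub_one_of_pos (by positivity)
    rw [Real.log_inv] at hl2
    have : 1 ≤ t⁻¹ := (one_le_inv₀ ht).2 ht1.le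
    rw [div_eq_mul_inv, abs_le]
    simp only [harmonic_zero, Rat.cast_zero]
    constructor <;> linarith
  · rw [if_neg h0.ne'] at h2
    set n := ⌊t⌋₊ with hn
    have hn1 : (1 : ℝ) ≤ n := by exact_mod_cast h0
    have hle : (n : ℝ) ≤ t := Nat.floor_le ht.le
    have hl1 : Real.log n ≤ Real.log t := Real.log_le_log (by positivity) hle
    have hl2 : Real.log t ≤ Real.log (n + 1) := Real.log_le_log ht hlt.le
    have hl3 : Real.log (n + 1) - Real.log n ≤ 1 / n := by
      rw [← Real.log_div (by positivity) (by positivity)]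
      refine (Real.log_le_sub_one_of_pos (by positivity)).trans_eq ?_
      field_simp
      ring
    have hl4 : 1 / (n : ℝ) ≤ 4 / t := by
      rw [div_le_div_iff₀ (by positivity) ht]
      linarith
    rw [abs_le]
    constructor <;> linarith

lemma copHarm_prime_mul {W p : ℕ} (hp : p.Prime) (hpW : p.Coprime W) (y : ℝ) :
    copHarm (p * W) y = copHarm W y - (p : ℝ)⁻¹ * copHarm W (y / p) := by
  have hp0 : 0 < p := hp.pos
  have hsplit : copHarm W y = copHarm (p * W) y +
      ∑ e ∈ (cop W ⌊y⌋₊).filter (p ∣ ·), (e : ℝ)⁻¹ := by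
    rw [copHarm, ← sum_filter_add_sum_filter_not _ (fun e => ¬ p ∣ e)]
    congr 1
    · refine sum_congr ?_ fun _ _ => rfl
      ext e
      simp only [mem_filter, mem_cop, Nat.coprime_mul_iff_left, hp.coprime_iff_not_dvd]
      tauto
    · simp
  have himg : ∑ e ∈ (cop W ⌊y⌋₊).filter (p ∣ ·), (e : ℝ)⁻¹ =
      ∑ e ∈ cop W ⌊y / p⌋₊, (p : ℝ)⁻¹ * (e : ℝ)⁻¹ := by
    symm
    refine sum_nbij' (fun e => p * e) (fun e => e / p) ?_ ?_ ?_ ?_ ?_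
    · intro e he
      rw [mem_cop, Nat.floor_div_natCast, Nat.le_div_iff_mul_le hp0] at he
      simp only [mem_filter, mem_cop, dvd_mul_right, and_true]
      refine ⟨⟨Nat.mul_pos hp0 he.1.1, by rw [mul_comm]; exact he.1.2⟩, ?_⟩
      exact Nat.Coprime.mul_right hpW.symm he.2
    · intro e he
      simp only [mem_filter, mem_cop] at he
      obtain ⟨⟨⟨h1, h2⟩, h3⟩, f, rfl⟩ := he
      rw [Nat.mul_div_cancel_left _ hp0, mem_cop, Nat.floor_div_natCast,
        Nat.le_div_iff_mul_le hp0]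
      refine ⟨⟨Nat.pos_of_mul_pos_left h1, by rwa [mul_comm]⟩, h3.coprime_mul_left_right⟩
    · intro e _
      exact Nat.mul_div_cancel_left _ hp0
    · intro e he
      exact Nat.mul_div_cancel' (mem_filter.1 he).2
    · intro e _
      push_cast
      rw [mul_inv]
  rw [himg, ← mul_sum] at hsplit
  rw [hsplit, copHarm]
  simp [copHarm]

/-- Harmonic sums over integers coprime to a product of primes, with a power saving. -/
lemma exists_copHarm_asymp (V : Finset ℕ) (hV : ∀ p ∈ V, p.Prime) :
    ∃ c c₀ C : ℝ, 0 < c ∧ c ≤ 1 ∧ 0 ≤ C ∧ ∀ y : ℝ, 0 < y →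
      |copHarm (∏ p ∈ V, p) y - c * Real.log y - c₀| ≤ C / y := by
  induction V using Finset.induction_on with
  | empty =>
    refine ⟨1, Real.eulerMascheroniConstant, 4, one_pos, le_rfl, by norm_num, fun y hy => ?_⟩
    simpa using abs_harmonic_floor_sub_log_le hy
  | insert p V hpV ih =>
    obtain ⟨c, c₀, C, hc, hc1, hC, h⟩ := ih fun q hq => hV q (mem_insert_of_mem hq)
    have hp : p.Prime := hV p (mem_insert_self _ _)
    have hcop : p.Coprime (∏ q ∈ V, q) := Nat.Coprime.prod_right fun q hq =>
      (Nat.coprime_primes hp (hV q (mem_insert_of_mem hq))).2 (by rintro rfl; exact hpV hq)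
    have hp1 : (1 : ℝ) < p := by exact_mod_cast hp.one_lt
    have hpi : (p : ℝ)⁻¹ < 1 := inv_lt_one_of_one_lt₀ hp1
    have hpi0 : 0 < (p : ℝ)⁻¹ := by positivity
    refine ⟨c * (1 - (p : ℝ)⁻¹), c₀ - (p : ℝ)⁻¹ * (c₀ - c * Real.log p), 2 * C,
      mul_pos hc (by linarith), by nlinarith, by positivity, fun y hy => ?_⟩
    have h1 := h y hy
    have h2 := h (y / p) (by positivity)
    rw [prod_insert hpV, copHarm_prime_mul hp hcop]
    rw [Real.log_div hy.ne' (by positivity)] at h2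
    have h3 : |(p : ℝ)⁻¹ * (copHarm (∏ q ∈ V, q) (y / p) - c * (Real.log y - Real.log p) - c₀)|
        ≤ C / y := by
      rw [abs_mul, abs_of_pos hpi0]
      calc (p : ℝ)⁻¹ * _ ≤ (p : ℝ)⁻¹ * (C / (y / p)) := by gcongr
        _ = C / y := by field_simp
    calc _ = |(copHarm (∏ q ∈ V, q) y - c * Real.log y - c₀) -
        (p : ℝ)⁻¹ * (copHarm (∏ q ∈ V, q) (y / p) - c * (Real.log y - Real.log p) - c₀)| := by
          congr 1; ring
      _ ≤ C / y + C / y := (abs_sub _ _).trans (add_le_add h1 h3)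
      _ = 2 * C / y := by ring

/-- Partial summation against a power of the distance to the endpoint. -/
lemma sum_mul_sub_pow_le {ι : Type*} (s : Finset ι) (w t : ι → ℝ) {L c C : ℝ} (hL : 0 ≤ L)
    (ht : ∀ i ∈ s, 0 ≤ t i ∧ t i ≤ L)
    (hA : ∀ x, 0 ≤ x → x ≤ L → ∑ i ∈ s with t i ≤ x, w i ≤ c * x + C) (j : ℕ) :
    ∑ i ∈ s, w i * (L - t i) ^ j ≤ c * L ^ (j + 1) / (j + 1) + C * L ^ j := by
  rcases j with _ | j
  · have h := hA L hL le_rfl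
    rw [filter_true_of_mem fun i hi => (ht i hi).2] at h
    simpa using h
  have hterm : ∀ i ∈ s, w i * (L - t i) ^ (j + 1) =
      ∫ u in (0 : ℝ)..L, Set.indicator {u | u ≤ L - t i} (fun u => w i * ((j + 1) * u ^ j)) u := by
    intro i hi
    have h := ht i hi
    rw [intervalIntegral.integral_indicator ⟨by linarith, by linarith⟩,
      intervalIntegral.integral_const_mul, intervalIntegral.integral_const_mul, integral_pow]
    have : (j + 1 : ℝ) ≠ 0 := by positivity
    have hj : (0 : ℝ) ^ (j + 1) = 0 := by simp
    rw [hj]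
    field_simp
    ring
  have hintegrable : ∀ i ∈ s, IntervalIntegrable
      (Set.indicator {u | u ≤ L - t i} (fun u => w i * ((j + 1) * u ^ j)))
      MeasureTheory.volume 0 L := by
    intro i _
    have hc : Continuous fun u : ℝ => w i * ((j + 1) * u ^ j) := by fun_prop
    have hi := (hc.intervalIntegrable (μ := MeasureTheory.volume) 0 L)
    rw [intervalIntegrable_iff] at hi ⊢
    exact hi.indicator measurableSet_Iic
  rw [sum_congr rfl hterm, ← intervalIntegral.integral_finsetSum hintegrable]
  have hval : c * L ^ (j + 1 + 1) / ((j + 1 : ℕ) + 1) + C * L ^ (j + 1) =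
      ∫ u in (0 : ℝ)..L, ((c * L + C) * (j + 1) * u ^ j - c * (j + 1) * u ^ (j + 1)) := by
    have h1 : (j + 1 : ℝ) ≠ 0 := by positivity
    have h2 : (j + 2 : ℝ) ≠ 0 := by positivity
    have h2' : (j + 1 + 1 : ℝ) ≠ 0 := by positivity
    rw [intervalIntegral.integral_sub (by apply Continuous.intervalIntegrable; fun_prop)
      (by apply Continuous.intervalIntegrable; fun_prop), intervalIntegral.integral_const_mul,
      intervalIntegral.integral_const_mul, integral_pow, integral_pow]
    push_cast
    simp
    field_simp
    ring
  rw [hval]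
  refine intervalIntegral.integral_mono_on hL ?_ ?_ ?_
  · have h : IntervalIntegrable (∑ i ∈ s,
        (Set.indicator {u | u ≤ L - t i} (fun u => w i * ((j + 1) * u ^ j))))
        MeasureTheory.volume 0 L := IntervalIntegrable.sum s hintegrable
    convert h using 1
    ext u
    simp
  · apply Continuous.intervalIntegrable; fun_prop
  · intro u hu
    have h := hA (L - u) (by linarith [hu.2]) (by linarith [hu.1])
    have hsum : ∑ i ∈ s, Set.indicator {u | u ≤ L - t i} (fun u => w i * ((j + 1) * u ^ j)) u =
        ((j + 1) * u ^ j) * ∑ i ∈ s with t i ≤ L - u, w i := by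
      rw [sum_filter, mul_sum]
      refine sum_congr rfl fun i _ => ?_
      simp only [Set.indicator, Set.mem_ofPred_eq, le_sub_comm (a := u)]
      split_ifs <;> ring
    rw [hsum]
    have hu0 : 0 ≤ (j + 1) * u ^ j := by have := hu.1; positivity
    calc _ ≤ ((j + 1) * u ^ j) * (c * (L - u) + C) := by gcongr
      _ = _ := by ring

lemma le_sum_mul_sub_pow {ι : Type*} (s : Finset ι) (w t : ι → ℝ) {L c C : ℝ} (hL : 0 ≤ L)
    (ht : ∀ i ∈ s, 0 ≤ t i ∧ t i ≤ L)
    (hA : ∀ x, 0 ≤ x → x ≤ L → c * x - C ≤ ∑ i ∈ s with t i ≤ x, w i) (j : ℕ) :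
    c * L ^ (j + 1) / (j + 1) - C * L ^ j ≤ ∑ i ∈ s, w i * (L - t i) ^ j := by
  have h := sum_mul_sub_pow_le s (fun i => -w i) t (c := -c) (C := C) hL ht (fun x hx hxL => by
    have := hA x hx hxL
    rw [sum_neg_distrib]
    linarith) j
  simp only [neg_mul, sum_neg_distrib] at h
  rw [neg_div] at h
  linarith

/-- The upper bound in Mertens' first theorem. -/
lemma sum_log_div_prime_le {n : ℕ} (hn : 1 ≤ n) :
    ∑ p ∈ (Icc 1 n).filter Nat.Prime, Real.log p / p ≤ Real.log n + Real.log 4 := by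
  have hn0 : (0 : ℝ) < n := by exact_mod_cast hn
  set s := (Icc 1 n).filter Nat.Prime with hs
  have hprime : ∀ p ∈ s, p.Prime := fun p hp => (mem_filter.1 hp).2
  have hdvd : ∏ p ∈ s, p ^ (n / p) ∣ n.factorial := by
    refine Finset.prod_dvd_of_isRelPrime ?_ ?_
    · intro p hp q hq hpq
      exact Nat.coprime_iff_isRelPrime.1 (Nat.Coprime.pow _ _
        ((Nat.coprime_primes (hprime p hp) (hprime q hq)).2 hpq))
    · intro p hp
      have hpp := hprime p hp
      have : p ^ (n / p) * (n / p).factorial ∣ (p * (n / p)).factorial := by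
        generalize n / p = m
        induction m with
        | zero => simp
        | succ m ih =>
          have h1 : (p * m).factorial * (p * (m + 1)) ∣ (p * (m + 1)).factorial := by
            obtain ⟨q, rfl⟩ : ∃ q, p = q + 1 := ⟨p - 1, by have := hpp.pos; omega⟩
            have e : (q + 1) * (m + 1) = ((q + 1) * m + q) + 1 := by ring
            rw [e, Nat.factorial_succ, mul_comm, mul_comm]
            rw [mul_comm ((q + 1) * m + q + 1)]
            exact mul_dvd_mul_right (Nat.factorial_dvd_factorial (Nat.le_add_right _ _)) _
          refine dvd_trans ?_ h1
          rw [Nat.factorial_succ, pow_succ]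
          calc p ^ m * p * ((m + 1) * m.factorial) = (p ^ m * m.factorial) * (p * (m + 1)) := by ring
            _ ∣ _ := mul_dvd_mul_right ih _
      exact (dvd_of_mul_right_dvd this).trans
        (Nat.factorial_dvd_factorial (Nat.mul_div_le n p))
  have h1 : ∑ p ∈ s, ((n / p : ℕ) : ℝ) * Real.log p ≤ n * Real.log n := by
    have hle : ((∏ p ∈ s, p ^ (n / p) : ℕ) : ℝ) ≤ (n : ℝ) ^ n := by
      exact_mod_cast (Nat.le_of_dvd (Nat.factorial_pos n) hdvd).trans (Nat.factorial_le_pow n)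
    have hpos : (0 : ℝ) < ((∏ p ∈ s, p ^ (n / p) : ℕ) : ℝ) := by
      exact_mod_cast prod_pos fun p hp => pow_pos (hprime p hp).pos _
    have := Real.log_le_log hpos hle
    rw [Real.log_pow] at this
    push_cast at this
    rw [Real.log_prod fun p hp => by have := (hprime p hp).pos; positivity] at this
    simpa [Real.log_pow] using this
  have h2 : ∑ p ∈ s, Real.log p ≤ Real.log 4 * n := by
    have h := Chebyshev.theta_le_log4_mul_x hn0.le
    rw [Chebyshev.theta, Nat.floor_natCast] at h
    refine le_trans (le_of_eq (sum_congr ?_ fun _ _ => rfl)) h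
    ext p
    simp only [hs, mem_filter, mem_Icc, mem_Ioc]
    rfl
  have h3 : ∀ p ∈ s, (n : ℝ) * (Real.log p / p) ≤ ((n / p : ℕ) : ℝ) * Real.log p + Real.log p := by
    intro p hp
    have hp0 : (0 : ℝ) < p := by exact_mod_cast (hprime p hp).pos
    have hlog : 0 ≤ Real.log p := Real.log_natCast_nonneg p
    have : (n : ℝ) / p ≤ ((n / p : ℕ) : ℝ) + 1 := by
      rw [div_le_iff₀ hp0]
      have := Nat.lt_div_mul_add (a := n) (hprime p hp).pos
      have h' : n ≤ (n / p + 1) * p := by rw [add_mul, one_mul]; exact this.le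
      exact_mod_cast h'
    calc (n : ℝ) * (Real.log p / p) = (n / p) * Real.log p := by ring
      _ ≤ (((n / p : ℕ) : ℝ) + 1) * Real.log p := by gcongr
      _ = _ := by ring
  have h4 := sum_le_sum h3
  rw [← mul_sum, sum_add_distrib] at h4
  have : (n : ℝ) * ∑ p ∈ s, Real.log p / p ≤ n * (Real.log n + Real.log 4) := by linarith
  exact le_of_mul_le_mul_left this hn0

lemma exists_sum_log_div_sq_le : ∃ C : ℝ, 0 ≤ C ∧ ∀ s : Finset ℕ, (∀ p ∈ s, 2 ≤ p) →
    ∑ p ∈ s, Real.log p / ((p : ℝ) - 1) ^ 2 ≤ C := by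
  have hsum : Summable fun n : ℕ => (8 : ℝ) * (n : ℝ) ^ (-(3 / 2) : ℝ) :=
    (Real.summable_nat_rpow.2 (by norm_num)).mul_left 8
  refine ⟨∑' n : ℕ, (8 : ℝ) * (n : ℝ) ^ (-(3 / 2) : ℝ), tsum_nonneg fun n => by positivity,
    fun s hs => ?_⟩
  refine (sum_le_sum fun p hp => ?_).trans (hsum.sum_le_tsum s fun n _ => by positivity)
  have h2 : (2 : ℝ) ≤ p := by exact_mod_cast hs p hp
  have hp0 : (0 : ℝ) < p := by linarith
  have hlog : Real.log p ≤ 2 * (p : ℝ) ^ (1 / 2 : ℝ) := by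
    have := Real.log_le_rpow_div hp0.le (show (0 : ℝ) < 1 / 2 by norm_num)
    linarith
  have hsq : (p : ℝ) ^ 2 / 4 ≤ ((p : ℝ) - 1) ^ 2 := by nlinarith
  have hp32 : (p : ℝ) ^ (-(3 / 2) : ℝ) * (p : ℝ) ^ 2 = (p : ℝ) ^ (1 / 2 : ℝ) := by
    rw [← Real.rpow_natCast, ← Real.rpow_add hp0]; norm_num
  rw [div_le_iff₀ (by nlinarith)]
  have : 0 ≤ (p : ℝ) ^ (-(3 / 2) : ℝ) := by positivity
  nlinarith [mul_le_mul_of_nonneg_left hsq this]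

/-- Mertens' first theorem (upper bound) with `p - 1` in the denominator. -/
lemma exists_sum_log_div_sub_one_le : ∃ C : ℝ, 0 ≤ C ∧ ∀ (P : Finset ℕ), (∀ p ∈ P, p.Prime) →
    ∀ x : ℝ, 0 ≤ x → ∑ p ∈ P.filter (fun p : ℕ => Real.log p ≤ x), Real.log p / ((p : ℝ) - 1) ≤ x + C := by
  obtain ⟨C, hC, h⟩ := exists_sum_log_div_sq_le
  refine ⟨Real.log 4 + C, add_nonneg (Real.log_nonneg (by norm_num)) hC, fun P hP x hx => ?_⟩
  set s := P.filter fun p : ℕ => Real.log p ≤ x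
  have hsp : ∀ p ∈ s, p.Prime := fun p hp => hP p (mem_filter.1 hp).1
  have hterm : ∀ p ∈ s, Real.log p / ((p : ℝ) - 1) ≤
      Real.log p / p + Real.log p / ((p : ℝ) - 1) ^ 2 := by
    intro p hp
    have h2 : (2 : ℝ) ≤ p := by exact_mod_cast (hsp p hp).two_le
    have hl := Real.log_natCast_nonneg p
    have : 1 / ((p : ℝ) - 1) ≤ 1 / p + 1 / ((p : ℝ) - 1) ^ 2 := by
      rw [div_add_div _ _ (by positivity) (by nlinarith),
        div_le_div_iff₀ (by linarith) (mul_pos (by linarith) (by nlinarith))]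
      nlinarith
    calc Real.log p / ((p : ℝ) - 1) = Real.log p * (1 / ((p : ℝ) - 1)) := by ring
      _ ≤ Real.log p * (1 / p + 1 / ((p : ℝ) - 1) ^ 2) := by gcongr
      _ = _ := by ring
  have hfl : 1 ≤ ⌊Real.exp x⌋₊ := Nat.le_floor (by simpa using Real.one_le_exp hx)
  have h1 : ∑ p ∈ s, Real.log p / p ≤ x + Real.log 4 := by
    calc ∑ p ∈ s, Real.log p / p
        ≤ ∑ p ∈ (Icc 1 ⌊Real.exp x⌋₊).filter Nat.Prime, Real.log p / p := by
          refine sum_le_sum_of_subset_of_nonneg ?_ fun p _ _ =>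
            div_nonneg (Real.log_natCast_nonneg p) (Nat.cast_nonneg _)
          intro p hp
          have hpp := hsp p hp
          simp only [mem_filter, mem_Icc]
          refine ⟨⟨hpp.pos, Nat.le_floor ?_⟩, hpp⟩
          rw [← Real.log_le_iff_le_exp (by exact_mod_cast hpp.pos)]
          exact (mem_filter.1 hp).2
      _ ≤ Real.log ⌊Real.exp x⌋₊ + Real.log 4 := sum_log_div_prime_le hfl
      _ ≤ x + Real.log 4 := by
          gcongr
          rw [Real.log_le_iff_le_exp (by exact_mod_cast hfl)]
          exact Nat.floor_le (Real.exp_pos x).le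
  have h2 := h s fun p hp => (hsp p hp).two_le
  have h3 := sum_le_sum hterm
  rw [sum_add_distrib] at h3
  linarith

/-- The primes up to `R` not dividing `W`. -/
def primesCop (W R : ℕ) : Finset ℕ := (Icc 1 R).filter fun p => p.Prime ∧ W.Coprime p

lemma mem_primesCop {W R p : ℕ} : p ∈ primesCop W R ↔ p ≤ R ∧ p.Prime ∧ W.Coprime p := by
  simp only [primesCop, mem_filter, mem_Icc]
  exact ⟨fun h => ⟨h.1.2, h.2⟩, fun h => ⟨⟨h.2.1.pos, h.1⟩, h.2⟩⟩

lemma prime_of_mem_powerset {W R : ℕ} {S : Finset ℕ} (hS : S ∈ (primesCop W R).powerset) :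
    ∀ p ∈ S, p.Prime := fun _ hp => (mem_primesCop.1 (mem_powerset.1 hS hp)).2.1

lemma prod_primes_pos {S : Finset ℕ} (hS : ∀ p ∈ S, p.Prime) : 0 < ∏ p ∈ S, p :=
  prod_pos fun p hp => (hS p hp).pos

/-- Nonnegative functions on `ℕ` that vanish beyond `R`. -/
structure NonnegUpTo (R : ℕ) (F : ℕ → ℝ) : Prop where
  nonneg : ∀ m, 0 ≤ F m
  zero : ∀ m, R < m → F m = 0

/-- Nonnegative functions that vanish beyond `R` and decrease on the positive integers. -/
structure DecUpTo (R : ℕ) (F : ℕ → ℝ) : Prop extends NonnegUpTo R F where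
  anti : ∀ m n, 0 < m → m ≤ n → F n ≤ F m

/-- The averaging operator `F ↦ (m ↦ ∑ F (m a) / a)` over `a` coprime to `W`. -/
noncomputable def copSum (W R : ℕ) (F : ℕ → ℝ) (m : ℕ) : ℝ := ∑ a ∈ cop W R, F (m * a) / a

lemma NonnegUpTo.copSum {W R : ℕ} {F : ℕ → ℝ} (hF : NonnegUpTo R F) :
    NonnegUpTo R (copSum W R F) where
  nonneg m := sum_nonneg fun a _ => div_nonneg (hF.nonneg _) (Nat.cast_nonneg _)
  zero m hm := sum_eq_zero fun a ha => by
    rw [hF.zero _ (hm.trans_le (Nat.le_mul_of_pos_right m (mem_cop.1 ha).1.1)), zero_div]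

lemma DecUpTo.copSum {W R : ℕ} {F : ℕ → ℝ} (hF : DecUpTo R F) : DecUpTo R (copSum W R F) where
  toNonnegUpTo := hF.toNonnegUpTo.copSum
  anti m n hm hmn := sum_le_sum fun a ha => by
    have := hF.anti (m * a) (n * a) (Nat.mul_pos hm (mem_cop.1 ha).1.1) (by gcongr)
    gcongr

lemma DecUpTo.iterate_copSum {W R : ℕ} {F : ℕ → ℝ} (hF : DecUpTo R F) (j : ℕ) :
    DecUpTo R ((AlmostPrime.copSum W R)^[j] F) := by
  induction j with
  | zero => exact hF
  | succ j ih => rw [Function.iterate_succ_apply']; exact ih.copSum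

lemma copSum_mono {W R : ℕ} {F G : ℕ → ℝ} (h : ∀ m, 0 < m → F m ≤ G m) (m : ℕ) (hm : 0 < m) :
    copSum W R F m ≤ copSum W R G m := sum_le_sum fun a ha => by
  have := h (m * a) (Nat.mul_pos hm (mem_cop.1 ha).1.1)
  gcongr

lemma iterate_copSum_mono {W R : ℕ} (j : ℕ) : ∀ {F G : ℕ → ℝ}, (∀ m, 0 < m → F m ≤ G m) →
    ∀ m, 0 < m → (copSum W R)^[j] F m ≤ (copSum W R)^[j] G m := by
  induction j with
  | zero => exact fun h => h
  | succ j ih => exact fun h => ih (copSum_mono h)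

section Powerset

variable {M : Type*} [AddCommMonoid M]

/-- Sums over ordered pairs of disjoint subsets, organised by their union. -/
lemma sum_powerset_sdiff (P : Finset ℕ) (f : Finset ℕ → Finset ℕ → M) :
    ∑ S ∈ P.powerset, ∑ A ∈ (P \ S).powerset, f S A =
      ∑ U ∈ P.powerset, ∑ S ∈ U.powerset, f S (U \ S) := by
  rw [sum_sigma', sum_sigma']
  refine sum_nbij' (fun x => ⟨x.1 ∪ x.2, x.1⟩) (fun x => ⟨x.2, x.1 \ x.2⟩) ?_ ?_ ?_ ?_ ?_
  · rintro ⟨S, A⟩ h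
    simp only [mem_sigma, mem_powerset, subset_sdiff] at h ⊢
    exact ⟨union_subset h.1 h.2.1, subset_union_left⟩
  · rintro ⟨U, S⟩ h
    simp only [mem_sigma, mem_powerset] at h ⊢
    exact ⟨h.2.trans h.1, sdiff_subset_sdiff h.1 le_rfl⟩
  · rintro ⟨S, A⟩ h
    simp only [mem_sigma, mem_powerset, subset_sdiff] at h
    simp [union_sdiff_cancel_left h.2.2.symm]
  · rintro ⟨U, S⟩ h
    simp only [mem_sigma, mem_powerset] at h
    simp [union_sdiff_of_subset h.2]
  · rintro ⟨S, A⟩ h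
    simp only [mem_sigma, mem_powerset, subset_sdiff] at h
    simp [union_sdiff_cancel_left h.2.2.symm]

end Powerset

/-- Summing over squarefree products of primes is at most summing over integers. -/
lemma sum_powerset_prod_le_sum_cop {W R : ℕ} {G : ℕ → ℝ} (hG : NonnegUpTo R G) :
    ∑ S ∈ (primesCop W R).powerset, G (∏ p ∈ S, p) ≤ ∑ b ∈ cop W R, G b := by
  have hinj : Set.InjOn (fun S : Finset ℕ => ∏ p ∈ S, p) (primesCop W R).powerset := by
    intro S hS T hT h
    have hS' := Nat.primeFactors_prod (prime_of_mem_powerset hS)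
    have hT' := Nat.primeFactors_prod (prime_of_mem_powerset hT)
    rw [← hS', ← hT']
    exact congrArg _ h
  rw [← sum_filter_add_sum_filter_not _ (fun S => ∏ p ∈ S, p ≤ R)]
  have h0 : ∑ S ∈ (primesCop W R).powerset with ¬ ∏ p ∈ S, p ≤ R, G (∏ p ∈ S, p) = 0 :=
    sum_eq_zero fun S hS => hG.zero _ (not_le.1 (mem_filter.1 hS).2)
  rw [h0, add_zero, ← sum_image (f := G) (g := fun S : Finset ℕ => ∏ p ∈ S, p)
    (hinj.mono (coe_subset.2 (filter_subset _ _)))]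
  refine sum_le_sum_of_subset_of_nonneg ?_ fun b _ _ => hG.nonneg b
  intro b hb
  obtain ⟨S, hS, rfl⟩ := mem_image.1 hb
  rw [mem_filter] at hS
  rw [mem_cop]
  refine ⟨⟨prod_primes_pos (prime_of_mem_powerset hS.1), hS.2⟩, ?_⟩
  exact Nat.Coprime.prod_right fun p hp => (mem_primesCop.1 (mem_powerset.1 hS.1 hp)).2.2

lemma sum_prod_inv_mul_le_copSum {W R : ℕ} {F : ℕ → ℝ} (hF : NonnegUpTo R F) {m : ℕ} (hm : 0 < m) :
    ∑ A ∈ (primesCop W R).powerset, (∏ p ∈ A, (p : ℝ)⁻¹) * F (m * ∏ p ∈ A, p) ≤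
      copSum W R F m := by
  have hG : NonnegUpTo R fun b => F (m * b) / b :=
    ⟨fun b => div_nonneg (hF.nonneg _) (Nat.cast_nonneg _), fun b hb => by
      rw [hF.zero _ (hb.trans_le (Nat.le_mul_of_pos_left b hm)), zero_div]⟩
  refine le_trans (le_of_eq (sum_congr rfl fun A _ => ?_)) (sum_powerset_prod_le_sum_cop (W := W) hG)
  rw [div_eq_inv_mul, prod_inv_distrib, Nat.cast_prod]

/-- Sums weighted by `j ^ ω(n) / n` are bounded by the `j`-fold averaging operator. -/
lemma sum_prod_div_mul_le_iterate {W R : ℕ} (j : ℕ) : ∀ {F : ℕ → ℝ}, NonnegUpTo R F →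
    ∀ {m : ℕ}, 0 < m →
    ∑ A ∈ (primesCop W R).powerset, (∏ p ∈ A, (j : ℝ) / p) * F (m * ∏ p ∈ A, p) ≤
      (copSum W R)^[j] F m := by
  induction j with
  | zero =>
    intro F hF m hm
    rw [sum_eq_single_of_mem ∅ (empty_mem_powerset _)]
    · simp
    · intro A _ hA
      obtain ⟨p, hp⟩ := nonempty_iff_ne_empty.2 hA
      rw [prod_eq_zero hp (by simp), zero_mul]
  | succ j ih =>
    intro F hF m hm
    rw [Function.iterate_succ_apply]
    refine le_trans ?_ (ih hF.copSum hm)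
    calc _ = ∑ U ∈ (primesCop W R).powerset, ∑ S ∈ U.powerset,
          (∏ p ∈ S, (j : ℝ) / p) * ((∏ p ∈ U \ S, (p : ℝ)⁻¹) *
            F (m * (∏ p ∈ S, p) * ∏ p ∈ U \ S, p)) := by
          refine sum_congr rfl fun U _ => ?_
          have : ∏ p ∈ U, ((j + 1 : ℕ) : ℝ) / p = ∏ p ∈ U, ((j : ℝ) / p + (p : ℝ)⁻¹) :=
            prod_congr rfl fun p _ => by push_cast; ring
          rw [this, prod_add, sum_mul]
          refine sum_congr rfl fun S hS => ?_
          rw [mul_assoc m, mul_comm (∏ p ∈ S, p), prod_sdiff (mem_powerset.1 hS)]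
          ring
      _ = ∑ S ∈ (primesCop W R).powerset, ∑ A ∈ (primesCop W R \ S).powerset,
          (∏ p ∈ S, (j : ℝ) / p) * ((∏ p ∈ A, (p : ℝ)⁻¹) * F (m * (∏ p ∈ S, p) * ∏ p ∈ A, p)) :=
          (sum_powerset_sdiff _ fun S A => (∏ p ∈ S, (j : ℝ) / p) *
            ((∏ p ∈ A, (p : ℝ)⁻¹) * F (m * (∏ p ∈ S, p) * ∏ p ∈ A, p))).symm
      _ ≤ _ := by
          refine sum_le_sum fun S hS => ?_
          rw [← mul_sum]
          refine mul_le_mul_of_nonneg_left ?_ (by positivity)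
          refine le_trans ?_ (sum_prod_inv_mul_le_copSum hF
            (Nat.mul_pos hm (prod_primes_pos (prime_of_mem_powerset hS))))
          refine sum_le_sum_of_subset_of_nonneg (powerset_mono.2 sdiff_subset) fun A _ _ => ?_
          exact mul_nonneg (by positivity) (hF.nonneg _)

lemma sum_inv_sq_le {D : ℕ} (hD : 0 < D) {s : Finset ℕ} (hs : ∀ p ∈ s, D < p) :
    ∑ p ∈ s, ((p : ℝ) ^ 2)⁻¹ ≤ 1 / D := by
  calc ∑ p ∈ s, ((p : ℝ) ^ 2)⁻¹ ≤ ∑ p ∈ Ioc D (max D (s.sup id)), ((p : ℝ) ^ 2)⁻¹ := by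
        refine sum_le_sum_of_subset_of_nonneg (fun p hp => ?_) fun _ _ _ => by positivity
        exact mem_Ioc.2 ⟨hs p hp, le_max_of_le_right (le_sup (f := id) hp)⟩
    _ ≤ (D : ℝ)⁻¹ - ((max D (s.sup id) : ℕ) : ℝ)⁻¹ :=
        sum_Ioc_inv_sq_le_sub hD.ne' (le_max_left _ _)
    _ ≤ 1 / D := by rw [one_div]; linarith [inv_nonneg.2 (Nat.cast_nonneg (α := ℝ) (max D (s.sup id)))]

/-- Upper bounds for sums weighted by a multiplicative function close to `j ^ ω(n) / n`. -/
lemma sum_prod_mul_le {W R D : ℕ} (hD : 0 < D) (hP : ∀ p ∈ primesCop W R, D < p)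
    (j : ℕ) {C B : ℝ} (hC : 0 ≤ C) {v : ℕ → ℝ}
    (hv : ∀ p ∈ primesCop W R, 0 ≤ v p ∧ v p ≤ j / p + C / (p : ℝ) ^ 2)
    {F : ℕ → ℝ} (hF : NonnegUpTo R F) (hB0 : 0 ≤ B)
    (hB : ∀ m, 0 < m → (copSum W R)^[j] F m ≤ B) :
    ∑ S ∈ (primesCop W R).powerset, (∏ p ∈ S, v p) * F (∏ p ∈ S, p) ≤ Real.exp (C / D) * B := by
  set P := primesCop W R with hPdef
  calc _ ≤ ∑ U ∈ P.powerset, ∑ S ∈ U.powerset, (∏ p ∈ U \ S, (j : ℝ) / p) *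
        ((∏ p ∈ S, C / (p : ℝ) ^ 2) * F ((∏ p ∈ S, p) * ∏ p ∈ U \ S, p)) := by
        refine sum_le_sum fun U hU => ?_
        have h1 : ∏ p ∈ U, v p ≤ ∏ p ∈ U, (C / (p : ℝ) ^ 2 + j / p) :=
          prod_le_prod (fun p hp => (hv p (mem_powerset.1 hU hp)).1) fun p hp => by
            linarith [(hv p (mem_powerset.1 hU hp)).2]
        refine (mul_le_mul_of_nonneg_right h1 (hF.nonneg _)).trans (le_of_eq ?_)
        rw [prod_add, sum_mul]
        refine sum_congr rfl fun S hS => ?_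
        rw [mul_comm (∏ p ∈ S, p), prod_sdiff (mem_powerset.1 hS)]
        ring
    _ = ∑ S ∈ P.powerset, ∑ A ∈ (P \ S).powerset, (∏ p ∈ A, (j : ℝ) / p) *
        ((∏ p ∈ S, C / (p : ℝ) ^ 2) * F ((∏ p ∈ S, p) * ∏ p ∈ A, p)) :=
        (sum_powerset_sdiff P fun S A => (∏ p ∈ A, (j : ℝ) / p) *
        ((∏ p ∈ S, C / (p : ℝ) ^ 2) * F ((∏ p ∈ S, p) * ∏ p ∈ A, p))).symm
    _ ≤ ∑ S ∈ P.powerset, (∏ p ∈ S, C / (p : ℝ) ^ 2) * B := by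
        refine sum_le_sum fun S hS => ?_
        have hpos := prod_primes_pos (prime_of_mem_powerset hS)
        calc _ ≤ ∑ A ∈ P.powerset, (∏ p ∈ A, (j : ℝ) / p) *
                ((∏ p ∈ S, C / (p : ℝ) ^ 2) * F ((∏ p ∈ S, p) * ∏ p ∈ A, p)) := by
              refine sum_le_sum_of_subset_of_nonneg (powerset_mono.2 sdiff_subset) fun A _ _ => ?_
              exact mul_nonneg (by positivity) (mul_nonneg (by positivity) (hF.nonneg _))
          _ = (∏ p ∈ S, C / (p : ℝ) ^ 2) * ∑ A ∈ P.powerset, (∏ p ∈ A, (j : ℝ) / p) *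
                F ((∏ p ∈ S, p) * ∏ p ∈ A, p) := by
              rw [mul_sum]
              exact sum_congr rfl fun A _ => by ring
          _ ≤ _ := mul_le_mul_of_nonneg_left
              ((sum_prod_div_mul_le_iterate j hF hpos).trans (hB _ hpos)) (by positivity)
    _ = (∏ p ∈ P, (1 + C / (p : ℝ) ^ 2)) * B := by rw [← sum_mul, prod_one_add]
    _ ≤ _ := by
        refine mul_le_mul_of_nonneg_right ?_ hB0
        calc ∏ p ∈ P, (1 + C / (p : ℝ) ^ 2) ≤ ∏ p ∈ P, Real.exp (C / (p : ℝ) ^ 2) :=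
              prod_le_prod (fun _ _ => by positivity) fun p _ => by
                rw [add_comm]; exact Real.add_one_le_exp _
          _ = Real.exp (∑ p ∈ P, C / (p : ℝ) ^ 2) := (Real.exp_sum _ _).symm
          _ ≤ _ := by
              rw [Real.exp_le_exp]
              have := mul_le_mul_of_nonneg_left (sum_inv_sq_le hD hP) hC
              rw [mul_sum] at this
              simpa [div_eq_mul_inv] using this

lemma sum_inv_le_prod_of_primeFactors_subset {s : Finset ℕ} (hs : ∀ p ∈ s, p.Prime) {t : Finset ℕ}
    (ht : ∀ n ∈ t, n ≠ 0 ∧ n.primeFactors ⊆ s) :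
    ∑ n ∈ t, (n : ℝ)⁻¹ ≤ ∏ p ∈ s, (p : ℝ) / (p - 1) := by
  let f : ℕ →* ℝ := { toFun := fun n => (n : ℝ)⁻¹, map_one' := by simp, map_mul' := by
                        intro x y; push_cast; rw [mul_inv] }
  have hf : ∀ {p : ℕ}, p.Prime → ‖f p‖ < 1 := fun {p} hp => by
    have : (1 : ℝ) < p := by exact_mod_cast hp.one_lt
    simpa [f] using inv_lt_one_of_one_lt₀ this
  have h := (EulerProduct.summable_and_hasSum_factoredNumbers_prod_filter_prime_geometric hf s).2
  have hprod : ∏ p ∈ s with p.Prime, (1 - f p)⁻¹ = ∏ p ∈ s, (p : ℝ) / (p - 1) := by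
    rw [filter_true_of_mem hs]
    refine prod_congr rfl fun p hp => ?_
    have : (1 : ℝ) < p := by exact_mod_cast (hs p hp).one_lt
    simp only [f, MonoidHom.coe_mk, OneHom.coe_mk]
    field_simp
  rw [← hprod]
  have hle := sum_le_hasSum (t.subtype (· ∈ Nat.factoredNumbers s))
    (fun n _ => by simp [f]) h
  have hmem : ∀ n ∈ t, n ∈ Nat.factoredNumbers s := fun n hn =>
    Nat.mem_factoredNumbers_iff_primeFactors_subset.2 (ht n hn)
  rwa [sum_subtype_of_mem (fun n : ℕ => f n) hmem] at hle

/-- The averaging operator is bounded by a weighted sum over squarefree integers. -/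
lemma DecUpTo.copSum_le_sum {W R : ℕ} {F : ℕ → ℝ} (hF : DecUpTo R F) {S : Finset ℕ}
    (hS : S ⊆ primesCop W R) {m : ℕ} (hm : 0 < m) :
    AlmostPrime.copSum W R F m ≤ (∏ p ∈ S, (p : ℝ) / (p - 1)) *
      ∑ A ∈ (primesCop W R \ S).powerset, (∏ p ∈ A, ((p : ℝ) - 1)⁻¹) * F (m * ∏ p ∈ A, p) := by
  have hprS : ∀ p ∈ S, p.Prime := fun p hp => (mem_primesCop.1 (hS hp)).2.1
  have hmaps : ∀ b ∈ cop W R, b.primeFactors \ S ∈ (primesCop W R \ S).powerset := by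
    intro b hb
    rw [mem_powerset]
    refine sdiff_subset_sdiff (fun p hp => ?_) le_rfl
    rw [mem_cop] at hb
    have hp' := Nat.mem_primeFactors.1 hp
    exact mem_primesCop.2 ⟨(Nat.le_of_dvd hb.1.1 hp'.2.1).trans hb.1.2, hp'.1,
      hb.2.coprime_dvd_right hp'.2.1⟩
  rw [AlmostPrime.copSum, ← sum_fiberwise_of_maps_to hmaps, mul_sum]
  refine sum_le_sum fun A hA => ?_
  have hA' := subset_sdiff.1 (mem_powerset.1 hA)
  have hprA : ∀ p ∈ A, p.Prime := fun p hp => (mem_primesCop.1 (hA'.1 hp)).2.1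
  have hApos := prod_primes_pos hprA
  have hdvd : ∀ b ∈ (cop W R).filter (fun b => b.primeFactors \ S = A), ∏ p ∈ A, p ∣ b := by
    intro b hb
    rw [mem_filter] at hb
    have hb0 : b ≠ 0 := by have := (mem_cop.1 hb.1).1.1; omega
    refine dvd_trans ?_ (Nat.prod_primeFactors_dvd b)
    exact prod_dvd_prod_of_subset _ _ _ (hb.2 ▸ sdiff_subset)
  calc _ ≤ ∑ b ∈ (cop W R).filter (fun b => b.primeFactors \ S = A),
        (F (m * ∏ p ∈ A, p) * (∏ p ∈ A, (p : ℝ))⁻¹) * ((b / ∏ p ∈ A, p : ℕ) : ℝ)⁻¹ := by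
        refine sum_le_sum fun b hb => ?_
        have hb1 := (mem_cop.1 (mem_filter.1 hb).1).1.1
        rw [Nat.cast_div (hdvd b hb) (by exact_mod_cast hApos.ne')]
        have hle := hF.anti (m * ∏ p ∈ A, p) (m * b) (Nat.mul_pos hm hApos)
          (Nat.mul_le_mul_left _ (Nat.le_of_dvd hb1 (hdvd b hb)))
        have hne : (∏ p ∈ A, (p : ℝ)) ≠ 0 := by rw [← Nat.cast_prod]; exact Nat.cast_ne_zero.2 hApos.ne'
        rw [Nat.cast_prod, inv_div, mul_assoc, inv_mul_eq_div, div_div, mul_comm (b : ℝ),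
          ← div_div, div_self hne, one_div, div_eq_mul_inv]
        gcongr
    _ = F (m * ∏ p ∈ A, p) * (∏ p ∈ A, (p : ℝ))⁻¹ *
        ∑ n ∈ ((cop W R).filter (fun b => b.primeFactors \ S = A)).image (· / ∏ p ∈ A, p),
          (n : ℝ)⁻¹ := by
        rw [sum_image, mul_sum]
        intro b hb c hc hbc
        have := congrArg (· * ∏ p ∈ A, p) hbc
        simpa [Nat.div_mul_cancel (hdvd b hb), Nat.div_mul_cancel (hdvd c hc)] using this
    _ ≤ F (m * ∏ p ∈ A, p) * (∏ p ∈ A, (p : ℝ))⁻¹ * ∏ p ∈ S ∪ A, (p : ℝ) / (p - 1) := by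
        refine mul_le_mul_of_nonneg_left ?_ (mul_nonneg (hF.nonneg _) (by positivity))
        refine sum_inv_le_prod_of_primeFactors_subset ?_ ?_
        · intro p hp
          exact (mem_union.1 hp).elim (hprS p) (hprA p)
        · intro n hn
          obtain ⟨b, hb, rfl⟩ := mem_image.1 hn
          have hb1 := (mem_cop.1 (mem_filter.1 hb).1).1.1
          refine ⟨(Nat.div_pos (Nat.le_of_dvd hb1 (hdvd b hb)) hApos).ne', ?_⟩
          refine (Nat.primeFactors_mono (Nat.div_dvd_of_dvd (hdvd b hb)) (by omega)).trans ?_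
          rw [← (mem_filter.1 hb).2, union_sdiff_self_eq_union]
          exact subset_union_right
    _ = _ := by
        rw [prod_union hA'.2.symm, ← prod_inv_distrib]
        have : ∏ p ∈ A, ((p : ℝ) - 1)⁻¹ = (∏ p ∈ A, (p : ℝ)⁻¹) * ∏ p ∈ A, (p : ℝ) / (p - 1) := by
          rw [← prod_mul_distrib]
          refine prod_congr rfl fun p hp => ?_
          have : (p : ℝ) ≠ 0 := by exact_mod_cast (hprA p hp).ne_zero
          rw [div_eq_mul_inv, ← mul_assoc, inv_mul_cancel₀ this, one_mul]
        rw [this]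
        ring

lemma div_sub_mul_add_inv_le {j p : ℝ} (hj : 0 ≤ j) (hp : j + 1 < p) :
    j / (p - j) * (p / (p - 1)) + (p - 1)⁻¹ ≤ (j + 1) / (p - (j + 1)) := by
  have h1 : 0 < p - j := by linarith
  have h2 : 0 < p - 1 := by linarith
  have h3 : 0 < p - (j + 1) := by linarith
  have : j / (p - j) * (p / (p - 1)) + (p - 1)⁻¹ = (j * p + p - j) / ((p - j) * (p - 1)) := by
    field_simp
    ring
  rw [this, div_le_div_iff₀ (by positivity) h3]
  nlinarith [mul_nonneg hj (h1.le.trans (by linarith : p - j ≤ p))]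

/-- Lower bounds for sums weighted by `∏ j / (p - j)`. -/
lemma DecUpTo.iterate_copSum_le_sum {W R k : ℕ} (hP : ∀ p ∈ primesCop W R, k < p) {j : ℕ}
    (hj : j ≤ k) : ∀ {F : ℕ → ℝ}, DecUpTo R F →
    (AlmostPrime.copSum W R)^[j] F 1 ≤
      ∑ S ∈ (primesCop W R).powerset, (∏ p ∈ S, (j : ℝ) / (p - j)) * F (∏ p ∈ S, p) := by
  induction j with
  | zero =>
    intro F hF
    rw [sum_eq_single_of_mem ∅ (empty_mem_powerset _)]
    · simp
    · intro A _ hA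
      obtain ⟨p, hp⟩ := nonempty_iff_ne_empty.2 hA
      rw [prod_eq_zero hp (by simp), zero_mul]
  | succ j ih =>
    intro F hF
    rw [Function.iterate_succ_apply]
    have hlt : ∀ p ∈ primesCop W R, (j : ℝ) + 1 < p := fun p hp => by
      have := hP p hp
      exact_mod_cast (by omega : j + 1 < p)
    calc _ ≤ ∑ S ∈ (primesCop W R).powerset, (∏ p ∈ S, (j : ℝ) / (p - j)) *
            AlmostPrime.copSum W R F (∏ p ∈ S, p) := ih (by omega) hF.copSum
      _ ≤ ∑ S ∈ (primesCop W R).powerset, ∑ A ∈ (primesCop W R \ S).powerset,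
            (∏ p ∈ S, (j : ℝ) / (p - j) * (p / (p - 1))) *
              ((∏ p ∈ A, ((p : ℝ) - 1)⁻¹) * F ((∏ p ∈ S, p) * ∏ p ∈ A, p)) := by
          refine sum_le_sum fun S hS => ?_
          rw [← mul_sum, prod_mul_distrib, mul_assoc]
          refine mul_le_mul_of_nonneg_left (hF.copSum_le_sum (mem_powerset.1 hS)
            (prod_primes_pos (prime_of_mem_powerset hS))) (prod_nonneg fun p hp => ?_)
          have := hlt p (mem_powerset.1 hS hp)
          exact div_nonneg (Nat.cast_nonneg _) (by linarith)
      _ = ∑ U ∈ (primesCop W R).powerset, ∑ S ∈ U.powerset,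
            (∏ p ∈ S, (j : ℝ) / (p - j) * (p / (p - 1))) *
              ((∏ p ∈ U \ S, ((p : ℝ) - 1)⁻¹) * F ((∏ p ∈ S, p) * ∏ p ∈ U \ S, p)) :=
          sum_powerset_sdiff _ fun S A => (∏ p ∈ S, (j : ℝ) / (p - j) * (p / (p - 1))) *
              ((∏ p ∈ A, ((p : ℝ) - 1)⁻¹) * F ((∏ p ∈ S, p) * ∏ p ∈ A, p))
      _ = ∑ U ∈ (primesCop W R).powerset,
            (∏ p ∈ U, ((j : ℝ) / (p - j) * (p / (p - 1)) + ((p : ℝ) - 1)⁻¹)) *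
              F (∏ p ∈ U, p) := by
          refine sum_congr rfl fun U _ => ?_
          rw [prod_add, sum_mul]
          refine sum_congr rfl fun S hS => ?_
          rw [mul_comm (∏ p ∈ S, p), prod_sdiff (mem_powerset.1 hS)]
          ring
      _ ≤ _ := by
          refine sum_le_sum fun U hU => mul_le_mul_of_nonneg_right ?_ (hF.nonneg _)
          refine prod_le_prod (fun p hp => ?_) fun p hp => ?_
          · have := hlt p (mem_powerset.1 hU hp)
            have h1 : (0 : ℝ) < p - j := by linarith
            have h2 : (0 : ℝ) < p - 1 := by
              have : (0 : ℝ) ≤ j := Nat.cast_nonneg _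
              linarith
            positivity
          · push_cast
            exact div_sub_mul_add_inv_le (Nat.cast_nonneg _) (hlt p (mem_powerset.1 hU hp))

/-- The positive integers up to `X` in the residue class `b` modulo `q`. -/
def progression (X q b : ℕ) : Finset ℕ := (Icc 1 X).filter fun n => n ≡ b [MOD q]

lemma mem_progression {X q b n : ℕ} :
    n ∈ progression X q b ↔ (1 ≤ n ∧ n ≤ X) ∧ n ≡ b [MOD q] := by
  rw [progression, mem_filter, mem_Icc]

lemma abs_card_progression_sub_le {X q b : ℕ} (hq : 0 < q) :
    |((progression X q b).card : ℝ) - X / q| ≤ 1 := by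
  have h := Nat.Ioc_filter_modEq_card 0 X hq b
  have hI : (Ioc 0 X).filter (fun n => n ≡ b [MOD q]) = progression X q b := by
    ext n; simp [mem_progression, Nat.lt_iff_add_one_le]
  rw [hI] at h
  have hq' : (0 : ℚ) < q := by exact_mod_cast hq
  have hnn : (0 : ℤ) ≤ ⌊((X : ℚ) - b) / q⌋ - ⌊(((0 : ℕ) : ℚ) - b) / q⌋ :=
    sub_nonneg.2 (Int.floor_le_floor (by gcongr; exact_mod_cast Nat.zero_le X))
  rw [max_eq_left hnn] at h
  have h' : ((progression X q b).card : ℚ) = ⌊((X : ℚ) - b) / q⌋ - ⌊(((0 : ℕ) : ℚ) - b) / q⌋ := by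
    exact_mod_cast h
  have hx : ((X : ℚ) - b) / q - (((0 : ℕ) : ℚ) - b) / q = X / q := by push_cast; ring
  have : |((progression X q b).card : ℚ) - X / q| ≤ 1 := by
    rw [h', ← hx, abs_le]
    constructor <;>
    linarith [Int.floor_le (((X : ℚ) - b) / q), Int.lt_floor_add_one (((X : ℚ) - b) / q),
      Int.floor_le ((((0 : ℕ) : ℚ) - b) / q), Int.lt_floor_add_one ((((0 : ℕ) : ℚ) - b) / q)]
  have := (Rat.cast_le (K := ℝ)).2 this
  push_cast at this
  exact this

/-- Sums of products of periodic functions over an arithmetic progression. -/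
lemma abs_sum_progression_prod_sub_le {f : ℕ → ℕ → ℝ} (X : ℕ) (S : Finset ℕ) :
    (∀ p ∈ S, p.Prime) → (∀ p ∈ S, ∀ n, f p (n % p) = f p n) → ∀ q b : ℕ, 0 < q →
    (∀ p ∈ S, q.Coprime p) →
    |∑ n ∈ progression X q b, ∏ p ∈ S, f p n -
      X / q * ∏ p ∈ S, ((∑ a ∈ range p, f p a) / p)| ≤ ∏ p ∈ S, ∑ a ∈ range p, |f p a| := by
  induction S using Finset.induction_on with
  | empty =>
    intro _ _ q b hq _
    simpa using abs_card_progression_sub_le (X := X) (b := b) hq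
  | insert p S hpS ih =>
    intro hpr hper q b hq hcop
    rw [forall_mem_insert] at hpr hper hcop
    have hp0 := hpr.1.pos
    have key : ∑ n ∈ progression X q b, ∏ r ∈ insert p S, f r n =
        ∑ a ∈ range p, f p a *
          ∑ n ∈ progression X (q * p) (Nat.chineseRemainder hcop.1 b a), ∏ r ∈ S, f r n := by
      rw [← sum_fiberwise_of_maps_to (g := fun n => n % p) (t := range p)
        fun n _ => mem_range.2 (Nat.mod_lt _ hp0)]
      refine sum_congr rfl fun a ha => ?_
      rw [mul_sum]
      have hset : (progression X q b).filter (fun n => n % p = a) =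
          progression X (q * p) (Nat.chineseRemainder hcop.1 b a) := by
        ext n
        rw [mem_filter, mem_progression, mem_progression, and_assoc,
          ← Nat.modEq_and_modEq_iff_modEq_mul hcop.1]
        refine and_congr_right fun _ => ?_
        have hc := (Nat.chineseRemainder hcop.1 b a).2
        have ha' : n % p = a ↔ n ≡ a [MOD p] := by
          rw [Nat.ModEq, Nat.mod_eq_of_lt (mem_range.1 ha)]
        rw [ha']
        exact ⟨fun h => ⟨h.1.trans hc.1.symm, h.2.trans hc.2.symm⟩,
          fun h => ⟨h.1.trans hc.1, h.2.trans hc.2⟩⟩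
      rw [← hset]
      refine sum_congr rfl fun n hn => ?_
      rw [prod_insert hpS, ← hper.1 n, (mem_filter.1 hn).2]
    have hmain : (X : ℝ) / q * ∏ r ∈ insert p S, ((∑ a ∈ range r, f r a) / r) =
        ∑ a ∈ range p, f p a *
          (X / (q * p : ℕ) * ∏ r ∈ S, ((∑ a ∈ range r, f r a) / r)) := by
      rw [prod_insert hpS, ← sum_mul]
      have : (p : ℝ) ≠ 0 := by exact_mod_cast hp0.ne'
      have : (q : ℝ) ≠ 0 := by exact_mod_cast hq.ne'
      push_cast
      field_simp
    rw [key, hmain, ← sum_sub_distrib, prod_insert hpS, sum_mul]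
    refine (abs_sum_le_sum_abs _ _).trans (sum_le_sum fun a ha => ?_)
    rw [← mul_sub, abs_mul]
    refine mul_le_mul_of_nonneg_left (ih hpr.2 hper.2 _ _ (Nat.mul_pos hq hp0) fun r hr => ?_)
      (abs_nonneg _)
    refine Nat.Coprime.mul_left (hcop.2 r hr) ((Nat.coprime_primes hpr.1 (hpr.2 r hr)).2 ?_)
    rintro rfl
    exact hpS hr

/-- Periodic functions of mean zero with prescribed mean square. -/
structure LocalFactor (ψ : ℕ → ℕ → ℝ) (u : ℕ → ℝ) (M : ℝ) (p : ℕ) : Prop where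
  prime : p.Prime
  periodic : ∀ n, ψ p (n % p) = ψ p n
  sum_eq : ∑ a ∈ range p, ψ p a = 0
  sum_sq : (∑ a ∈ range p, ψ p a ^ 2) / p = u p
  sum_abs_le : ∑ a ∈ range p, |ψ p a| ≤ M
  sum_sq_le : ∑ a ∈ range p, ψ p a ^ 2 ≤ M

lemma abs_sum_progression_mul_sub_le {ψ : ℕ → ℕ → ℝ} {u : ℕ → ℝ} {M : ℝ} (hM : 1 ≤ M)
    {Q : Finset ℕ} (hQ : ∀ p ∈ Q, LocalFactor ψ u M p) (X q b : ℕ) (hq : 0 < q)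
    (hcop : ∀ p ∈ Q, q.Coprime p) {S T : Finset ℕ} (hS : S ⊆ Q) (hT : T ⊆ Q) :
    |∑ n ∈ progression X q b, (∏ p ∈ S, ψ p n) * ∏ p ∈ T, ψ p n -
      X / q * (if S = T then ∏ p ∈ S, u p else 0)| ≤ M ^ S.card * M ^ T.card := by
  let f : ℕ → ℕ → ℝ := fun p n => (if p ∈ S then ψ p n else 1) * if p ∈ T then ψ p n else 1
  have hST : S ∪ T ⊆ Q := union_subset hS hT
  have h := abs_sum_progression_prod_sub_le (f := f) X (S ∪ T) (fun p hp => (hQ p (hST hp)).prime)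
    (fun p hp n => by simp only [f, (hQ p (hST hp)).periodic n]) q b hq fun p hp => hcop p (hST hp)
  have h1 : ∀ n, ∏ p ∈ S ∪ T, f p n = (∏ p ∈ S, ψ p n) * ∏ p ∈ T, ψ p n := fun n => by
    simp only [f, prod_mul_distrib, prod_ite_mem]
    rw [inter_eq_right.2 subset_union_left, inter_eq_right.2 subset_union_right]
  have h2 : ∏ p ∈ S ∪ T, ((∑ a ∈ range p, f p a) / p) = if S = T then ∏ p ∈ S, u p else 0 := by
    split_ifs with hE
    · subst hE
      rw [union_self]
      refine prod_congr rfl fun p hp => ?_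
      rw [← (hQ p (hS hp)).sum_sq]
      simp [f, hp, sq]
    · obtain ⟨p, hp⟩ := symmDiff_nonempty.2 hE
      rw [mem_symmDiff] at hp
      rcases hp with hp | hp
      · refine prod_eq_zero (mem_union_left _ hp.1) ?_
        simp [f, hp.1, hp.2, (hQ p (hS hp.1)).sum_eq]
      · refine prod_eq_zero (mem_union_right _ hp.1) ?_
        simp [f, hp.1, hp.2, (hQ p (hT hp.1)).sum_eq]
  simp only [h1] at h
  rw [h2] at h
  refine h.trans ?_
  calc ∏ p ∈ S ∪ T, ∑ a ∈ range p, |f p a| ≤ ∏ _p ∈ S ∪ T, M := by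
        refine prod_le_prod (fun p _ => sum_nonneg fun _ _ => abs_nonneg _) fun p hp => ?_
        have hp' := hQ p (hST hp)
        by_cases h1 : p ∈ S <;> by_cases h2 : p ∈ T
        · simpa [f, h1, h2, ← sq] using hp'.sum_sq_le
        · simpa [f, h1, h2] using hp'.sum_abs_le
        · simpa [f, h1, h2] using hp'.sum_abs_le
        · simp [h1, h2] at hp
    _ ≤ M ^ (S.card + T.card) := by
        rw [prod_const]
        exact pow_le_pow_right₀ hM (card_union_le S T)
    _ = _ := pow_add _ _ _

/-- The mean square over a progression of a linear combination of products of local factors. -/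
lemma abs_sum_progression_sq_sub_le {ψ : ℕ → ℕ → ℝ} {u : ℕ → ℝ} {M : ℝ} (hM : 1 ≤ M)
    {Q : Finset ℕ} (hQ : ∀ p ∈ Q, LocalFactor ψ u M p) (X q b : ℕ) (hq : 0 < q)
    (hcop : ∀ p ∈ Q, q.Coprime p) (y : Finset ℕ → ℝ) :
    |∑ n ∈ progression X q b, (∑ S ∈ Q.powerset, y S * ∏ p ∈ S, ψ p n) ^ 2 -
      X / q * ∑ S ∈ Q.powerset, (∏ p ∈ S, u p) * y S ^ 2| ≤
      (∑ S ∈ Q.powerset, |y S| * M ^ S.card) ^ 2 := by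
  have hexp : ∑ n ∈ progression X q b, (∑ S ∈ Q.powerset, y S * ∏ p ∈ S, ψ p n) ^ 2 =
      ∑ S ∈ Q.powerset, ∑ T ∈ Q.powerset, y S * y T *
        ∑ n ∈ progression X q b, (∏ p ∈ S, ψ p n) * ∏ p ∈ T, ψ p n := by
    simp only [sq, sum_mul_sum]
    rw [sum_comm]
    refine sum_congr rfl fun S _ => ?_
    rw [sum_comm]
    refine sum_congr rfl fun T _ => ?_
    rw [mul_sum]
    exact sum_congr rfl fun n _ => by ring
  have hdiag : (X : ℝ) / q * ∑ S ∈ Q.powerset, (∏ p ∈ S, u p) * y S ^ 2 =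
      ∑ S ∈ Q.powerset, ∑ T ∈ Q.powerset, y S * y T *
        (X / q * if S = T then ∏ p ∈ S, u p else 0) := by
    rw [mul_sum]
    refine sum_congr rfl fun S hS => ?_
    rw [sum_eq_single_of_mem S hS fun T _ hT => by simp [hT.symm]]
    simp
    ring
  rw [hexp, hdiag, ← sum_sub_distrib, sq, sum_mul_sum]
  refine (abs_sum_le_sum_abs _ _).trans (sum_le_sum fun S hS => ?_)
  rw [← sum_sub_distrib]
  refine (abs_sum_le_sum_abs _ _).trans (sum_le_sum fun T hT => ?_)
  rw [← mul_sub, abs_mul, abs_mul]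
  calc _ ≤ |y S| * |y T| * (M ^ S.card * M ^ T.card) :=
        mul_le_mul_of_nonneg_left (abs_sum_progression_mul_sub_le hM hQ X q b hq hcop
          (mem_powerset.1 hS) (mem_powerset.1 hT)) (by positivity)
    _ = _ := by ring

/-- Linear forms with nonnegative coefficients, together with a residue class modulo the product
of the primes up to `D` on which they have no small prime factors. -/
structure SieveSetup (k : ℕ) where
  a : Fin k → ℕ
  b : Fin k → ℕ
  D : ℕ
  n₀ : ℕ
  k_pos : 0 < k
  a_pos : ∀ i, 0 < a i
  b_pos : ∀ i, 0 < b i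
  lt_D : 2 * k + 2 ≤ D
  coprime : ∀ i, (primorial D).Coprime (a i * n₀ + b i)
  not_dvd_a : ∀ i p, p.Prime → D < p → ¬ p ∣ a i
  not_dvd_det : ∀ i j, i ≠ j → ∀ p : ℕ, p.Prime → D < p →
    ¬ (p : ℤ) ∣ (a i : ℤ) * b j - a j * b i

lemma primorial_coprime_prime_iff {D p : ℕ} (hp : p.Prime) : (primorial D).Coprime p ↔ D < p := by
  rw [Nat.coprime_comm, hp.coprime_iff_not_dvd, primorial, hp.prime.dvd_finsetProd_iff]
  simp only [mem_filter, mem_range, not_exists, not_and]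
  constructor
  · intro h
    by_contra! hle
    exact h p ⟨by omega, hp⟩ dvd_rfl
  · intro h q hq hpq
    have := Nat.le_of_dvd hq.2.pos hpq
    omega

/-- The linear congruence `e ∣ a n + b` is a residue class. -/
lemma exists_forall_dvd_iff_modEq {a e : ℕ} (h : a.Coprime e) (he : 0 < e) (b : ℕ) :
    ∃ y, ∀ n, e ∣ a * n + b ↔ n ≡ y [MOD e] := by
  obtain ⟨x, hx0, hx⟩ := Nat.chineseRemainder h 0 (b * (e - 1))
  obtain ⟨y, rfl⟩ := (Nat.modEq_zero_iff_dvd).1 hx0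
  have hy : e ∣ a * y + b := by
    have h1 : a * y + b ≡ b * (e - 1) + b [MOD e] := hx.add_right b
    have h2 : b * (e - 1) + b = b * e := by
      obtain ⟨e, rfl⟩ := Nat.exists_eq_succ_of_ne_zero he.ne'
      simp [Nat.mul_succ]
    rw [h2] at h1
    exact (Nat.modEq_zero_iff_dvd).1 (h1.trans ((Nat.modEq_zero_iff_dvd).2 (dvd_mul_left e b)))
  refine ⟨y, fun n => ⟨fun hn => ?_, fun hn => ?_⟩⟩
  · have h1 : a * n + b ≡ a * y + b [MOD e] :=
      ((Nat.modEq_zero_iff_dvd).2 hn).trans ((Nat.modEq_zero_iff_dvd).2 hy).symm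
    exact Nat.ModEq.cancel_left_of_coprime h.symm (Nat.ModEq.add_right_cancel' b h1)
  · have h1 : a * n + b ≡ a * y + b [MOD e] := (hn.mul_left a).add_right b
    exact (Nat.modEq_zero_iff_dvd).1 (h1.trans ((Nat.modEq_zero_iff_dvd).2 hy))

namespace SieveSetup

variable {k : ℕ} (s : SieveSetup k)

/-- The values of the linear forms. -/
def L (i : Fin k) (n : ℕ) : ℕ := s.a i * n + s.b i

/-- The modulus. -/
def W : ℕ := primorial s.D

lemma W_pos : 0 < s.W := primorial_pos _

/-- The local factors of the sieve weights. -/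
noncomputable def ψ (p n : ℕ) : ℝ := if ∃ i, p ∣ s.L i n then -1 else (k : ℝ) / (p - k)

lemma a_coprime {e : ℕ} (he : s.W.Coprime e) (i : Fin k) : (s.a i).Coprime e := by
  refine Nat.coprime_of_dvd fun p hp hpa hpe => ?_
  exact s.not_dvd_a i p hp ((primorial_coprime_prime_iff hp).1 (he.coprime_dvd_right hpe)) hpa

lemma exists_dvd_L_iff {e : ℕ} (he : s.W.Coprime e) (i : Fin k) (he0 : 0 < e) :
    ∃ y, ∀ n, e ∣ s.L i n ↔ n ≡ y [MOD e] := exists_forall_dvd_iff_modEq (s.a_coprime he i) he0 _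

lemma card_filter_dvd {p : ℕ} (hp : p.Prime) (hD : s.D < p) :
    ((range p).filter fun r => ∃ i, p ∣ s.L i r).card = k := by
  have hcop : s.W.Coprime p := (primorial_coprime_prime_iff hp).2 hD
  choose y hy using fun i => s.exists_dvd_L_iff hcop i hp.pos
  have himg : (range p).filter (fun r => ∃ i, p ∣ s.L i r) =
      (univ : Finset (Fin k)).image fun i => y i % p := by
    ext r
    simp only [mem_filter, mem_range, mem_image, mem_univ, true_and, hy]
    constructor
    · rintro ⟨hr, i, hi⟩
      exact ⟨i, by rw [← hi, Nat.mod_eq_of_lt hr]⟩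
    · rintro ⟨i, rfl⟩
      exact ⟨Nat.mod_lt _ hp.pos, i, Nat.mod_modEq _ _⟩
  rw [himg, card_image_of_injective, card_univ, Fintype.card_fin]
  intro i j hij
  by_contra hne
  have h1 : p ∣ s.L i (y i) := (hy i _).2 rfl
  have h2 : p ∣ s.L j (y i) := (hy j _).2 hij
  refine s.not_dvd_det i j hne p hp hD ?_
  have h1' : (p : ℤ) ∣ (s.a i : ℤ) * y i + s.b i := by exact_mod_cast h1
  have h2' : (p : ℤ) ∣ (s.a j : ℤ) * y i + s.b j := by exact_mod_cast h2
  have := (h2'.mul_left (s.a i)).sub (h1'.mul_left (s.a j))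
  have e : (s.a i : ℤ) * (s.a j * y i + s.b j) - s.a j * (s.a i * y i + s.b i) =
      s.a i * s.b j - s.a j * s.b i := by ring
  rwa [e] at this

lemma localFactor {p : ℕ} (hp : p.Prime) (hD : s.D < p) :
    LocalFactor s.ψ (fun p => (k : ℝ) / (p - k)) (2 * k) p := by
  have hpk : (2 * k : ℝ) < p := by
    have := s.lt_D
    exact_mod_cast (by omega : 2 * k < p)
  have hk : (0 : ℝ) < k := by exact_mod_cast s.k_pos
  have hsum : ∀ g : ℝ → ℝ, ∑ a ∈ range p, g (s.ψ p a) =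
      k * g (-1) + (p - k) * g (k / (p - k)) := by
    intro g
    rw [← sum_filter_add_sum_filter_not _ fun r => ∃ i, p ∣ s.L i r]
    congr 1
    · rw [sum_congr rfl (g := fun _ => g (-1))
        fun r hr => by rw [ψ, if_pos (mem_filter.1 hr).2], sum_const, s.card_filter_dvd hp hD,
        nsmul_eq_mul]
    · rw [sum_congr rfl (g := fun _ => g (k / (p - k)))
        fun r hr => by rw [ψ, if_neg (mem_filter.1 hr).2], sum_const, nsmul_eq_mul]
      congr 1
      have := card_filter_add_card_filter_not (s := range p) fun r => ∃ i, p ∣ s.L i r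
      rw [s.card_filter_dvd hp hD, card_range] at this
      rw [eq_sub_iff_add_eq']
      exact_mod_cast this
  have hpk' : (0 : ℝ) < p - k := by linarith
  have hsq : ∑ a ∈ range p, s.ψ p a ^ 2 = k * p / (p - k) := by
    rw [hsum fun x => x ^ 2]
    field_simp
    ring
  refine ⟨hp, fun n => ?_, ?_, ?_, ?_, ?_⟩
  · have : ∀ i, p ∣ s.L i (n % p) ↔ p ∣ s.L i n := fun i => by
      have : s.L i (n % p) ≡ s.L i n [MOD p] := ((Nat.mod_modEq n p).mul_left _).add_right _
      exact this.dvd_iff dvd_rfl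
    simp only [ψ, this]
  · rw [hsum fun x => x]
    field_simp
    ring
  · rw [hsq]
    have : (p : ℝ) ≠ 0 := by exact_mod_cast hp.ne_zero
    field_simp
  · rw [hsum fun x => |x|, abs_of_nonneg (by positivity : 0 ≤ (k : ℝ) / (p - k))]
    refine le_of_eq ?_
    field_simp
    norm_num
  · rw [hsq, div_le_iff₀ hpk']
    nlinarith

/-- The sieve weight attached to coefficients `Y`. -/
noncomputable def Λ (P : Finset ℕ) (Y : Finset ℕ → ℝ) (n : ℕ) : ℝ :=
  ∑ S ∈ P.powerset, Y S * ∏ p ∈ S, s.ψ p n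

/-- The total size of the error terms. -/
def errSum (k : ℕ) (P : Finset ℕ) (Y : Finset ℕ → ℝ) : ℝ :=
  ∑ S ∈ P.powerset, |Y S| * (2 * k) ^ S.card

lemma exists_filter_dvd_eq_progression {e : ℕ} (he : s.W.Coprime e) (he0 : 0 < e) (X : ℕ)
    (i : Fin k) : ∃ y, (progression X s.W s.n₀).filter (fun n => e ∣ s.L i n) =
      progression X (s.W * e) y := by
  obtain ⟨y, hy⟩ := s.exists_dvd_L_iff he i he0
  refine ⟨Nat.chineseRemainder he s.n₀ y, ?_⟩
  have hc := (Nat.chineseRemainder he s.n₀ y).2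
  ext n
  rw [mem_filter, mem_progression, mem_progression, and_assoc, hy,
    ← Nat.modEq_and_modEq_iff_modEq_mul he]
  exact and_congr_right fun _ => ⟨fun h => ⟨h.1.trans hc.1.symm, h.2.trans hc.2.symm⟩,
    fun h => ⟨h.1.trans hc.1, h.2.trans hc.2⟩⟩

end SieveSetup

lemma sum_powerset_eq_sum_sum {M : Type*} [AddCommMonoid M] {P Q : Finset ℕ} (hQ : Q ⊆ P)
    (f : Finset ℕ → M) : ∑ T ∈ P.powerset, f T =
      ∑ S ∈ (P \ Q).powerset, ∑ F ∈ Q.powerset, f (S ∪ F) := by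
  rw [← sum_product']
  refine sum_nbij' (fun T => (T \ Q, T ∩ Q)) (fun x => x.1 ∪ x.2) ?_ ?_ ?_ ?_ ?_
  · intro T hT
    simp only [mem_product, mem_powerset] at hT ⊢
    exact ⟨sdiff_subset_sdiff hT le_rfl, inter_subset_right⟩
  · rintro ⟨S, F⟩ h
    simp only [mem_product, mem_powerset] at h ⊢
    exact union_subset (h.1.trans sdiff_subset) (h.2.trans hQ)
  · intro T _
    exact sdiff_union_inter T Q
  · rintro ⟨S, F⟩ h
    simp only [mem_product, mem_powerset, subset_sdiff] at h
    refine Prod.ext ?_ ?_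
    · simp [union_sdiff_distrib, sdiff_eq_empty_iff_subset.2 h.2, sdiff_eq_self_of_disjoint h.1.2]
    · simp [union_inter_distrib_right, disjoint_iff_inter_eq_empty.1 h.1.2, inter_eq_left.2 h.2]
  · intro T _
    exact congrArg f (sdiff_union_inter T Q).symm

namespace SieveSetup

variable {k : ℕ} (s : SieveSetup k)

/-- The weighted mean square over the `n` for which `e` divides a linear form. -/
lemma abs_sum_sq_sub_le {R e : ℕ} (Y : Finset ℕ → ℝ) (he : s.W.Coprime e) (he0 : 0 < e) (X : ℕ)
    (i : Fin k) :
    |∑ n ∈ (progression X s.W s.n₀).filter (fun n => e ∣ s.L i n),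
        s.Λ (primesCop s.W R) Y n ^ 2 -
      X / (s.W * e) * ∑ S ∈ (primesCop s.W R \ (primesCop s.W R).filter (· ∣ e)).powerset,
        (∏ p ∈ S, (k : ℝ) / (p - k)) *
          (∑ F ∈ ((primesCop s.W R).filter (· ∣ e)).powerset, (-1) ^ F.card * Y (S ∪ F)) ^ 2| ≤
      errSum k (primesCop s.W R) Y ^ 2 := by
  set P := primesCop s.W R with hP
  set Q := P.filter (· ∣ e) with hQ
  have hQP : Q ⊆ P := filter_subset _ _
  have hk : (1 : ℝ) ≤ 2 * k := by
    have := s.k_pos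
    exact_mod_cast (by omega : 1 ≤ 2 * k)
  obtain ⟨y, hy⟩ := s.exists_filter_dvd_eq_progression he he0 X i
  have hΛ : ∀ n ∈ progression X (s.W * e) y, s.Λ P Y n =
      ∑ S ∈ (P \ Q).powerset, (∑ F ∈ Q.powerset, (-1) ^ F.card * Y (S ∪ F)) * ∏ p ∈ S, s.ψ p n := by
    intro n hn
    rw [← hy, mem_filter] at hn
    rw [Λ, sum_powerset_eq_sum_sum hQP]
    refine sum_congr rfl fun S hS => ?_
    rw [sum_mul]
    refine sum_congr rfl fun F hF => ?_
    have hdisj : Disjoint S F :=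
      (subset_sdiff.1 (mem_powerset.1 hS)).2.mono_right (mem_powerset.1 hF)
    have : ∏ p ∈ F, s.ψ p n = (-1) ^ F.card := by
      rw [← prod_const]
      refine prod_congr rfl fun p hp => ?_
      have hpe : p ∣ e := (mem_filter.1 (mem_powerset.1 hF hp)).2
      rw [ψ, if_pos ⟨i, hpe.trans hn.2⟩]
    rw [prod_union hdisj, this]
    ring
  rw [hy, sum_congr rfl fun n hn => by rw [hΛ n hn]]
  have hmem : ∀ p ∈ P \ Q, p.Prime ∧ s.D < p ∧ ¬ p ∣ e := by
    intro p hp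
    rw [mem_sdiff, hQ, mem_filter, not_and] at hp
    have h1 := mem_primesCop.1 hp.1
    exact ⟨h1.2.1, (primorial_coprime_prime_iff h1.2.1).1 h1.2.2, hp.2 hp.1⟩
  have h := abs_sum_progression_sq_sub_le hk (Q := P \ Q)
    (fun p hp => s.localFactor (hmem p hp).1 (hmem p hp).2.1) X (s.W * e) y
    (Nat.mul_pos s.W_pos he0) (fun p hp => by
      have := hmem p hp
      refine Nat.Coprime.mul_left ((primorial_coprime_prime_iff this.1).2 this.2.1) ?_
      exact ((this.1.coprime_iff_not_dvd).2 this.2.2).symm)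
    fun S => ∑ F ∈ Q.powerset, (-1) ^ F.card * Y (S ∪ F)
  push_cast at h
  refine h.trans ?_
  have h0 : (0 : ℝ) ≤ 2 * k := by linarith
  refine pow_le_pow_left₀ (sum_nonneg fun S _ => by positivity) ?_ 2
  rw [errSum, sum_powerset_eq_sum_sum hQP]
  refine sum_le_sum fun S hS => ?_
  calc _ ≤ (∑ F ∈ Q.powerset, |Y (S ∪ F)|) * (2 * k : ℝ) ^ S.card := by
        refine mul_le_mul_of_nonneg_right ((abs_sum_le_sum_abs _ _).trans (le_of_eq ?_))
          (by positivity)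
        exact sum_congr rfl fun F _ => by rw [abs_mul, abs_pow, abs_neg, abs_one, one_pow, one_mul]
    _ ≤ _ := by
        rw [sum_mul]
        refine sum_le_sum fun F _ => mul_le_mul_of_nonneg_left ?_ (abs_nonneg _)
        exact pow_le_pow_right₀ hk (card_le_card subset_union_left)

end SieveSetup

lemma sum_powerset_filter_subset {M : Type*} [AddCommMonoid M] {N G : Finset ℕ} (hG : G ⊆ N)
    (v : Finset ℕ → M) : ∑ F ∈ N.powerset with G ⊆ F, v F =
      ∑ A ∈ (N \ G).powerset, v (G ∪ A) := by
  refine sum_nbij' (fun F => F \ G) (fun A => G ∪ A) ?_ ?_ ?_ ?_ ?_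
  · intro F hF
    simp only [mem_filter, mem_powerset] at hF ⊢
    exact sdiff_subset_sdiff hF.1 le_rfl
  · intro A hA
    simp only [mem_filter, mem_powerset] at hA ⊢
    exact ⟨union_subset hG (hA.trans sdiff_subset), subset_union_left⟩
  · intro F hF
    exact union_sdiff_of_subset (mem_filter.1 hF).2
  · intro A hA
    exact union_sdiff_cancel_left (subset_sdiff.1 (mem_powerset.1 hA)).2.symm
  · intro F hF
    rw [union_sdiff_of_subset (mem_filter.1 hF).2]

/-- Diagonalisation of the quadratic form with coefficients `∏ (F₁ ∩ F₂)`. -/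
lemma sum_sum_mul_prod_inter (N : Finset ℕ) (v : Finset ℕ → ℝ) :
    ∑ F ∈ N.powerset, ∑ F' ∈ N.powerset, v F * v F' * ∏ p ∈ F ∩ F', (p : ℝ) =
      ∑ G ∈ N.powerset, (∏ p ∈ G, ((p : ℝ) - 1)) *
        (∑ F ∈ N.powerset with G ⊆ F, v F) ^ 2 := by
  have h1 : ∀ F ∈ N.powerset, ∀ F' ∈ N.powerset, v F * v F' * ∏ p ∈ F ∩ F', (p : ℝ) =
      ∑ G ∈ N.powerset, (∏ p ∈ G, ((p : ℝ) - 1)) *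
        ((if G ⊆ F then v F else 0) * if G ⊆ F' then v F' else 0) := by
    intro F hF F' hF'
    have : ∏ p ∈ F ∩ F', (p : ℝ) = ∑ G ∈ (F ∩ F').powerset, ∏ p ∈ G, ((p : ℝ) - 1) := by
      rw [← prod_one_add]
      exact prod_congr rfl fun p _ => by ring
    rw [this, mul_sum]
    have hsub : (F ∩ F').powerset = N.powerset.filter fun G => G ⊆ F ∧ G ⊆ F' := by
      ext G
      simp only [mem_powerset, mem_filter, subset_inter_iff]
      exact ⟨fun h => ⟨h.1.trans (mem_powerset.1 hF), h⟩, fun h => h.2⟩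
    rw [hsub, sum_filter]
    refine sum_congr rfl fun G _ => ?_
    by_cases hG : G ⊆ F <;> by_cases hG' : G ⊆ F' <;> simp [hG, hG']
    ring
  rw [sum_congr rfl fun F hF => sum_congr rfl fun F' hF' => h1 F hF F' hF']
  rw [sum_congr rfl fun F _ => sum_comm, sum_comm]
  refine sum_congr rfl fun G _ => ?_
  rw [sq, sum_filter, sum_mul_sum, mul_sum]
  exact sum_congr rfl fun F _ => by rw [mul_sum]

lemma sum_sum_mul_prod_inter_of_mem_union {N : Finset ℕ} {p : ℕ} (hp : p ∈ N)
    (v : Finset ℕ → ℝ) {ζ : Finset ℕ → ℝ}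
    (hζ : ∀ G ⊆ N, ∑ F ∈ N.powerset with G ⊆ F, v F = ζ G) :
    ∑ F ∈ N.powerset, ∑ F' ∈ N.powerset,
        (if p ∈ F ∪ F' then v F * v F' * ∏ r ∈ F ∩ F', (r : ℝ) else 0) =
      ∑ G ∈ (N.erase p).powerset, (∏ r ∈ G, ((r : ℝ) - 1)) *
        (2 * ζ G * ζ (insert p G) + (p - 2) * ζ (insert p G) ^ 2) := by
  have hsub : (N.erase p).powerset = N.powerset.filter fun F => p ∉ F := by
    ext F
    simp only [mem_powerset, mem_filter, subset_erase]
  have hrest : ∑ F ∈ (N.erase p).powerset, ∑ F' ∈ (N.erase p).powerset,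
      v F * v F' * ∏ r ∈ F ∩ F', (r : ℝ) = ∑ F ∈ N.powerset, ∑ F' ∈ N.powerset,
        (if p ∈ F ∪ F' then 0 else v F * v F' * ∏ r ∈ F ∩ F', (r : ℝ)) := by
    rw [hsub, sum_filter]
    refine sum_congr rfl fun F _ => ?_
    rw [sum_filter]
    by_cases hF : p ∈ F
    · simp [hF]
    · simp only [hF, not_false_eq_true, if_true, mem_union, false_or]
      exact sum_congr rfl fun F' _ => by by_cases hF' : p ∈ F' <;> simp [hF']
  have htot : ∑ F ∈ N.powerset, ∑ F' ∈ N.powerset,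
        (if p ∈ F ∪ F' then v F * v F' * ∏ r ∈ F ∩ F', (r : ℝ) else 0) +
      ∑ F ∈ (N.erase p).powerset, ∑ F' ∈ (N.erase p).powerset,
        v F * v F' * ∏ r ∈ F ∩ F', (r : ℝ) =
      ∑ F ∈ N.powerset, ∑ F' ∈ N.powerset, v F * v F' * ∏ r ∈ F ∩ F', (r : ℝ) := by
    rw [hrest, ← sum_add_distrib]
    refine sum_congr rfl fun F _ => ?_
    rw [← sum_add_distrib]
    exact sum_congr rfl fun F' _ => by by_cases h : p ∈ F ∪ F' <;> simp [h]
  have hdiff : ∀ G ∈ (N.erase p).powerset,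
      ∑ F ∈ (N.erase p).powerset with G ⊆ F, v F = ζ G - ζ (insert p G) := by
    intro G hG
    rw [mem_powerset] at hG
    rw [← hζ G (hG.trans (erase_subset _ _)),
      ← hζ (insert p G) (insert_subset hp (hG.trans (erase_subset _ _))), eq_sub_iff_add_eq, hsub]
    simp only [sum_filter]
    rw [← sum_add_distrib]
    refine sum_congr rfl fun F _ => ?_
    by_cases h1 : p ∈ F <;> by_cases h2 : G ⊆ F <;> simp [h1, h2, insert_subset_iff]
  rw [← eq_sub_iff_add_eq] at htot
  rw [htot, sum_sum_mul_prod_inter, sum_sum_mul_prod_inter,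
    sum_congr rfl fun G hG => by rw [hζ G (mem_powerset.1 hG)],
    sum_congr (s₁ := (N.erase p).powerset) rfl fun G hG => by rw [hdiff G hG]]
  conv_lhs => rw [← insert_erase hp]
  rw [sum_powerset_insert (notMem_erase p N), erase_insert (notMem_erase p N), ← sum_add_distrib,
    ← sum_sub_distrib]
  refine sum_congr rfl fun G hG => ?_
  have hpG : p ∉ G := fun h => notMem_erase p N (mem_powerset.1 hG h)
  rw [prod_insert hpG]
  ring

/-- Möbius inversion for the coefficients of the sieve. -/
lemma sum_filter_subset_neg_one_pow_mul {N G : Finset ℕ} (hG : G ⊆ N) (t : Finset ℕ → ℝ) :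
    ∑ F ∈ N.powerset with G ⊆ F, (-1) ^ F.card * ∑ A ∈ (N \ F).powerset, t (F ∪ A) =
      (-1) ^ G.card * t G := by
  rw [sum_powerset_filter_subset hG]
  have h1 : ∀ F ∈ (N \ G).powerset, (-1 : ℝ) ^ (G ∪ F).card *
      ∑ A ∈ (N \ (G ∪ F)).powerset, t (G ∪ F ∪ A) =
      ∑ A ∈ ((N \ G) \ F).powerset, (-1) ^ G.card * ((-1) ^ F.card * t (G ∪ (F ∪ A))) := by
    intro F hF
    rw [card_union_of_disjoint (subset_sdiff.1 (mem_powerset.1 hF)).2.symm, pow_add,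
      Finset.sdiff_sdiff_left', ← sdiff_union_distrib, mul_sum]
    exact sum_congr rfl fun A _ => by rw [union_assoc]; ring
  rw [sum_congr rfl h1, sum_powerset_sdiff (N \ G) fun F A =>
    (-1 : ℝ) ^ G.card * ((-1) ^ F.card * t (G ∪ (F ∪ A)))]
  have h2 : ∀ U ∈ (N \ G).powerset, ∑ S ∈ U.powerset,
      (-1 : ℝ) ^ G.card * ((-1) ^ S.card * t (G ∪ (S ∪ U \ S))) =
      (-1) ^ G.card * t (G ∪ U) * ((∑ S ∈ U.powerset, (-1 : ℤ) ^ S.card : ℤ) : ℝ) := by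
    intro U _
    push_cast
    rw [mul_sum]
    refine sum_congr rfl fun S hS => ?_
    rw [union_sdiff_of_subset (mem_powerset.1 hS)]
    ring
  rw [sum_congr rfl h2, sum_eq_single_of_mem ∅ (empty_mem_powerset _)]
  · simp
  · intro U _ hU
    rw [sum_powerset_neg_one_pow_card, if_neg hU]
    simp

/-- The sieve coefficients obtained from a smooth cut-off `Z`. -/
noncomputable def sieveY (P : Finset ℕ) (Z : ℕ → ℝ) (S : Finset ℕ) : ℝ :=
  (∏ p ∈ S, (p : ℝ) / (p - 1)) *
    ∑ A ∈ (P \ S).powerset, (∏ p ∈ A, ((p : ℝ) - 1)⁻¹) * Z ((∏ p ∈ S, p) * ∏ p ∈ A, p)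

lemma sum_cop_filter_dvd_inv {W d : ℕ} (hd : 0 < d) (hWd : W.Coprime d) (E : ℕ) :
    ∑ e ∈ cop W E with d ∣ e, (e : ℝ)⁻¹ = (d : ℝ)⁻¹ * copHarm W ((E : ℝ) / d) := by
  rw [copHarm, Nat.floor_div_eq_div, mul_sum]
  symm
  refine sum_nbij' (fun e => d * e) (fun e => e / d) ?_ ?_ ?_ ?_ ?_
  · intro e he
    rw [mem_cop] at he
    rw [mem_filter, mem_cop]
    refine ⟨⟨⟨Nat.mul_pos hd he.1.1, ?_⟩, hWd.mul_right he.2⟩, dvd_mul_right _ _⟩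
    exact (Nat.mul_le_mul_left d he.1.2).trans (Nat.mul_div_le E d)
  · intro e he
    rw [mem_filter, mem_cop] at he
    rw [mem_cop]
    exact ⟨⟨Nat.div_pos (Nat.le_of_dvd he.1.1.1 he.2) hd, Nat.div_le_div_right he.1.1.2⟩,
      he.1.2.coprime_dvd_right (Nat.div_dvd_of_dvd he.2)⟩
  · intro e _
    exact Nat.mul_div_cancel_left e hd
  · intro e he
    exact Nat.mul_div_cancel' (mem_filter.1 he).2
  · intro e _
    push_cast
    rw [mul_inv]

lemma prod_dvd_iff_subset_filter {P F : Finset ℕ} (hP : ∀ p ∈ P, p.Prime) (hF : F ⊆ P) (e : ℕ) :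
    ∏ p ∈ F, p ∣ e ↔ F ⊆ P.filter (· ∣ e) := by
  constructor
  · intro h p hp
    exact mem_filter.2 ⟨hF hp, (dvd_prod_of_mem _ hp).trans h⟩
  · intro h
    exact Finset.prod_primes_dvd _ (fun p hp => (hP p (hF hp)).prime)
      fun p hp => (mem_filter.1 (h hp)).2

/-- Sums of squares of divisor sums over an interval, in terms of a quadratic form. -/
lemma abs_sum_cop_inv_mul_sq_sub_le {W R E : ℕ} (hE : 0 < E) {c c₀ C : ℝ}
    (hharm : ∀ y : ℝ, 0 < y → |copHarm W y - c * Real.log y - c₀| ≤ C / y)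
    {N : Finset ℕ} (hN : N ⊆ primesCop W R) (x : Finset ℕ → ℝ) :
    |∑ e ∈ cop W E, (e : ℝ)⁻¹ * (∑ F ∈ (N.filter (· ∣ e)).powerset, x F) ^ 2 -
      ∑ F ∈ N.powerset, ∑ F' ∈ N.powerset, x F * x F' * ((∏ p ∈ F ∪ F', (p : ℝ))⁻¹ *
        (c * Real.log E + c₀ - c * ∑ p ∈ F ∪ F', Real.log p))| ≤
      C / E * (∑ F ∈ N.powerset, |x F|) ^ 2 := by
  have hpr : ∀ p ∈ N, p.Prime := fun p hp => (mem_primesCop.1 (hN hp)).2.1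
  have hE' : (0 : ℝ) < E := by exact_mod_cast hE
  have h1 : ∑ e ∈ cop W E, (e : ℝ)⁻¹ * (∑ F ∈ (N.filter (· ∣ e)).powerset, x F) ^ 2 =
      ∑ F ∈ N.powerset, ∑ F' ∈ N.powerset, x F * x F' *
        ∑ e ∈ cop W E with ∏ p ∈ F ∪ F', p ∣ e, (e : ℝ)⁻¹ := by
    have h2 : ∀ e ∈ cop W E, (e : ℝ)⁻¹ * (∑ F ∈ (N.filter (· ∣ e)).powerset, x F) ^ 2 =
        ∑ F ∈ N.powerset, ∑ F' ∈ N.powerset,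
          x F * x F' * if ∏ p ∈ F ∪ F', p ∣ e then (e : ℝ)⁻¹ else 0 := by
      intro e _
      have hs : (N.filter (· ∣ e)).powerset = N.powerset.filter fun F => F ⊆ N.filter (· ∣ e) := by
        ext F
        simp only [mem_powerset, mem_filter]
        exact ⟨fun h => ⟨h.trans (filter_subset _ _), h⟩, fun h => h.2⟩
      rw [hs, sq, sum_filter, sum_mul_sum, mul_sum]
      refine sum_congr rfl fun F hF => ?_
      rw [mul_sum]
      refine sum_congr rfl fun F' hF' => ?_
      have : (∏ p ∈ F ∪ F', p ∣ e) ↔ F ⊆ N.filter (· ∣ e) ∧ F' ⊆ N.filter (· ∣ e) := by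
        rw [prod_dvd_iff_subset_filter hpr
          (union_subset (mem_powerset.1 hF) (mem_powerset.1 hF')), union_subset_iff]
      by_cases ha : F ⊆ N.filter (· ∣ e) <;> by_cases hb : F' ⊆ N.filter (· ∣ e) <;>
        simp [this, ha, hb]
      ring
    rw [sum_congr rfl h2, sum_comm]
    refine sum_congr rfl fun F _ => ?_
    rw [sum_comm]
    refine sum_congr rfl fun F' _ => ?_
    rw [← mul_sum, sum_filter]
  rw [h1, ← sum_sub_distrib, sq, sum_mul_sum, mul_sum]
  refine (abs_sum_le_sum_abs _ _).trans (sum_le_sum fun F hF => ?_)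
  rw [← sum_sub_distrib, mul_sum]
  refine (abs_sum_le_sum_abs _ _).trans (sum_le_sum fun F' hF' => ?_)
  rw [← mul_sub, abs_mul, abs_mul, mul_comm (C / E)]
  refine mul_le_mul_of_nonneg_left ?_ (by positivity)
  have hU : F ∪ F' ⊆ N := union_subset (mem_powerset.1 hF) (mem_powerset.1 hF')
  have hprU : ∀ p ∈ F ∪ F', p.Prime := fun p hp => hpr p (hU hp)
  have hd := prod_primes_pos hprU
  have hWd : W.Coprime (∏ p ∈ F ∪ F', p) :=
    Nat.Coprime.prod_right fun p hp => (mem_primesCop.1 (hN (hU hp))).2.2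
  have hd' : (0 : ℝ) < ∏ p ∈ F ∪ F', (p : ℝ) :=
    prod_pos fun p hp => by exact_mod_cast (hprU p hp).pos
  rw [sum_cop_filter_dvd_inv hd hWd, Nat.cast_prod, ← mul_sub, abs_mul, abs_of_pos (inv_pos.2 hd')]
  have h := hharm ((E : ℝ) / ∏ p ∈ F ∪ F', (p : ℝ)) (by positivity)
  rw [Real.log_div hE'.ne' hd'.ne', Real.log_prod fun p hp => by
    exact_mod_cast (hprU p hp).ne_zero] at h
  have e1 : ∀ A : ℝ, A - (c * Real.log E + c₀ - c * ∑ p ∈ F ∪ F', Real.log p) =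
    A - c * (Real.log E - ∑ p ∈ F ∪ F', Real.log p) - c₀ := fun A => by ring
  rw [e1]
  calc _ ≤ (∏ p ∈ F ∪ F', (p : ℝ))⁻¹ * (C / (E / ∏ p ∈ F ∪ F', (p : ℝ))) := by gcongr
    _ = _ := by field_simp

lemma sum_sum_erase_powerset (N : Finset ℕ) (f : ℕ → Finset ℕ → ℝ) :
    ∑ p ∈ N, ∑ G ∈ (N.erase p).powerset, f p G = ∑ G ∈ N.powerset, ∑ p ∈ N \ G, f p G := by
  refine sum_comm' fun p G => ?_
  simp only [mem_powerset, subset_erase, mem_sdiff]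
  tauto

lemma sum_sum_erase_powerset_insert (N : Finset ℕ) (f : ℕ → Finset ℕ → ℝ) :
    ∑ p ∈ N, ∑ G ∈ (N.erase p).powerset, f p (insert p G) =
      ∑ G ∈ N.powerset, ∑ p ∈ G, f p G := by
  rw [sum_comm' (s' := fun p => N.powerset.filter (p ∈ ·)) (t' := N) (fun G p => by
    simp only [mem_powerset, mem_filter]
    exact ⟨fun h => ⟨⟨h.1, h.2⟩, h.1 h.2⟩, fun h => h.1⟩)]
  refine sum_congr rfl fun p hp => ?_
  refine sum_nbij' (fun G => insert p G) (fun G => G.erase p) ?_ ?_ ?_ ?_ ?_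
  · intro G hG
    rw [mem_powerset, subset_erase] at hG
    simp [insert_subset_iff, hp, hG.1]
  · intro G hG
    rw [mem_filter, mem_powerset] at hG
    exact mem_powerset.2 (erase_subset_erase _ hG.1)
  · intro G hG
    rw [mem_powerset, subset_erase] at hG
    exact erase_insert hG.2
  · intro G hG
    exact insert_erase (mem_filter.1 hG).2
  · intro G _
    rfl

/-- The quadratic form of the divisor sums, evaluated in diagonal form. -/
lemma quadratic_form_le {N : Finset ℕ} (hN : ∀ p ∈ N, p.Prime) {z : Finset ℕ → ℝ}
    (hz : ∀ G, 0 ≤ z G) (hzanti : ∀ p ∈ N, ∀ G ⊆ N, z (insert p G) ≤ z G) {c K C₂ : ℝ}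
    (hc : 0 ≤ c) (hC₂ : ∑ p ∈ N, Real.log p / ((p : ℝ) - 1) ^ 2 ≤ C₂) (w : ℝ) :
    ∑ F ∈ N.powerset, ∑ F' ∈ N.powerset,
      ((-1) ^ F.card * (w * ∑ A ∈ (N \ F).powerset, (∏ p ∈ F ∪ A, ((p : ℝ) - 1)⁻¹) * z (F ∪ A))) *
      ((-1) ^ F'.card *
        (w * ∑ A ∈ (N \ F').powerset, (∏ p ∈ F' ∪ A, ((p : ℝ) - 1)⁻¹) * z (F' ∪ A))) *
      (∏ p ∈ F ∩ F', (p : ℝ)) * (K - c * ∑ p ∈ F ∪ F', Real.log p) ≤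
    w ^ 2 * ∑ G ∈ N.powerset, (∏ p ∈ G, ((p : ℝ) - 1)⁻¹) *
      ((K + c * C₂ - c * ∑ p ∈ G, Real.log p) * z G ^ 2 +
        2 * c * z G * ∑ p ∈ N \ G, Real.log p / (p - 1) * z (insert p G)) := by
  set t : Finset ℕ → ℝ := fun G => (∏ p ∈ G, ((p : ℝ) - 1)⁻¹) * z G with ht
  set v : Finset ℕ → ℝ := fun F => (-1) ^ F.card * (w * ∑ A ∈ (N \ F).powerset, t (F ∪ A)) with hv
  set ζ : Finset ℕ → ℝ := fun G => w * ((-1) ^ G.card * t G) with hζdef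
  have hζ : ∀ G ⊆ N, ∑ F ∈ N.powerset with G ⊆ F, v F = ζ G := by
    intro G hG
    rw [hζdef]
    simp only
    rw [← sum_filter_subset_neg_one_pow_mul hG, mul_sum]
    exact sum_congr rfl fun F _ => by rw [hv]; ring
  have hp1 : ∀ p ∈ N, (0 : ℝ) < p - 1 := fun p hp => by
    have : (1 : ℝ) < p := by exact_mod_cast (hN p hp).one_lt
    linarith
  have hφ : ∀ G ⊆ N, (0 : ℝ) < ∏ p ∈ G, ((p : ℝ) - 1)⁻¹ := fun G hG =>
    prod_pos fun p hp => inv_pos.2 (hp1 p (hG hp))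
  have hφφ : ∀ G ⊆ N, (∏ p ∈ G, ((p : ℝ) - 1)) * ∏ p ∈ G, ((p : ℝ) - 1)⁻¹ = 1 := fun G hG => by
    rw [← prod_mul_distrib]
    exact prod_eq_one fun p hp => mul_inv_cancel₀ (hp1 p (hG hp)).ne'
  have hsq : ∀ n : ℕ, ((-1 : ℝ) ^ n) ^ 2 = 1 := fun n => by rw [← pow_mul, mul_comm, pow_mul]; simp
  have hlog : ∑ F ∈ N.powerset, ∑ F' ∈ N.powerset,
      v F * v F' * (∏ p ∈ F ∩ F', (p : ℝ)) * ∑ p ∈ F ∪ F', Real.log p =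
      ∑ p ∈ N, Real.log p * ∑ F ∈ N.powerset, ∑ F' ∈ N.powerset,
        (if p ∈ F ∪ F' then v F * v F' * ∏ r ∈ F ∩ F', (r : ℝ) else 0) := by
    symm
    simp only [mul_sum]
    rw [sum_comm]
    refine sum_congr rfl fun F hF => ?_
    rw [sum_comm]
    refine sum_congr rfl fun F' hF' => ?_
    have hU : F ∪ F' ⊆ N := union_subset (mem_powerset.1 hF) (mem_powerset.1 hF')
    simp only [mul_ite, mul_zero]
    rw [sum_ite_mem, inter_eq_right.2 hU]
    exact sum_congr rfl fun p _ => by ring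
  have hsplit : ∑ F ∈ N.powerset, ∑ F' ∈ N.powerset,
      v F * v F' * (∏ p ∈ F ∩ F', (p : ℝ)) * (K - c * ∑ p ∈ F ∪ F', Real.log p) =
      K * ∑ F ∈ N.powerset, ∑ F' ∈ N.powerset, v F * v F' * (∏ p ∈ F ∩ F', (p : ℝ)) -
      c * ∑ F ∈ N.powerset, ∑ F' ∈ N.powerset,
      v F * v F' * (∏ p ∈ F ∩ F', (p : ℝ)) * ∑ p ∈ F ∪ F', Real.log p := by
    rw [mul_sum, mul_sum, ← sum_sub_distrib]
    refine sum_congr rfl fun F _ => ?_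
    rw [mul_sum, mul_sum, ← sum_sub_distrib]
    exact sum_congr rfl fun F' _ => by ring
  have hQ : ∑ G ∈ N.powerset, (∏ p ∈ G, ((p : ℝ) - 1)) *
      (∑ F ∈ N.powerset with G ⊆ F, v F) ^ 2 =
      w ^ 2 * ∑ G ∈ N.powerset, (∏ p ∈ G, ((p : ℝ) - 1)⁻¹) * z G ^ 2 := by
    rw [mul_sum]
    refine sum_congr rfl fun G hG => ?_
    rw [hζ G (mem_powerset.1 hG), hζdef, ht]
    simp only [mul_pow, hsq]
    linear_combination (w ^ 2 * (∏ p ∈ G, ((p : ℝ) - 1)⁻¹) * z G ^ 2) * hφφ G (mem_powerset.1 hG)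
  have hQp : ∀ p ∈ N, Real.log p * ∑ G ∈ (N.erase p).powerset, (∏ r ∈ G, ((r : ℝ) - 1)) *
        (2 * ζ G * ζ (insert p G) + (p - 2) * ζ (insert p G) ^ 2) =
      w ^ 2 * (∑ G ∈ (N.erase p).powerset,
        (∏ r ∈ insert p G, ((r : ℝ) - 1)⁻¹) * (Real.log p * z (insert p G) ^ 2)) -
      w ^ 2 * (∑ G ∈ (N.erase p).powerset, (∏ r ∈ G, ((r : ℝ) - 1)⁻¹) *
        (2 * z G * (Real.log p / (p - 1) * z (insert p G)) +
          Real.log p / (p - 1) ^ 2 * z (insert p G) ^ 2)) := by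
    intro p hp
    rw [mul_sum, mul_sum, mul_sum, ← sum_sub_distrib]
    refine sum_congr rfl fun G hG => ?_
    have hG' := subset_erase.1 (mem_powerset.1 hG)
    rw [hζdef, ht]
    simp only [prod_insert hG'.2, card_insert_of_notMem hG'.2, pow_succ (-1 : ℝ) G.card]
    have h1 := hsq G.card
    have h2 := hφφ G hG'.1
    have h3 := (hp1 p hp).ne'
    set e := (-1 : ℝ) ^ G.card
    set f := ∏ r ∈ G, ((r : ℝ) - 1)
    set g := ∏ r ∈ G, ((r : ℝ) - 1)⁻¹
    have e1 : Real.log p * (f * (2 * (w * (e * (g * z G))) *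
        (w * (e * -1 * (((p : ℝ) - 1)⁻¹ * g * z (insert p G)))) +
        (p - 2) * (w * (e * -1 * (((p : ℝ) - 1)⁻¹ * g * z (insert p G)))) ^ 2)) =
        (f * g) * e ^ 2 * g * w ^ 2 * Real.log p * (-2 * z G * ((p : ℝ) - 1)⁻¹ * z (insert p G) +
          (p - 2) * (((p : ℝ) - 1)⁻¹ * z (insert p G)) ^ 2) := by ring
    rw [e1, h1, h2]
    field_simp
    ring
  have hQp' := fun (p : ℕ) (hp : p ∈ N) => (congrArg (Real.log p * ·)
    (sum_sum_mul_prod_inter_of_mem_union hp v hζ)).trans (hQp p hp)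
  change ∑ F ∈ N.powerset, ∑ F' ∈ N.powerset,
      v F * v F' * (∏ p ∈ F ∩ F', (p : ℝ)) * (K - c * ∑ p ∈ F ∪ F', Real.log p) ≤ _
  rw [hsplit, sum_sum_mul_prod_inter, hQ, hlog, sum_congr rfl hQp',
    sum_sub_distrib, ← mul_sum, ← mul_sum,
    sum_sum_erase_powerset_insert N fun p G =>
      (∏ r ∈ G, ((r : ℝ) - 1)⁻¹) * (Real.log p * z G ^ 2),
    sum_sum_erase_powerset N fun p G => (∏ r ∈ G, ((r : ℝ) - 1)⁻¹) *
        (2 * z G * (Real.log p / (p - 1) * z (insert p G)) +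
          Real.log p / (p - 1) ^ 2 * z (insert p G) ^ 2)]
  have hfin : ∀ G ∈ N.powerset, ∑ p ∈ N \ G, (∏ r ∈ G, ((r : ℝ) - 1)⁻¹) *
        (2 * z G * (Real.log p / (p - 1) * z (insert p G)) +
          Real.log p / (p - 1) ^ 2 * z (insert p G) ^ 2) ≤
      (∏ r ∈ G, ((r : ℝ) - 1)⁻¹) * (C₂ * z G ^ 2 +
        2 * z G * ∑ p ∈ N \ G, Real.log p / (p - 1) * z (insert p G)) := by
    intro G hG
    rw [← mul_sum, sum_add_distrib, ← mul_sum, add_comm]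
    refine mul_le_mul_of_nonneg_left (add_le_add ?_ le_rfl) (hφ G (mem_powerset.1 hG)).le
    calc _ ≤ ∑ p ∈ N \ G, Real.log p / ((p : ℝ) - 1) ^ 2 * z G ^ 2 := by
          refine sum_le_sum fun p hp => ?_
          have hpN := (mem_sdiff.1 hp).1
          have := hzanti p hpN G (mem_powerset.1 hG)
          have h0 := hz (insert p G)
          have : 0 ≤ Real.log p := Real.log_natCast_nonneg p
          gcongr
      _ ≤ ∑ p ∈ N, Real.log p / ((p : ℝ) - 1) ^ 2 * z G ^ 2 :=
          sum_le_sum_of_subset_of_nonneg sdiff_subset fun p _ _ => by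
            have : 0 ≤ Real.log p := Real.log_natCast_nonneg p
            positivity
      _ ≤ _ := by
          rw [← sum_mul]
          gcongr
  have hcw : 0 ≤ c * w ^ 2 := by positivity
  have := mul_le_mul_of_nonneg_left (sum_le_sum hfin) hcw
  have e2 : w ^ 2 * ∑ G ∈ N.powerset, (∏ p ∈ G, ((p : ℝ) - 1)⁻¹) *
      ((K + c * C₂ - c * ∑ p ∈ G, Real.log p) * z G ^ 2 +
        2 * c * z G * ∑ p ∈ N \ G, Real.log p / (p - 1) * z (insert p G)) =
      K * (w ^ 2 * ∑ G ∈ N.powerset, (∏ p ∈ G, ((p : ℝ) - 1)⁻¹) * z G ^ 2) -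
      c * (w ^ 2 * ∑ G ∈ N.powerset, ∑ p ∈ G,
        (∏ r ∈ G, ((r : ℝ) - 1)⁻¹) * (Real.log p * z G ^ 2)) +
      c * w ^ 2 * ∑ G ∈ N.powerset, (∏ r ∈ G, ((r : ℝ) - 1)⁻¹) * (C₂ * z G ^ 2 +
        2 * z G * ∑ p ∈ N \ G, Real.log p / (p - 1) * z (insert p G)) := by
    simp only [mul_sum, ← sum_sub_distrib, ← sum_add_distrib]
    refine sum_congr rfl fun G _ => ?_
    simp only [← mul_sum, ← sum_mul]
    ring
  rw [e2]
  linarith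

lemma sieveY_union {P S F : Finset ℕ} (Z : ℕ → ℝ) (hF : F ⊆ P \ S) :
    sieveY P Z (S ∪ F) = (∏ p ∈ F, (p : ℝ)) * ((∏ p ∈ S, (p : ℝ) / (p - 1)) *
      ∑ A ∈ ((P \ S) \ F).powerset, (∏ p ∈ F ∪ A, ((p : ℝ) - 1)⁻¹) *
        Z ((∏ p ∈ S, p) * ∏ p ∈ F ∪ A, p)) := by
  have hF' := subset_sdiff.1 hF
  rw [sieveY, prod_union hF'.2.symm, prod_union hF'.2.symm, Finset.sdiff_sdiff_left' P S F,
    ← sdiff_union_distrib]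
  have h1 : ∏ p ∈ F, (p : ℝ) / (p - 1) = (∏ p ∈ F, (p : ℝ)) * ∏ p ∈ F, ((p : ℝ) - 1)⁻¹ := by
    rw [← prod_mul_distrib]
    exact prod_congr rfl fun p _ => div_eq_mul_inv _ _
  rw [h1]
  simp only [mul_sum]
  refine sum_congr rfl fun A hA => ?_
  have hA' := subset_sdiff.1 (mem_powerset.1 hA)
  have hd : Disjoint F A := (hA'.2.mono_right subset_union_right).symm
  rw [prod_union hd, prod_union hd, mul_assoc (∏ p ∈ S, p)]
  ring

section

variable {W R : ℕ} {Z : ℕ → ℝ}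

/-- The quantity bounding a divisor-weighted mean square, for a fixed set `S` of primes. -/
noncomputable def divisorMain (P : Finset ℕ) (Z : ℕ → ℝ) (c K : ℝ) (S : Finset ℕ) : ℝ :=
  (∏ p ∈ S, (p : ℝ) / (p - 1)) ^ 2 * ∑ G ∈ (P \ S).powerset, (∏ p ∈ G, ((p : ℝ) - 1)⁻¹) *
      ((K - c * ∑ p ∈ G, Real.log p) * Z ((∏ p ∈ S, p) * ∏ p ∈ G, p) ^ 2 +
        2 * c * Z ((∏ p ∈ S, p) * ∏ p ∈ G, p) * ∑ p ∈ (P \ S) \ G,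
          Real.log p / (p - 1) * Z ((∏ p ∈ S, p) * ∏ r ∈ insert p G, r))

lemma sum_cop_inv_mul_sq_le {E : ℕ} (hE : 0 < E) {c c₀ C C₂ : ℝ} (hc : 0 ≤ c)
    (hharm : ∀ y : ℝ, 0 < y → |copHarm W y - c * Real.log y - c₀| ≤ C / y)
    (hC₂ : ∀ s : Finset ℕ, (∀ p ∈ s, 2 ≤ p) → ∑ p ∈ s, Real.log p / ((p : ℝ) - 1) ^ 2 ≤ C₂)
    (hZ : DecUpTo R Z) {S : Finset ℕ} (hS : S ⊆ primesCop W R) :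
    ∑ e ∈ cop W E, (e : ℝ)⁻¹ * (∑ F ∈ ((primesCop W R \ S).filter (· ∣ e)).powerset,
        (-1) ^ F.card * sieveY (primesCop W R) Z (S ∪ F)) ^ 2 ≤
      divisorMain (primesCop W R) Z c (c * Real.log E + c₀ + c * C₂) S +
      C / E * (∑ F ∈ (primesCop W R \ S).powerset, |sieveY (primesCop W R) Z (S ∪ F)|) ^ 2 := by
  set P := primesCop W R with hP
  have hpr : ∀ p ∈ P, p.Prime := fun p hp => (mem_primesCop.1 hp).2.1
  have hprN : ∀ p ∈ P \ S, p.Prime := fun p hp => hpr p (sdiff_subset hp)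
  have hSpos := prod_primes_pos fun p hp => hpr p (hS hp)
  have h := abs_sum_cop_inv_mul_sq_sub_le hE hharm (sdiff_subset : P \ S ⊆ P)
    fun F => (-1) ^ F.card * sieveY P Z (S ∪ F)
  have habs : ∑ F ∈ (P \ S).powerset, |(-1) ^ F.card * sieveY P Z (S ∪ F)| =
      ∑ F ∈ (P \ S).powerset, |sieveY P Z (S ∪ F)| :=
    sum_congr rfl fun F _ => by rw [abs_mul, abs_pow, abs_neg, abs_one, one_pow, one_mul]
  rw [habs] at h
  have h1 := (abs_le.1 h).2
  refine le_trans (sub_le_iff_le_add'.1 h1) (add_le_add ?_ le_rfl)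
  have hq := quadratic_form_le (N := P \ S) hprN (z := fun B => Z ((∏ p ∈ S, p) * ∏ p ∈ B, p))
    (fun G => hZ.nonneg _) (fun p hp G hG => by
      have hGpos := prod_primes_pos fun p hp => hprN p (hG hp)
      refine hZ.anti _ _ (Nat.mul_pos hSpos hGpos) (Nat.mul_le_mul_left _ ?_)
      exact Nat.le_of_dvd (prod_primes_pos fun r hr => hprN r (insert_subset hp hG hr))
        (prod_dvd_prod_of_subset _ _ _ (subset_insert _ _))) (K := c * Real.log E + c₀)
    hc (hC₂ _ fun p hp => (hprN p hp).two_le) (∏ p ∈ S, (p : ℝ) / (p - 1))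
  refine le_trans (le_of_eq ?_) hq
  refine sum_congr rfl fun F hF => sum_congr rfl fun F' hF' => ?_
  rw [sieveY_union Z (mem_powerset.1 hF), sieveY_union Z (mem_powerset.1 hF')]
  have hU : F ∪ F' ⊆ P \ S := union_subset (mem_powerset.1 hF) (mem_powerset.1 hF')
  have hne : ∏ p ∈ F ∪ F', (p : ℝ) ≠ 0 := prod_ne_zero_iff.2 fun p hp => by
    exact_mod_cast (hprN p (hU hp)).ne_zero
  have hinv : (∏ p ∈ F, (p : ℝ)) * (∏ p ∈ F', (p : ℝ)) * (∏ p ∈ F ∪ F', (p : ℝ))⁻¹ =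
      ∏ p ∈ F ∩ F', (p : ℝ) := by
    rw [← prod_union_inter, mul_comm (∏ p ∈ F ∪ F', (p : ℝ)), mul_assoc, mul_inv_cancel₀ hne,
      mul_one]
  rw [← hinv]
  ring

end

lemma card_divisors_le_two_mul {m E W : ℕ} (hm : 0 < m) (hE : m ≤ E ^ 2) (hW : W.Coprime m) :
    m.divisors.card ≤ 2 * ((cop W E).filter (· ∣ m)).card := by
  have hsub : m.divisors ⊆ (cop W E).filter (· ∣ m) ∪
      ((cop W E).filter (· ∣ m)).image (m / ·) := by
    intro d hd
    have hdm := Nat.dvd_of_mem_divisors hd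
    have hd0 := Nat.pos_of_dvd_of_pos hdm hm
    rw [mem_union]
    by_cases hdE : d ≤ E
    · left
      exact mem_filter.2 ⟨mem_cop.2 ⟨⟨hd0, hdE⟩, hW.coprime_dvd_right hdm⟩, hdm⟩
    · right
      have hq : m / d ∣ m := Nat.div_dvd_of_dvd hdm
      refine mem_image.2 ⟨m / d, mem_filter.2 ⟨mem_cop.2 ⟨⟨Nat.div_pos (Nat.le_of_dvd hm hdm) hd0,
        ?_⟩, hW.coprime_dvd_right hq⟩, hq⟩, Nat.div_div_self hdm hm.ne'⟩
      have : m / d * d = m := Nat.div_mul_cancel hdm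
      nlinarith
  calc _ ≤ _ := card_le_card hsub
    _ ≤ _ := card_union_le _ _
    _ ≤ ((cop W E).filter (· ∣ m)).card + ((cop W E).filter (· ∣ m)).card :=
      add_le_add le_rfl card_image_le
    _ = _ := by ring

namespace SieveSetup

variable {k : ℕ} (s : SieveSetup k)

lemma L_pos (i : Fin k) (n : ℕ) : 0 < s.L i n := Nat.add_pos_right _ (s.b_pos i)

lemma coprime_L {X n : ℕ} (hn : n ∈ progression X s.W s.n₀) (i : Fin k) :
    s.W.Coprime (s.L i n) := by
  have h : s.L i n ≡ s.L i s.n₀ [MOD s.W] := ((mem_progression.1 hn).2.mul_left _).add_right _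
  have h2 := h.gcd_eq
  rw [Nat.Coprime, Nat.gcd_comm, h2, Nat.gcd_comm]
  exact s.coprime i

lemma lt_of_mem_primesCop {R p : ℕ} (hp : p ∈ primesCop s.W R) : s.D < p :=
  (primorial_coprime_prime_iff (mem_primesCop.1 hp).2.1).1 (mem_primesCop.1 hp).2.2

lemma two_mul_add_two_lt {R p : ℕ} (hp : p ∈ primesCop s.W R) : (2 * k + 2 : ℝ) < p := by
  have := s.lt_of_mem_primesCop hp
  have := s.lt_D
  exact_mod_cast (by omega : 2 * k + 2 < p)

lemma u_nonneg {R p : ℕ} (hp : p ∈ primesCop s.W R) : 0 ≤ (k : ℝ) / (p - k) := by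
  have := s.two_mul_add_two_lt hp
  have : (0 : ℝ) ≤ k := Nat.cast_nonneg _
  exact div_nonneg this (by linarith)

lemma u_le_one {R p : ℕ} (hp : p ∈ primesCop s.W R) : (k : ℝ) / (p - k) ≤ 1 := by
  have := s.two_mul_add_two_lt hp
  have : (0 : ℝ) ≤ k := Nat.cast_nonneg _
  rw [div_le_one (by linarith)]
  linarith

lemma prod_u_nonneg {R : ℕ} {S : Finset ℕ} (hS : S ∈ (primesCop s.W R).powerset) :
    0 ≤ ∏ p ∈ S, (k : ℝ) / (p - k) :=
  prod_nonneg fun _ hp => s.u_nonneg (mem_powerset.1 hS hp)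

lemma prod_u_le_one {R : ℕ} {S : Finset ℕ} (hS : S ∈ (primesCop s.W R).powerset) :
    ∏ p ∈ S, (k : ℝ) / (p - k) ≤ 1 :=
  prod_le_one (fun _ hp => s.u_nonneg (mem_powerset.1 hS hp))
    fun _ hp => s.u_le_one (mem_powerset.1 hS hp)

lemma sum_sq_sum_le_errSum (P : Finset ℕ) (Y : Finset ℕ → ℝ) (hk : 0 < k) :
    ∑ S ∈ P.powerset, (∑ F ∈ (P \ S).powerset, |Y (S ∪ F)|) ^ 2 ≤ errSum k P Y ^ 2 := by
  have hnn : ∀ S ∈ P.powerset, 0 ≤ ∑ F ∈ (P \ S).powerset, |Y (S ∪ F)| :=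
    fun S _ => sum_nonneg fun _ _ => abs_nonneg _
  refine (sum_sq_le_sq_sum_of_nonneg hnn).trans (pow_le_pow_left₀ (sum_nonneg hnn) ?_ 2)
  rw [sum_powerset_sdiff P fun S F => |Y (S ∪ F)|, errSum]
  refine sum_le_sum fun U _ => ?_
  calc _ = ∑ S ∈ U.powerset, |Y U| :=
        sum_congr rfl fun S hS => by rw [union_sdiff_of_subset (mem_powerset.1 hS)]
    _ = |Y U| * 2 ^ U.card := by rw [sum_const, card_powerset, nsmul_eq_mul]; push_cast; ring
    _ ≤ _ := by
        have : (1 : ℝ) ≤ k := by exact_mod_cast hk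
        gcongr
        linarith

/-- The divisor-weighted mean square of the sieve weights. -/
lemma sum_card_divisors_mul_sq_le {R E X : ℕ} (hE : 0 < E) {c c₀ C C₂ : ℝ} (hc : 0 ≤ c)
    (hC : 0 ≤ C)
    (hharm : ∀ y : ℝ, 0 < y → |copHarm s.W y - c * Real.log y - c₀| ≤ C / y)
    (hC₂ : ∀ s : Finset ℕ, (∀ p ∈ s, 2 ≤ p) → ∑ p ∈ s, Real.log p / ((p : ℝ) - 1) ^ 2 ≤ C₂)
    {Z : ℕ → ℝ} (hZ : DecUpTo R Z) (i : Fin k) (hX : s.L i X ≤ E ^ 2) :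
    ∑ n ∈ progression X s.W s.n₀, ((s.L i n).divisors.card : ℝ) *
        s.Λ (primesCop s.W R) (sieveY (primesCop s.W R) Z) n ^ 2 ≤
      2 * (X / s.W) * ∑ S ∈ (primesCop s.W R).powerset, (∏ p ∈ S, (k : ℝ) / (p - k)) *
          divisorMain (primesCop s.W R) Z c (c * Real.log E + c₀ + c * C₂) S +
      (2 * X * C / E + 2 * E) *
        errSum k (primesCop s.W R) (sieveY (primesCop s.W R) Z) ^ 2 := by
  set P := primesCop s.W R with hP
  set Y := sieveY P Z with hY
  have hW : (1 : ℝ) ≤ s.W := by exact_mod_cast s.W_pos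
  have step1 : ∑ n ∈ progression X s.W s.n₀, ((s.L i n).divisors.card : ℝ) * s.Λ P Y n ^ 2 ≤
      2 * ∑ e ∈ cop s.W E, ∑ n ∈ (progression X s.W s.n₀).filter (fun n => e ∣ s.L i n),
        s.Λ P Y n ^ 2 := by
    calc _ ≤ ∑ n ∈ progression X s.W s.n₀,
          2 * (((cop s.W E).filter (· ∣ s.L i n)).card : ℝ) * s.Λ P Y n ^ 2 := by
          refine sum_le_sum fun n hn => mul_le_mul_of_nonneg_right ?_ (sq_nonneg _)
          have hnX := (mem_progression.1 hn).1.2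
          have hle : s.L i n ≤ E ^ 2 := le_trans (by unfold L; gcongr) hX
          exact_mod_cast card_divisors_le_two_mul (s.L_pos i n) hle (s.coprime_L hn i)
      _ = _ := by
          simp only [sum_filter]
          rw [sum_comm, mul_sum]
          refine sum_congr rfl fun n _ => ?_
          rw [← sum_filter, sum_const, nsmul_eq_mul]
          ring
  have step2 : ∀ e ∈ cop s.W E,
      ∑ n ∈ (progression X s.W s.n₀).filter (fun n => e ∣ s.L i n), s.Λ P Y n ^ 2 ≤
      X / s.W * ∑ S ∈ P.powerset, (∏ p ∈ S, (k : ℝ) / (p - k)) * ((e : ℝ)⁻¹ *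
        (∑ F ∈ ((P \ S).filter (· ∣ e)).powerset, (-1) ^ F.card * Y (S ∪ F)) ^ 2) +
      errSum k P Y ^ 2 := by
    intro e he
    rw [mem_cop] at he
    have h := (abs_le.1 (s.abs_sum_sq_sub_le (R := R) Y he.2 he.1.1 X i)).2
    refine (sub_le_iff_le_add'.1 h).trans (add_le_add ?_ le_rfl)
    rw [← div_div, div_eq_mul_inv _ (e : ℝ), mul_assoc, mul_sum]
    refine mul_le_mul_of_nonneg_left ?_ (by positivity)
    calc _ = ∑ S ∈ (P \ P.filter (· ∣ e)).powerset, (∏ p ∈ S, (k : ℝ) / (p - k)) * ((e : ℝ)⁻¹ *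
        (∑ F ∈ ((P \ S).filter (· ∣ e)).powerset, (-1) ^ F.card * Y (S ∪ F)) ^ 2) := by
          refine sum_congr rfl fun S hS => ?_
          have hS' := subset_sdiff.1 (mem_powerset.1 hS)
          have : (P \ S).filter (· ∣ e) = P.filter (· ∣ e) := by
            ext p
            simp only [mem_filter, mem_sdiff]
            refine ⟨fun h => ⟨h.1.1, h.2⟩, fun h => ⟨⟨h.1, fun hpS => ?_⟩, h.2⟩⟩
            exact disjoint_left.1 hS'.2 hpS (mem_filter.2 h)
          rw [this]
          ring
      _ ≤ _ := by
          refine sum_le_sum_of_subset_of_nonneg (powerset_mono.2 sdiff_subset) fun S hS _ => ?_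
          exact mul_nonneg (s.prod_u_nonneg hS) (by positivity)
  have step3 : ∑ e ∈ cop s.W E, ∑ S ∈ P.powerset, (∏ p ∈ S, (k : ℝ) / (p - k)) * ((e : ℝ)⁻¹ *
        (∑ F ∈ ((P \ S).filter (· ∣ e)).powerset, (-1) ^ F.card * Y (S ∪ F)) ^ 2) ≤
      ∑ S ∈ P.powerset, (∏ p ∈ S, (k : ℝ) / (p - k)) *
          divisorMain P Z c (c * Real.log E + c₀ + c * C₂) S + C / E * errSum k P Y ^ 2 := by
    rw [sum_comm]
    calc _ ≤ ∑ S ∈ P.powerset, ((∏ p ∈ S, (k : ℝ) / (p - k)) *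
          divisorMain P Z c (c * Real.log E + c₀ + c * C₂) S +
          C / E * (∑ F ∈ (P \ S).powerset, |Y (S ∪ F)|) ^ 2) := by
          refine sum_le_sum fun S hS => ?_
          rw [← mul_sum]
          have h1 := s.prod_u_nonneg hS
          have h2 := s.prod_u_le_one hS
          have h3 := mul_le_mul_of_nonneg_left
            (sum_cop_inv_mul_sq_le hE hc hharm hC₂ hZ (mem_powerset.1 hS)) h1
          rw [mul_add] at h3
          refine h3.trans (add_le_add le_rfl ?_)
          exact mul_le_of_le_one_left (by positivity) h2
      _ ≤ _ := by
          rw [sum_add_distrib, ← mul_sum]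
          gcongr
          exact sum_sq_sum_le_errSum P Y s.k_pos
  have hcard : ((cop s.W E).card : ℝ) ≤ E := by
    have : (cop s.W E).card ≤ (Icc 1 E).card := card_filter_le _ _
    simpa using (Nat.cast_le (α := ℝ)).2 this
  refine step1.trans ?_
  have h4 := sum_le_sum step2
  rw [sum_add_distrib, ← mul_sum, sum_const, nsmul_eq_mul] at h4
  have hXW : (0 : ℝ) ≤ X / s.W := by positivity
  have h5 := mul_le_mul_of_nonneg_left step3 hXW
  rw [mul_add] at h5
  have h6 : (X : ℝ) / s.W * (C / E * errSum k P Y ^ 2) ≤ X * (C / E * errSum k P Y ^ 2) :=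
    mul_le_mul_of_nonneg_right (div_le_self (Nat.cast_nonneg _) hW) (by positivity)
  have h7 := mul_le_mul_of_nonneg_right hcard (sq_nonneg (errSum k P Y))
  have e1 : 2 * X * C / E * errSum k P Y ^ 2 = 2 * (X * (C / E * errSum k P Y ^ 2)) := by ring
  rw [add_mul, e1]
  linarith

end SieveSetup

/-- The relative logarithmic distance of `m` to the level `R`. -/
noncomputable def relLog (R m : ℕ) : ℝ := Real.log ((R : ℝ) / m) / Real.log R

/-- Powers of the relative logarithmic distance, truncated at the level `R`. -/
noncomputable def truncPow (R j m : ℕ) : ℝ := if m ≤ R then relLog R m ^ j else 0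

section truncPow

variable {R : ℕ}

lemma relLog_one (hR : 1 < R) : relLog R 1 = 1 := by
  have : Real.log R ≠ 0 := (Real.log_pos (by exact_mod_cast hR)).ne'
  simp [relLog, this]

lemma relLog_nonneg {m : ℕ} (hm : m ≤ R) : 0 ≤ relLog R m := by
  rcases Nat.eq_zero_or_pos m with rfl | h0
  · simp [relLog]
  refine div_nonneg (Real.log_nonneg ?_) (Real.log_natCast_nonneg _)
  rw [le_div_iff₀ (by positivity), one_mul]
  exact_mod_cast hm

lemma relLog_anti {m n : ℕ} (hm : 0 < m) (hmn : m ≤ n) (hn : n ≤ R) :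
    relLog R n ≤ relLog R m := by
  have hn0 : 0 < n := hm.trans_le hmn
  have hR0 : 0 < R := hn0.trans_le hn
  refine div_le_div_of_nonneg_right (Real.log_le_log (by positivity) ?_)
    (Real.log_natCast_nonneg _)
  gcongr

lemma relLog_le_one {m : ℕ} (hm : m ≤ R) : relLog R m ≤ 1 := by
  rcases Nat.eq_zero_or_pos m with rfl | h0
  · simp [relLog]
  have hR0 : 0 < R := h0.trans_le hm
  refine div_le_one_of_le₀ (Real.log_le_log (by positivity) ?_) (Real.log_natCast_nonneg _)
  exact div_le_self (by positivity) (by exact_mod_cast h0)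

lemma truncPow_of_le {m : ℕ} (hm : m ≤ R) (j : ℕ) : truncPow R j m = relLog R m ^ j := if_pos hm

lemma truncPow_of_lt {m : ℕ} (hm : R < m) (j : ℕ) : truncPow R j m = 0 := if_neg hm.not_ge

lemma decUpTo_truncPow (R j : ℕ) : DecUpTo R (truncPow R j) where
  nonneg m := by
    unfold truncPow
    split_ifs with h
    · exact pow_nonneg (relLog_nonneg h) _
    · exact le_rfl
  zero m hm := truncPow_of_lt hm j
  anti m n hm hmn := by
    unfold truncPow
    split_ifs with h1 h2 h2
    · exact pow_le_pow_left₀ (relLog_nonneg h1) (relLog_anti hm hmn h1) _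
    · omega
    · exact pow_nonneg (relLog_nonneg h2) _
    · exact le_rfl

lemma truncPow_nonneg (j m : ℕ) : 0 ≤ truncPow R j m := (decUpTo_truncPow R j).nonneg m

lemma truncPow_le_zero (j m : ℕ) : truncPow R j m ≤ truncPow R 0 m := by
  unfold truncPow
  split_ifs with h
  · rw [pow_zero]
    exact pow_le_one₀ (relLog_nonneg h) (relLog_le_one h)
  · exact le_rfl

lemma truncPow_one (hR : 1 < R) (j : ℕ) : truncPow R j 1 = 1 := by
  rw [truncPow_of_le hR.le, relLog_one hR, one_pow]

end truncPow

lemma copSum_sum {W R : ℕ} {ι : Type*} (t : Finset ι) (f : ι → ℝ) (F : ι → ℕ → ℝ) (m : ℕ) :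
    copSum W R (fun m => ∑ j ∈ t, f j * F j m) m = ∑ j ∈ t, f j * copSum W R (F j) m := by
  simp only [copSum, mul_sum, sum_div]
  rw [sum_comm]
  refine sum_congr rfl fun j _ => sum_congr rfl fun a _ => by ring

lemma iterate_copSum_sum {W R : ℕ} {ι : Type*} (t : Finset ι) (f : ι → ℝ) (k : ℕ) :
    ∀ (F : ι → ℕ → ℝ), (copSum W R)^[k] (fun m => ∑ j ∈ t, f j * F j m) =
      fun m => ∑ j ∈ t, f j * (copSum W R)^[k] (F j) m := by
  induction k with
  | zero => intro F; rfl
  | succ k ih =>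
    intro F
    simp only [Function.iterate_succ_apply]
    rw [← ih]
    congr 1
    ext m
    exact copSum_sum t f F m

lemma sum_filter_log_le_inv {W R m : ℕ} (hm : 0 < m) (hmR : m ≤ R) {x : ℝ}
    (hxL : x ≤ Real.log ((R : ℝ) / m)) :
    ∑ a ∈ ((cop W R).filter (fun a => m * a ≤ R)).filter (fun a : ℕ => Real.log a ≤ x),
      (a : ℝ)⁻¹ = copHarm W (Real.exp x) := by
  unfold copHarm
  refine sum_congr ?_ fun _ _ => rfl
  ext a
  have hR0 : (0 : ℝ) < R := by exact_mod_cast hm.trans_le hmR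
  have hm0 : (0 : ℝ) < m := by exact_mod_cast hm
  simp only [mem_filter, mem_cop, Nat.le_floor_iff (Real.exp_pos x).le]
  constructor
  · rintro ⟨⟨⟨⟨h1, h2⟩, h3⟩, h4⟩, h5⟩
    exact ⟨⟨h1, (Real.log_le_iff_le_exp (by exact_mod_cast h1)).1 h5⟩, h3⟩
  · rintro ⟨⟨h1, h2⟩, h3⟩
    have ha : (a : ℝ) ≤ R / m := by
      refine h2.trans ?_
      rwa [← Real.le_log_iff_exp_le (by positivity)]
    rw [le_div_iff₀ hm0] at ha
    have ha' : m * a ≤ R := by rw [mul_comm]; exact_mod_cast ha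
    exact ⟨⟨⟨⟨h1, (Nat.le_mul_of_pos_left a hm).trans ha'⟩, h3⟩, ha'⟩,
      (Real.log_le_iff_le_exp (by exact_mod_cast h1)).2 h2⟩

lemma copSum_truncPow_eq {W R m : ℕ} (hm : 0 < m) (hmR : m ≤ R) (j : ℕ) :
    copSum W R (truncPow R j) m = (∑ a ∈ (cop W R).filter (fun a => m * a ≤ R),
      (a : ℝ)⁻¹ * (Real.log ((R : ℝ) / m) - Real.log a) ^ j) / Real.log R ^ j := by
  rw [copSum, sum_filter, sum_div]
  refine sum_congr rfl fun a ha => ?_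
  have ha0 : (0 : ℝ) < a := by exact_mod_cast (mem_cop.1 ha).1.1
  have hR0 : (0 : ℝ) < R := by exact_mod_cast hm.trans_le hmR
  have hm0 : (0 : ℝ) < m := by exact_mod_cast hm
  split_ifs with h
  · rw [truncPow_of_le h, relLog, Nat.cast_mul, ← div_div, Real.log_div (by positivity) ha0.ne',
      div_pow]
    ring
  · rw [truncPow_of_lt (not_le.1 h)]
    simp

section Asymp

variable {W R : ℕ} {c A : ℝ}

/-- One application of the averaging operator integrates a truncated power. -/
lemma abs_copSum_truncPow_sub_le
    (hA : ∀ x : ℝ, 0 ≤ x → |copHarm W (Real.exp x) - c * x| ≤ A) (hR : 1 < R) (j : ℕ) {m : ℕ}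
    (hm : 0 < m) :
    |copSum W R (truncPow R j) m - c * Real.log R / (j + 1) * truncPow R (j + 1) m| ≤
      A * truncPow R j m := by
  rcases lt_or_ge R m with hmR | hmR
  · rw [(decUpTo_truncPow R j).copSum.zero m hmR, truncPow_of_lt hmR, truncPow_of_lt hmR]
    simp
  have hL : 0 < Real.log R := Real.log_pos (by exact_mod_cast hR)
  have hR0 : (0 : ℝ) < R := by exact_mod_cast hm.trans_le hmR
  have hm0 : (0 : ℝ) < m := by exact_mod_cast hm
  have hlog : 0 ≤ Real.log ((R : ℝ) / m) :=
    Real.log_nonneg (by rw [le_div_iff₀ hm0, one_mul]; exact_mod_cast hmR)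
  have ht : ∀ a ∈ (cop W R).filter (fun a => m * a ≤ R),
      0 ≤ Real.log a ∧ Real.log a ≤ Real.log ((R : ℝ) / m) := by
    intro a ha
    rw [mem_filter, mem_cop] at ha
    have ha0 : (0 : ℝ) < a := by exact_mod_cast ha.1.1.1
    refine ⟨Real.log_natCast_nonneg _, Real.log_le_log ha0 ?_⟩
    rw [le_div_iff₀ hm0, mul_comm]
    exact_mod_cast ha.2
  have hup := sum_mul_sub_pow_le _ (fun a : ℕ => (a : ℝ)⁻¹) (fun a : ℕ => Real.log a) hlog ht
    (c := c) (C := A) (fun x hx hxL => by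
      rw [sum_filter_log_le_inv hm hmR hxL]
      linarith [(abs_le.1 (hA x hx)).2]) j
  have hlo := le_sum_mul_sub_pow _ (fun a : ℕ => (a : ℝ)⁻¹) (fun a : ℕ => Real.log a) hlog ht
    (c := c) (C := A) (fun x hx hxL => by
      rw [sum_filter_log_le_inv hm hmR hxL]
      linarith [(abs_le.1 (hA x hx)).1]) j
  rw [copSum_truncPow_eq hm hmR, truncPow_of_le hmR, truncPow_of_le hmR, relLog, div_pow, div_pow]
  have hj : (0 : ℝ) < (j : ℝ) + 1 := by positivity
  have e1 : c * Real.log R / (j + 1) *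
      (Real.log ((R : ℝ) / m) ^ (j + 1) / Real.log R ^ (j + 1)) =
      c * Real.log ((R : ℝ) / m) ^ (j + 1) / (j + 1) / Real.log R ^ j := by
    field_simp
    ring
  rw [e1, ← sub_div, abs_div, abs_of_pos (pow_pos hL j), mul_div_assoc']
  gcongr
  rw [abs_le]
  constructor <;> linarith

lemma abs_iterate_copSum_truncPow_sub_le (hc : 0 ≤ c) (hc1 : c ≤ 1) (hA0 : 0 ≤ A)
    (hA : ∀ x : ℝ, 0 ≤ x → |copHarm W (Real.exp x) - c * x| ≤ A) (hR : 1 ≤ Real.log R) (k j : ℕ) :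
    ∀ m, 0 < m → |(copSum W R)^[k] (truncPow R j) m -
        (c * Real.log R) ^ k * (j.factorial / (j + k).factorial) * truncPow R (j + k) m| ≤
      k * (1 + A) ^ k * (Real.log R ^ k / Real.log R) * truncPow R 0 m := by
  have hR1 : 1 < R := by
    by_contra h
    interval_cases R <;> norm_num at hR
  set ℓ := Real.log R with hℓ
  have hℓ0 : 0 < ℓ := by linarith
  induction k with
  | zero => intro m _; simp [div_self (Nat.cast_ne_zero.2 j.factorial_ne_zero : (j.factorial : ℝ) ≠ 0)]
  | succ k ih =>
    intro m hm
    rw [Function.iterate_succ_apply']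
    set a := (c * ℓ) ^ k * ((j.factorial : ℝ) / (j + k).factorial) with ha
    set e := k * (1 + A) ^ k * (ℓ ^ k / ℓ) with he
    have ha0 : 0 ≤ a := by positivity
    have he0 : 0 ≤ e := by positivity
    have hfac : (j.factorial : ℝ) / (j + k).factorial ≤ 1 :=
      div_le_one_of_le₀ (by exact_mod_cast Nat.factorial_le (by omega)) (by positivity)
    have haℓ : a ≤ ℓ ^ k := by
      have h1 : (c * ℓ) ^ k ≤ ℓ ^ k :=
        pow_le_pow_left₀ (by positivity) (mul_le_of_le_one_left hℓ0.le hc1) _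
      calc a ≤ ℓ ^ k * 1 := by rw [ha]; gcongr
        _ = _ := mul_one _
    have h1 := abs_copSum_truncPow_sub_le hA hR1 (j + k) hm
    have h0 := abs_copSum_truncPow_sub_le hA hR1 0 hm
    have hcop : |copSum W R ((copSum W R)^[k] (truncPow R j)) m -
        a * copSum W R (truncPow R (j + k)) m| ≤ e * copSum W R (truncPow R 0) m := by
      simp only [copSum, mul_sum, ← sum_sub_distrib]
      refine (abs_sum_le_sum_abs _ _).trans (sum_le_sum fun b hb => ?_)
      have hb0 := (mem_cop.1 hb).1.1
      have := ih (m * b) (Nat.mul_pos hm hb0)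
      rw [mul_div_assoc', mul_div_assoc', ← sub_div, abs_div, abs_of_nonneg (Nat.cast_nonneg (α := ℝ) b)]
      gcongr
    have hq0 := truncPow_nonneg (R := R) 0 m
    have hqj := truncPow_le_zero (R := R) (j + k) m
    have hq1 := truncPow_le_zero (R := R) 1 m
    have hT0 : copSum W R (truncPow R 0) m ≤ (ℓ * (1 + A)) * truncPow R 0 m := by
      have h := (abs_le.1 h0).2
      have e1 : c * ℓ / ((0 : ℕ) + 1 : ℝ) * truncPow R (0 + 1) m ≤ ℓ * truncPow R 0 m := by
        simp only [Nat.cast_zero, zero_add, div_one]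
        have := truncPow_nonneg (R := R) 1 m
        calc c * ℓ * truncPow R 1 m ≤ 1 * ℓ * truncPow R 0 m := by gcongr
          _ = _ := by ring
      have e2 : A * truncPow R 0 m ≤ ℓ * A * truncPow R 0 m := by
        have : A ≤ ℓ * A := le_mul_of_one_le_left hA0 hR
        gcongr
      linarith
    have key : (c * ℓ) ^ (k + 1) * ((j.factorial : ℝ) / (j + (k + 1)).factorial) =
        a * (c * ℓ / ((j + k : ℕ) + 1)) := by
      rw [ha, ← add_assoc, Nat.factorial_succ]
      push_cast
      field_simp
      ring
    rw [key]
    have h2 : |a * copSum W R (truncPow R (j + k)) m -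
        a * (c * ℓ / ((j + k : ℕ) + 1)) * truncPow R (j + (k + 1)) m| ≤
        ℓ ^ k * (A * truncPow R 0 m) := by
      rw [mul_assoc a, ← mul_sub, abs_mul, abs_of_nonneg ha0]
      have : A * truncPow R (j + k) m ≤ A * truncPow R 0 m := by gcongr
      exact mul_le_mul haℓ (h1.trans this) (abs_nonneg _) (by positivity)
    have h3 : e * copSum W R (truncPow R 0) m ≤ e * (ℓ * (1 + A) * truncPow R 0 m) := by gcongr
    have h4 : ((k + 1 : ℕ) : ℝ) * (1 + A) ^ (k + 1) * (ℓ ^ (k + 1) / ℓ) =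
        e * (ℓ * (1 + A)) + (1 + A) ^ (k + 1) * ℓ ^ k := by
      rw [he]
      push_cast
      field_simp
      ring
    have h5 : A ≤ (1 + A) ^ (k + 1) := by
      have := one_le_pow₀ (n := k) (show 1 ≤ 1 + A by linarith)
      rw [pow_succ]
      nlinarith
    have h6 : ℓ ^ k * (A * truncPow R 0 m) ≤ (1 + A) ^ (k + 1) * ℓ ^ k * truncPow R 0 m := by
      calc _ = A * ℓ ^ k * truncPow R 0 m := by ring
        _ ≤ _ := by gcongr
    rw [h4]
    have := abs_sub_le (copSum W R ((copSum W R)^[k] (truncPow R j)) m)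
      (a * copSum W R (truncPow R (j + k)) m)
      (a * (c * ℓ / ((j + k : ℕ) + 1)) * truncPow R (j + (k + 1)) m)
    linarith

/-- The polynomial `∑ f j y ^ j` in the relative logarithmic distance, truncated at `R`. -/
noncomputable def truncPoly (R N : ℕ) (f : ℕ → ℝ) (m : ℕ) : ℝ :=
  ∑ j ∈ range N, f j * truncPow R j m

lemma abs_iterate_copSum_truncPoly_one_sub_le (hc : 0 ≤ c) (hc1 : c ≤ 1) (hA0 : 0 ≤ A)
    (hA : ∀ x : ℝ, 0 ≤ x → |copHarm W (Real.exp x) - c * x| ≤ A) (hR : 1 ≤ Real.log R) (k N : ℕ)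
    (f : ℕ → ℝ) :
    |(copSum W R)^[k] (truncPoly R N f) 1 - (c * Real.log R) ^ k *
        ∑ j ∈ range N, f j * (j.factorial / (j + k).factorial)| ≤
      k * (1 + A) ^ k * (∑ j ∈ range N, |f j|) * (Real.log R ^ k / Real.log R) := by
  have hR1 : 1 < R := by
    by_contra h
    interval_cases R <;> norm_num at hR
  unfold truncPoly
  rw [iterate_copSum_sum]
  simp only [mul_sum, sum_mul, ← sum_sub_distrib]
  refine (abs_sum_le_sum_abs _ _).trans (sum_le_sum fun j _ => ?_)
  have h := abs_iterate_copSum_truncPow_sub_le hc hc1 hA0 hA hR k j 1 one_pos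
  rw [truncPow_one hR1, truncPow_one hR1] at h
  calc _ = |f j| * |(copSum W R)^[k] (truncPow R j) 1 - (c * Real.log R) ^ k *
        (j.factorial / (j + k).factorial) * 1| := by rw [← abs_mul]; congr 1; ring
    _ ≤ |f j| * (k * (1 + A) ^ k * (Real.log R ^ k / Real.log R) * 1) := by gcongr
    _ = _ := by ring

lemma decUpTo_truncPoly (R N : ℕ) {f : ℕ → ℝ} (hf : ∀ j, 0 ≤ f j) :
    DecUpTo R (truncPoly R N f) where
  nonneg m := sum_nonneg fun j _ => mul_nonneg (hf j) (truncPow_nonneg j m)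
  zero m hm := sum_eq_zero fun j _ => by rw [truncPow_of_lt hm, mul_zero]
  anti m n hm hmn := sum_le_sum fun j _ =>
    mul_le_mul_of_nonneg_left ((decUpTo_truncPow R j).anti m n hm hmn) (hf j)

end Asymp

/-- The sieve weight `1 + β y`, truncated at `R`. -/
noncomputable def linWeight (R : ℕ) (β : ℝ) (m : ℕ) : ℝ := truncPow R 0 m + β * truncPow R 1 m

lemma decUpTo_linWeight (R : ℕ) {β : ℝ} (hβ : 0 ≤ β) : DecUpTo R (linWeight R β) where
  nonneg m := add_nonneg (truncPow_nonneg _ _) (mul_nonneg hβ (truncPow_nonneg _ _))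
  zero m hm := by rw [linWeight, truncPow_of_lt hm, truncPow_of_lt hm, mul_zero, add_zero]
  anti m n hm hmn := add_le_add ((decUpTo_truncPow R 0).anti m n hm hmn)
    (mul_le_mul_of_nonneg_left ((decUpTo_truncPow R 1).anti m n hm hmn) hβ)

lemma linWeight_of_le {R m : ℕ} (hm : m ≤ R) (β : ℝ) :
    linWeight R β m = 1 + β * relLog R m := by
  rw [linWeight, truncPow_of_le hm, truncPow_of_le hm, pow_zero, pow_one]

lemma linWeight_le {R : ℕ} {β : ℝ} (hβ : 0 ≤ β) (m : ℕ) :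
    linWeight R β m ≤ (1 + β) * truncPow R 0 m := by
  have := mul_le_mul_of_nonneg_left (truncPow_le_zero (R := R) 1 m) hβ
  rw [linWeight]
  linarith

/-- The constant in the mean square of the sieve weights. -/
noncomputable def squareConst (k : ℕ) (β : ℝ) : ℝ :=
  2 / (k + 2).factorial + 6 * β / (k + 3).factorial + 6 * β ^ 2 / (k + 4).factorial

/-- The constant in the divisor-weighted mean square of the sieve weights. -/
noncomputable def divisorConst (k : ℕ) (β κ : ℝ) : ℝ :=
  κ / (k + 1).factorial + (2 * κ * β + 1) / (k + 2).factorial +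
    (2 * κ * β ^ 2 + 4 * β) / (k + 3).factorial + 4 * β ^ 2 / (k + 4).factorial

section Main

variable {W R : ℕ} {c A β : ℝ}

lemma copSum_linWeight (m : ℕ) : copSum W R (linWeight R β) m =
    copSum W R (truncPow R 0) m + β * copSum W R (truncPow R 1) m := by
  simp only [copSum, linWeight, mul_sum, ← sum_add_distrib]
  exact sum_congr rfl fun a _ => by ring

lemma one_lt_of_one_le_log (hR : 1 ≤ Real.log R) : 1 < R := by
  by_contra h
  interval_cases R <;> norm_num at hR

lemma abs_copSum_linWeight_sub_le (hA0 : 0 ≤ A) (hβ : 0 ≤ β)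
    (hA : ∀ x : ℝ, 0 ≤ x → |copHarm W (Real.exp x) - c * x| ≤ A) (hR : 1 < R) {m : ℕ}
    (hm : 0 < m) (hmR : m ≤ R) :
    |copSum W R (linWeight R β) m -
        c * Real.log R * (relLog R m + β * relLog R m ^ 2 / 2)| ≤ A * (1 + β) := by
  have h0 := abs_copSum_truncPow_sub_le hA hR 0 hm
  have h1 := abs_copSum_truncPow_sub_le hA hR 1 hm
  simp only [truncPow_of_le hmR] at h0 h1
  have hy := relLog_le_one hmR
  rw [copSum_linWeight]
  norm_num at h0 h1
  calc _ = |(copSum W R (truncPow R 0) m - c * Real.log R * relLog R m) +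
        β * (copSum W R (truncPow R 1) m - c * Real.log R / 2 * relLog R m ^ 2)| := by
        congr 1; ring
    _ ≤ A + β * (A * relLog R m) := by
        refine (abs_add_le _ _).trans (add_le_add h0 ?_)
        rw [abs_mul, abs_of_nonneg hβ]
        gcongr
    _ ≤ A + β * (A * 1) := by gcongr
    _ = _ := by ring

/-- Lower bound for the main term of the mean square of the sieve weights. -/
lemma exists_le_sum_sieveY_sq (k : ℕ) (hc : 0 ≤ c) (hc1 : c ≤ 1) (hA0 : 0 ≤ A) (hβ : 0 ≤ β)
    (hA : ∀ x : ℝ, 0 ≤ x → |copHarm W (Real.exp x) - c * x| ≤ A) :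
    ∃ C : ℝ, ∀ R : ℕ, 1 ≤ Real.log R → (∀ p ∈ primesCop W R, k < p) →
      Real.log R ^ (k + 2) * (c ^ (k + 2) * squareConst k β - C / Real.log R) ≤
        ∑ S ∈ (primesCop W R).powerset, (∏ p ∈ S, (k : ℝ) / (p - k)) *
          sieveY (primesCop W R) (linWeight R β) S ^ 2 := by
  refine ⟨2 * c * A * (1 + β) ^ 2 + k * (1 + A) ^ k *
    (2 * c * A * (1 + β) ^ 2 + c ^ 2 + c ^ 2 * β + c ^ 2 * β ^ 2 / 4), fun R hR hP => ?_⟩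
  have hR1 := one_lt_of_one_le_log hR
  set ℓ := Real.log R with hℓ
  have hℓ0 : 0 < ℓ := by linarith
  set P := primesCop W R with hPdef
  have hZ := decUpTo_linWeight R hβ
  have hZ' := hZ.copSum (W := W)
  have hF : DecUpTo R fun m => copSum W R (linWeight R β) m ^ 2 :=
    { nonneg := fun m => sq_nonneg _
      zero := fun m hm => by rw [hZ'.zero m hm]; ring
      anti := fun m n hm hmn =>
        pow_le_pow_left₀ (hZ'.nonneg n) (hZ'.anti m n hm hmn) 2 }
  set f : ℕ → ℝ := fun j => if j = 0 then -(2 * c * A * (1 + β) ^ 2) / ℓ else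
    if j = 2 then c ^ 2 else if j = 3 then c ^ 2 * β else if j = 4 then c ^ 2 * β ^ 2 / 4 else 0
    with hf
  have hsquare_iter : (copSum W R)^[k] (fun m => copSum W R (linWeight R β) m ^ 2) 1 ≤
      ∑ S ∈ P.powerset, (∏ p ∈ S, (k : ℝ) / (p - k)) * sieveY P (linWeight R β) S ^ 2 := by
    refine (hF.iterate_copSum_le_sum hP le_rfl).trans (sum_le_sum fun S hS => ?_)
    have hu : 0 ≤ ∏ p ∈ S, (k : ℝ) / (p - k) := prod_nonneg fun p hp => by
      have : (k : ℝ) < p := by exact_mod_cast hP p (mem_powerset.1 hS hp)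
      exact div_nonneg (Nat.cast_nonneg _) (by linarith)
    refine mul_le_mul_of_nonneg_left (pow_le_pow_left₀ (hZ'.nonneg _) ?_ 2) hu
    exact hZ.copSum_le_sum (mem_powerset.1 hS) (prod_primes_pos (prime_of_mem_powerset hS))
  have hpoly_le : ∀ m, 0 < m → ℓ ^ 2 * truncPoly R 5 f m ≤ copSum W R (linWeight R β) m ^ 2 := by
    intro m hm
    rcases lt_or_ge R m with hmR | hmR
    · have : truncPoly R 5 f m = 0 := sum_eq_zero fun j _ => by rw [truncPow_of_lt hmR, mul_zero]
      rw [this, mul_zero]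
      exact sq_nonneg _
    have hy0 := relLog_nonneg hmR
    have hy1 := relLog_le_one hmR
    set y := relLog R m with hy
    have hT := (abs_le.1 (abs_copSum_linWeight_sub_le hA0 hβ hA hR1 hm hmR)).1
    have hT0 := hZ'.nonneg m
    set T := copSum W R (linWeight R β) m
    have hpoly : ℓ ^ 2 * truncPoly R 5 f m =
        (c * ℓ * (y + β * y ^ 2 / 2)) ^ 2 - 2 * (c * ℓ * (1 + β)) * (A * (1 + β)) := by
      simp only [truncPoly, sum_range_succ, sum_range_zero, truncPow_of_le hmR, hf]
      norm_num
      rw [← hy]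
      field_simp
      ring
    rw [hpoly]
    have hz0 : 0 ≤ c * ℓ * (y + β * y ^ 2 / 2) := by positivity
    have hz1 : c * ℓ * (y + β * y ^ 2 / 2) ≤ c * ℓ * (1 + β) := by
      have : y ^ 2 ≤ 1 := pow_le_one₀ hy0 hy1
      gcongr
      nlinarith
    set z := c * ℓ * (y + β * y ^ 2 / 2)
    have hAβ : 0 ≤ A * (1 + β) := by positivity
    rcases le_total z (A * (1 + β)) with h | h
    · nlinarith [sq_nonneg T]
    · nlinarith
  have hiter_le := iterate_copSum_mono (W := W) (R := R) k hpoly_le 1 one_pos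
  have e1 : (copSum W R)^[k] (fun m => ℓ ^ 2 * truncPoly R 5 f m) 1 =
      ℓ ^ 2 * (copSum W R)^[k] (truncPoly R 5 f) 1 := by
    have := iterate_copSum_sum (W := W) (R := R) {()} (fun _ => ℓ ^ 2) k fun _ => truncPoly R 5 f
    simp only [sum_singleton] at this
    rw [this]
  rw [e1] at hiter_le
  have hiter_abs := (abs_le.1 (abs_iterate_copSum_truncPoly_one_sub_le hc hc1 hA0 hA hR k 5 f)).1
  rw [← hℓ] at hiter_abs
  have hsum : ∑ j ∈ range 5, f j * ((j.factorial : ℝ) / (j + k).factorial) =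
      -(2 * c * A * (1 + β) ^ 2) / ℓ / k.factorial + c ^ 2 * squareConst k β := by
    simp only [sum_range_succ, sum_range_zero, hf, squareConst]
    norm_num [Nat.factorial]
    simp only [add_comm 2 k, add_comm 3 k, add_comm 4 k]
    norm_num [Nat.factorial]
    field_simp
    ring
  have habs : ∑ j ∈ range 5, |f j| ≤
      2 * c * A * (1 + β) ^ 2 + c ^ 2 + c ^ 2 * β + c ^ 2 * β ^ 2 / 4 := by
    have h0 : |f 0| ≤ 2 * c * A * (1 + β) ^ 2 := by
      simp only [hf, if_true]
      rw [abs_div, abs_neg, abs_of_nonneg (by positivity), abs_of_pos hℓ0]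
      exact div_le_self (by positivity) hR
    have h2 : |f 2| = c ^ 2 := by simp [hf]
    have h3 : |f 3| = c ^ 2 * β := by simp [hf, abs_of_nonneg hβ]
    have h4 : |f 4| = c ^ 2 * β ^ 2 / 4 := by
      simp [hf, abs_div]
    have h1 : |f 1| = 0 := by simp [hf]
    simp only [sum_range_succ, sum_range_zero, h1, h2, h3, h4]
    linarith
  rw [hsum] at hiter_abs
  refine le_trans ?_ (hiter_le.trans hsquare_iter)
  have hck : c ^ k ≤ 1 := pow_le_one₀ hc hc1
  have hfac : (1 : ℝ) ≤ k.factorial := by exact_mod_cast k.factorial_pos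
  have e2 : (c * ℓ) ^ k * (2 * c * A * (1 + β) ^ 2 / ℓ / k.factorial) ≤
      ℓ ^ k * (2 * c * A * (1 + β) ^ 2 / ℓ) := by
    rw [mul_pow]
    calc _ ≤ 1 * ℓ ^ k * (2 * c * A * (1 + β) ^ 2 / ℓ) := by
          refine mul_le_mul ?_ (div_le_self (by positivity) hfac) (by positivity) (by positivity)
          gcongr
      _ = _ := by ring
  have e3 : k * (1 + A) ^ k * (∑ j ∈ range 5, |f j|) * (ℓ ^ k / ℓ) ≤ k * (1 + A) ^ k *
      (2 * c * A * (1 + β) ^ 2 + c ^ 2 + c ^ 2 * β + c ^ 2 * β ^ 2 / 4) * (ℓ ^ k / ℓ) := by gcongr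
  set H := 2 * c * A * (1 + β) ^ 2 with hH
  set M := k * (1 + A) ^ k * (H + c ^ 2 + c ^ 2 * β + c ^ 2 * β ^ 2 / 4) with hM
  have e4 : ℓ ^ k * (c ^ (k + 2) * squareConst k β - (H + M) / ℓ) ≤
      (copSum W R)^[k] (truncPoly R 5 f) 1 := by
    have : ℓ ^ k * (c ^ (k + 2) * squareConst k β - (H + M) / ℓ) =
        (c * ℓ) ^ k * (c ^ 2 * squareConst k β) - ℓ ^ k * (H / ℓ) - M * (ℓ ^ k / ℓ) := by
      rw [mul_pow]
      ring
    rw [this]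
    have e5 : (c * ℓ) ^ k * (-H / ℓ / k.factorial + c ^ 2 * squareConst k β) =
      (c * ℓ) ^ k * (c ^ 2 * squareConst k β) - (c * ℓ) ^ k * (H / ℓ / k.factorial) := by ring
    rw [e5] at hiter_abs
    linarith
  calc _ = ℓ ^ 2 * (ℓ ^ k * (c ^ (k + 2) * squareConst k β - (H + M) / ℓ)) := by ring
    _ ≤ _ := by gcongr

end Main

lemma log_div_eq_mul_relLog {R : ℕ} (hR : 1 < R) (m : ℕ) :
    Real.log ((R : ℝ) / m) = Real.log R * relLog R m := by
  rw [relLog, mul_div_cancel₀ _ (Real.log_pos (by exact_mod_cast hR)).ne']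

lemma log_mul_relLog_mul {R m n : ℕ} (hR : 1 < R) (hm : 0 < m) (hn : 0 < n) :
    Real.log R * relLog R (m * n) = Real.log R * relLog R m - Real.log n := by
  have hR0 : (0 : ℝ) < R := by exact_mod_cast zero_lt_one.trans hR
  have hm0 : (0 : ℝ) < m := by exact_mod_cast hm
  have hn0 : (0 : ℝ) < n := by exact_mod_cast hn
  rw [← log_div_eq_mul_relLog hR, ← log_div_eq_mul_relLog hR, Nat.cast_mul, ← div_div,
    Real.log_div (by positivity) hn0.ne']

section Main

variable {W R : ℕ} {c A β κ C₁ : ℝ}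

lemma sum_log_div_mul_linWeight_le (hβ : 0 ≤ β) (hC₁0 : 0 ≤ C₁)
    (hC₁ : ∀ P : Finset ℕ, (∀ p ∈ P, p.Prime) → ∀ x : ℝ, 0 ≤ x →
      ∑ p ∈ P.filter (fun p : ℕ => Real.log p ≤ x), Real.log p / ((p : ℝ) - 1) ≤ x + C₁)
    (hR : 1 < R) {P : Finset ℕ} (hP : ∀ p ∈ P, p.Prime) {m : ℕ} (hm : 0 < m) (hmR : m ≤ R) :
    ∑ p ∈ P, Real.log p / (p - 1) * linWeight R β (m * p) ≤
      Real.log R * (relLog R m + β * relLog R m ^ 2 / 2) + C₁ * (1 + β) := by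
  have hℓ : 0 < Real.log R := Real.log_pos (by exact_mod_cast hR)
  set ℓ := Real.log R with hℓd
  set y := relLog R m with hy
  have hy0 : 0 ≤ y := relLog_nonneg hmR
  have hy1 : y ≤ 1 := relLog_le_one hmR
  set s := P.filter fun p => m * p ≤ R with hs
  have hsP : ∀ p ∈ s, p.Prime := fun p hp => hP p (mem_filter.1 hp).1
  have e1 : ∑ p ∈ P, Real.log p / (p - 1) * linWeight R β (m * p) =
      ∑ p ∈ s, Real.log p / (p - 1) * (ℓ * y - Real.log p) ^ 0 +
      β / ℓ * ∑ p ∈ s, Real.log p / (p - 1) * (ℓ * y - Real.log p) ^ 1 := by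
    rw [mul_sum, ← sum_add_distrib, hs, sum_filter]
    refine sum_congr rfl fun p hp => ?_
    split_ifs with h
    · rw [linWeight_of_le h, pow_zero, pow_one, hy, ← log_mul_relLog_mul hR hm (hP p hp).pos]
      field_simp
      rw [← hℓd]
      ring
    · rw [linWeight, truncPow_of_lt (not_le.1 h), truncPow_of_lt (not_le.1 h)]
      ring
  have ht : ∀ p ∈ s, 0 ≤ Real.log (p : ℕ) ∧ Real.log (p : ℕ) ≤ ℓ * y := by
    intro p hp
    have h := relLog_nonneg (mem_filter.1 hp).2
    have h2 := log_mul_relLog_mul hR hm (hsP p hp).pos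
    refine ⟨Real.log_natCast_nonneg _, ?_⟩
    have : 0 ≤ ℓ * relLog R (m * p) := mul_nonneg hℓ.le h
    linarith
  have hM : ∀ x, 0 ≤ x → x ≤ ℓ * y →
      ∑ p ∈ s.filter (fun p : ℕ => Real.log p ≤ x), Real.log p / ((p : ℝ) - 1) ≤ 1 * x + C₁ :=
    fun x hx _ => by rw [one_mul]; exact hC₁ s hsP x hx
  have h0 := sum_mul_sub_pow_le s (fun p : ℕ => Real.log p / ((p : ℝ) - 1))
    (fun p : ℕ => Real.log p) (by positivity) ht hM 0
  have h1 := sum_mul_sub_pow_le s (fun p : ℕ => Real.log p / ((p : ℝ) - 1))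
    (fun p : ℕ => Real.log p) (by positivity) ht hM 1
  rw [e1]
  calc _ ≤ (1 * (ℓ * y) ^ (0 + 1) / ((0 : ℕ) + 1) + C₁ * (ℓ * y) ^ 0) +
        β / ℓ * (1 * (ℓ * y) ^ (1 + 1) / ((1 : ℕ) + 1) + C₁ * (ℓ * y) ^ 1) := by gcongr
    _ = ℓ * (y + β * y ^ 2 / 2) + C₁ * (1 + β * y) := by
        field_simp
        norm_num
        ring
    _ ≤ ℓ * (y + β * y ^ 2 / 2) + C₁ * (1 + β * 1) := by gcongr
    _ = _ := by ring

/-- The error constant in the inner sum of the divisor-weighted mean square. -/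
noncomputable def innerErr (c A β κ C₁ : ℝ) : ℝ :=
  2 * C₁ * (1 + β) ^ 2 * c +
    A * (κ * (1 + β) ^ 2 + (3 + 5 * β + 2 * β ^ 2) + 2 * C₁ * (1 + β) ^ 2)

/-- Coefficients of the polynomial bounding the inner sum of the divisor-weighted mean square. -/
noncomputable def innerCoeff (ℓ c A β κ C₁ : ℝ) : ℕ → ℝ
  | 0 => ℓ * innerErr c A β κ C₁
  | 1 => c * ℓ ^ 2 * κ
  | 2 => c * ℓ ^ 2 * (κ * β + 1 / 2)
  | 3 => c * ℓ ^ 2 * (κ * β ^ 2 / 3 + 2 * β / 3)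
  | 4 => c * ℓ ^ 2 * (β ^ 2 / 6)
  | _ => 0

lemma divisorMain_le {D : ℕ} (hD : 2 ≤ D) (hPD : ∀ p ∈ primesCop W R, D < p)
    (hc : 0 ≤ c) (hA0 : 0 ≤ A) (hβ : 0 ≤ β) (hκ : 1 ≤ κ) (hC₁0 : 0 ≤ C₁)
    (hA : ∀ x : ℝ, 0 ≤ x → |copHarm W (Real.exp x) - c * x| ≤ A)
    (hC₁ : ∀ P : Finset ℕ, (∀ p ∈ P, p.Prime) → ∀ x : ℝ, 0 ≤ x →
      ∑ p ∈ P.filter (fun p : ℕ => Real.log p ≤ x), Real.log p / ((p : ℝ) - 1) ≤ x + C₁)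
    (hR : 1 ≤ Real.log R) {K : ℝ} (hK : K ≤ c * κ * Real.log R) {S : Finset ℕ}
    (hS : S ⊆ primesCop W R) :
    divisorMain (primesCop W R) (linWeight R β) c K S ≤
      c * Real.exp (2 / D) * ((∏ p ∈ S, (p : ℝ) / (p - 1)) ^ 2 *
        truncPoly R 5 (innerCoeff (Real.log R) c A β κ C₁) (∏ p ∈ S, p)) := by
  have hR1 := one_lt_of_one_le_log hR
  set P := primesCop W R with hPd
  set ℓ := Real.log R with hℓd
  have hℓ : 0 < ℓ := by linarith
  have hpr : ∀ p ∈ P, p.Prime := fun p hp => (mem_primesCop.1 hp).2.1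
  set r := ∏ p ∈ S, p with hr
  have hr0 : 0 < r := prod_primes_pos fun p hp => hpr p (hS hp)
  have hZ := decUpTo_linWeight R hβ
  have hpos : ∀ G ∈ (P \ S).powerset, 0 < ∏ p ∈ G, p := fun G hG =>
    prod_primes_pos fun p hp => hpr p (sdiff_subset (mem_powerset.1 hG hp))
  rcases lt_or_ge R r with hrR | hrR
  · have h1 : truncPoly R 5 (innerCoeff ℓ c A β κ C₁) r = 0 :=
      sum_eq_zero fun j _ => by rw [truncPow_of_lt hrR, mul_zero]
    rw [h1, mul_zero, mul_zero, divisorMain]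
    refine le_of_eq (mul_eq_zero_of_right _ (sum_eq_zero fun G hG => ?_))
    rw [hZ.zero _ (hrR.trans_le (Nat.le_mul_of_pos_right r (hpos G hG)))]
    ring
  have hy0 := relLog_nonneg hrR
  have hy1 := relLog_le_one hrR
  set y := relLog R r with hy
  set g : ℕ → ℝ := fun j => if j = 0 then ℓ * (κ - y) + 2 * C₁ * (1 + β) ^ 2 else
    if j = 1 then ℓ * ((κ - y) * (2 * β) + 3) else
    if j = 2 then ℓ * ((κ - y) * β ^ 2 + 5 * β) else ℓ * (2 * β ^ 2) with hg
  have hκy : 0 ≤ κ - y := by linarith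
  have hg0 : ∀ j, 0 ≤ g j := by
    intro j
    simp only [hg]
    split_ifs <;> positivity
  have hdec := decUpTo_truncPoly R 4 hg0
  set Fr : ℕ → ℝ := fun h => truncPoly R 4 g (r * h) with hFr
  have hFrN : NonnegUpTo R Fr := ⟨fun h => hdec.nonneg _, fun h hh =>
    hdec.zero _ (hh.trans_le (Nat.le_mul_of_pos_left h hr0))⟩
  have hterm : ∀ G ∈ (P \ S).powerset,
      (K - c * ∑ p ∈ G, Real.log p) * linWeight R β (r * ∏ p ∈ G, p) ^ 2 +
        2 * c * linWeight R β (r * ∏ p ∈ G, p) * ∑ p ∈ (P \ S) \ G,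
          Real.log p / (p - 1) * linWeight R β (r * ∏ r ∈ insert p G, r) ≤
      c * Fr (∏ p ∈ G, p) := by
    intro G hG
    have hG0 := hpos G hG
    have hGpr : ∀ p ∈ G, p.Prime := fun p hp => hpr p (sdiff_subset (mem_powerset.1 hG hp))
    rcases lt_or_ge R (r * ∏ p ∈ G, p) with hgR | hgR
    · rw [hZ.zero _ hgR]
      have := mul_nonneg hc (hFrN.nonneg (∏ p ∈ G, p))
      simpa using this
    have hlog : ∑ p ∈ G, Real.log (p : ℕ) = Real.log (∏ p ∈ G, p : ℕ) := by
      rw [Nat.cast_prod, Real.log_prod fun p hp => by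
        exact_mod_cast (hGpr p hp).ne_zero]
    have hM : ∑ p ∈ (P \ S) \ G, Real.log p / (p - 1) * linWeight R β (r * ∏ r ∈ insert p G, r) ≤
        ℓ * (relLog R (r * ∏ p ∈ G, p) + β * relLog R (r * ∏ p ∈ G, p) ^ 2 / 2) +
          C₁ * (1 + β) := by
      refine le_trans (le_of_eq (sum_congr rfl fun p hp => ?_)) (sum_log_div_mul_linWeight_le hβ
        hC₁0 hC₁ hR1 (P := (P \ S) \ G) (fun p hp => hpr p (sdiff_subset (sdiff_subset hp)))
        (Nat.mul_pos hr0 hG0) hgR)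
      rw [prod_insert (mem_sdiff.1 hp).2, mul_assoc, mul_comm p]
    have hl := log_mul_relLog_mul hR1 hr0 hG0
    have hw0 := relLog_nonneg hgR
    have hw1 := relLog_le_one hgR
    rw [hlog, linWeight_of_le hgR]
    set v := relLog R (r * ∏ p ∈ G, p) with hv
    set M := ∑ p ∈ (P \ S) \ G, Real.log p / (p - 1) * linWeight R β (r * ∏ r ∈ insert p G, r)
    have hFv : Fr (∏ p ∈ G, p) = ℓ * (κ - y) + 2 * C₁ * (1 + β) ^ 2 +
        ℓ * ((κ - y) * (2 * β) + 3) * v + ℓ * ((κ - y) * β ^ 2 + 5 * β) * v ^ 2 +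
        ℓ * (2 * β ^ 2) * v ^ 3 := by
      simp only [hFr, truncPoly, sum_range_succ, sum_range_zero, truncPow_of_le hgR, hg, ← hv]
      norm_num
    have hβv : 1 + β * v ≤ 1 + β := by nlinarith
    have hKl : K - c * Real.log (∏ p ∈ G, p : ℕ) ≤ c * (ℓ * (κ - y + v)) := by
      have : Real.log (∏ p ∈ G, p : ℕ) = ℓ * y - ℓ * v := by linarith
      rw [this]
      linarith
    rw [hFv]
    calc _ ≤ c * (ℓ * (κ - y + v)) * (1 + β * v) ^ 2 +
          2 * c * (1 + β * v) * (ℓ * (v + β * v ^ 2 / 2) + C₁ * (1 + β)) := by gcongr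
      _ ≤ c * (ℓ * (κ - y + v)) * (1 + β * v) ^ 2 +
          (2 * c * (1 + β * v) * (ℓ * (v + β * v ^ 2 / 2)) +
            2 * c * (1 + β) * (C₁ * (1 + β))) := by
          rw [mul_add (2 * c * (1 + β * v))]
          gcongr
      _ = _ := by ring
  have hcop : ∀ m, 0 < m → (copSum W R)^[1] Fr m ≤
      truncPoly R 5 (innerCoeff ℓ c A β κ C₁) r := by
    intro m hm
    have h1 : (copSum W R)^[1] Fr m ≤ copSum W R (truncPoly R 4 g) r := by
      rw [Function.iterate_one]
      refine sum_le_sum fun a ha => ?_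
      have ha0 := (mem_cop.1 ha).1.1
      have := hdec.anti (r * a) (r * (m * a)) (Nat.mul_pos hr0 ha0)
        (Nat.mul_le_mul_left r (Nat.le_mul_of_pos_left a hm))
      gcongr
    refine h1.trans ?_
    have h2 : copSum W R (truncPoly R 4 g) r = ∑ j ∈ range 4, g j * copSum W R (truncPow R j) r :=
      copSum_sum (range 4) g (truncPow R) r
    rw [h2]
    have h3 : ∀ j, g j * copSum W R (truncPow R j) r ≤
        g j * (c * ℓ / (j + 1) * y ^ (j + 1) + A) := by
      intro j
      refine mul_le_mul_of_nonneg_left ?_ (hg0 j)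
      have := (abs_le.1 (abs_copSum_truncPow_sub_le hA hR1 j hr0)).2
      rw [truncPow_of_le hrR, truncPow_of_le hrR, ← hy, ← hℓd] at this
      have h4 : A * y ^ j ≤ A * 1 := by
        gcongr
        exact pow_le_one₀ hy0 hy1
      linarith
    refine (sum_le_sum fun j _ => h3 j).trans ?_
    have h5 : A * (g 0 + g 1 + g 2 + g 3) ≤ A * (ℓ * (κ * (1 + β) ^ 2 +
        (3 + 5 * β + 2 * β ^ 2) + 2 * C₁ * (1 + β) ^ 2)) := by
      refine mul_le_mul_of_nonneg_left ?_ hA0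
      simp only [hg]
      norm_num
      have t1 : 2 * C₁ * (1 + β) ^ 2 ≤ ℓ * (2 * C₁ * (1 + β) ^ 2) :=
        le_mul_of_one_le_left (by positivity) hR
      have t2 : ℓ * ((κ - y) * (1 + β) ^ 2) ≤ ℓ * (κ * (1 + β) ^ 2) := by
        gcongr
        linarith
      linarith
    have h6 : 2 * C₁ * (1 + β) ^ 2 * c * y * ℓ ≤ 2 * C₁ * (1 + β) ^ 2 * c * 1 * ℓ := by gcongr
    have e1 : ∑ j ∈ range 4, g j * (c * ℓ / (j + 1) * y ^ (j + 1) + A) =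
        2 * C₁ * (1 + β) ^ 2 * c * y * ℓ + A * (g 0 + g 1 + g 2 + g 3) +
        c * ℓ ^ 2 * (κ * y + (κ * β + 1 / 2) * y ^ 2 + (κ * β ^ 2 / 3 + 2 * β / 3) * y ^ 3 +
          β ^ 2 / 6 * y ^ 4) := by
      simp only [sum_range_succ, sum_range_zero, hg]
      norm_num
      ring
    have e2 : truncPoly R 5 (innerCoeff ℓ c A β κ C₁) r = ℓ * innerErr c A β κ C₁ +
        c * ℓ ^ 2 * (κ * y + (κ * β + 1 / 2) * y ^ 2 + (κ * β ^ 2 / 3 + 2 * β / 3) * y ^ 3 +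
          β ^ 2 / 6 * y ^ 4) := by
      simp only [truncPoly, sum_range_succ, sum_range_zero, truncPow_of_le hrR, innerCoeff, ← hy]
      ring
    rw [e1, e2, innerErr]
    linarith
  have hB0 : 0 ≤ truncPoly R 5 (innerCoeff ℓ c A β κ C₁) r :=
    le_trans ((hFrN.copSum (W := W)).nonneg 1) (hcop 1 one_pos)
  have hp2 : ∀ p ∈ P, (3 : ℝ) ≤ p := fun p hp => by
    have := hPD p hp
    exact_mod_cast (by omega : 3 ≤ p)
  have hinv0 : ∀ p ∈ P, (0 : ℝ) ≤ ((p : ℝ) - 1)⁻¹ := fun p hp =>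
    inv_nonneg.2 (by linarith [hp2 p hp])
  have hC := sum_prod_mul_le (by omega : 0 < D) hPD 1 (by norm_num : (0 : ℝ) ≤ 2)
    (v := fun p => ((p : ℝ) - 1)⁻¹) (fun p hp => by
      have h3 := hp2 p hp
      refine ⟨hinv0 p hp, ?_⟩
      rw [Nat.cast_one, inv_eq_one_div, div_add_div _ _ (by positivity) (by positivity),
        div_le_div_iff₀ (by linarith) (by positivity)]
      nlinarith [sq_nonneg ((p : ℝ))]) hFrN hB0 hcop
  rw [divisorMain]
  calc _ ≤ (∏ p ∈ S, (p : ℝ) / (p - 1)) ^ 2 * ∑ G ∈ (P \ S).powerset,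
        (∏ p ∈ G, ((p : ℝ) - 1)⁻¹) * (c * Fr (∏ p ∈ G, p)) := by
        refine mul_le_mul_of_nonneg_left (sum_le_sum fun G hG => ?_) (sq_nonneg _)
        refine mul_le_mul_of_nonneg_left (hterm G hG) (prod_nonneg fun p hp => ?_)
        exact hinv0 p (sdiff_subset (mem_powerset.1 hG hp))
    _ ≤ (∏ p ∈ S, (p : ℝ) / (p - 1)) ^ 2 * ∑ G ∈ P.powerset,
        (∏ p ∈ G, ((p : ℝ) - 1)⁻¹) * (c * Fr (∏ p ∈ G, p)) := by
        refine mul_le_mul_of_nonneg_left (sum_le_sum_of_subset_of_nonneg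
          (powerset_mono.2 sdiff_subset) fun G hG _ => ?_) (sq_nonneg _)
        exact mul_nonneg (prod_nonneg fun p hp => hinv0 p (mem_powerset.1 hG hp))
          (mul_nonneg hc (hFrN.nonneg _))
    _ = c * ((∏ p ∈ S, (p : ℝ) / (p - 1)) ^ 2 * ∑ G ∈ P.powerset,
        (∏ p ∈ G, ((p : ℝ) - 1)⁻¹) * Fr (∏ p ∈ G, p)) := by
        rw [mul_left_comm c, mul_sum _ _ c]
        congr 1
        exact sum_congr rfl fun G _ => by ring
    _ ≤ c * ((∏ p ∈ S, (p : ℝ) / (p - 1)) ^ 2 *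
        (Real.exp (2 / D) * truncPoly R 5 (innerCoeff ℓ c A β κ C₁) r)) := by gcongr
    _ = _ := by ring

lemma div_sub_mul_sq_le {k p : ℕ} (h' : 2 * k + 2 < p) :
    (k : ℝ) / (p - k) * (p / (p - 1)) ^ 2 ≤ k / p + (2 * k ^ 2 + 8 * k) / (p : ℝ) ^ 2 := by
  have h : (2 * k + 3 : ℝ) ≤ p := by exact_mod_cast h'
  have hk0 : (0 : ℝ) ≤ k := Nat.cast_nonneg k
  have hp0 : (0 : ℝ) < p := by linarith
  have hpk : (0 : ℝ) < p - k := by linarith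
  have h1 : (k : ℝ) / (p - k) ≤ k / p + 2 * k ^ 2 / p ^ 2 := by
    rw [div_add_div _ _ (by positivity) (by positivity), div_le_div_iff₀ hpk (by positivity)]
    nlinarith [mul_nonneg (mul_nonneg hk0 hk0) (mul_nonneg hp0.le
      (by linarith : (0 : ℝ) ≤ p - 2 * k))]
  have h2 : (k : ℝ) / (p - k) ≤ 2 * k / p := by
    rw [div_le_div_iff₀ hpk hp0]
    nlinarith
  have h3 : ((p : ℝ) / (p - 1)) ^ 2 ≤ 1 + 4 / p := by
    rw [div_pow, ← sub_nonneg]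
    have hp1 : (p : ℝ) - 1 ≠ 0 := by linarith
    have : 1 + 4 / (p : ℝ) - p ^ 2 / (p - 1) ^ 2 =
        (2 * p ^ 2 - 7 * p + 4) / (p * (p - 1) ^ 2) := by
      field_simp
      ring
    rw [this]
    exact div_nonneg (by nlinarith) (by positivity)
  calc (k : ℝ) / (p - k) * (p / (p - 1)) ^ 2 ≤ k / (p - k) * (1 + 4 / p) := by gcongr
    _ = k / (p - k) + k / (p - k) * (4 / p) := by ring
    _ ≤ (k / p + 2 * k ^ 2 / p ^ 2) + 2 * k / p * (4 / p) := by gcongr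
    _ = _ := by field_simp; ring

lemma exists_sum_mul_divisorMain_le (k : ℕ)
    (hc : 0 ≤ c) (hc1 : c ≤ 1) (hA0 : 0 ≤ A) (hβ : 0 ≤ β) (hκ : 1 ≤ κ) (hC₁0 : 0 ≤ C₁)
    (hA : ∀ x : ℝ, 0 ≤ x → |copHarm W (Real.exp x) - c * x| ≤ A)
    (hC₁ : ∀ P : Finset ℕ, (∀ p ∈ P, p.Prime) → ∀ x : ℝ, 0 ≤ x →
      ∑ p ∈ P.filter (fun p : ℕ => Real.log p ≤ x), Real.log p / ((p : ℝ) - 1) ≤ x + C₁) :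
    ∃ C : ℝ, ∀ R D : ℕ, 1 ≤ Real.log R → 2 * k + 2 ≤ D → (∀ p ∈ primesCop W R, D < p) →
      ∀ K : ℝ, K ≤ c * κ * Real.log R →
      ∑ S ∈ (primesCop W R).powerset, (∏ p ∈ S, (k : ℝ) / (p - k)) *
          divisorMain (primesCop W R) (linWeight R β) c K S ≤
        Real.exp ((2 * k ^ 2 + 8 * k + 2) / D) * (Real.log R ^ (k + 2) *
          (c ^ (k + 2) * divisorConst k β κ + C / Real.log R)) := by
  set M := innerErr c A β κ C₁ with hM
  set N := M + (κ + (κ * β + 1 / 2) + (κ * β ^ 2 / 3 + 2 * β / 3) + β ^ 2 / 6) with hN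
  refine ⟨M + k * (1 + A) ^ k * N, fun R D hR hkD hPD K hK => ?_⟩
  set P := primesCop W R with hPd
  set ℓ := Real.log R with hℓd
  have hℓ : 0 < ℓ := by linarith
  have hD0 : 0 < D := by omega
  have hM0 : 0 ≤ M := by rw [hM, innerErr]; positivity
  have hN0 : 0 ≤ N := by positivity
  set f := innerCoeff ℓ c A β κ C₁ with hf
  have hf0 : ∀ j, 0 ≤ f j := by
    intro j
    match j with
    | 0 => exact mul_nonneg hℓ.le hM0
    | 1 => simp only [hf, innerCoeff]; positivity
    | 2 => simp only [hf, innerCoeff]; positivity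
    | 3 => simp only [hf, innerCoeff]; positivity
    | 4 => simp only [hf, innerCoeff]; positivity
    | (n + 5) => simp [hf, innerCoeff]
  have hdec := decUpTo_truncPoly R 5 hf0
  have hp : ∀ p ∈ P, (2 * k + 2 : ℝ) < p := fun p hp => by
    exact_mod_cast hkD.trans_lt (hPD p hp)
  have hu0 : ∀ p ∈ P, 0 ≤ (k : ℝ) / (p - k) := fun p hpP => by
    have := hp p hpP
    have hk0 : (0 : ℝ) ≤ k := Nat.cast_nonneg k
    exact div_nonneg hk0 (by linarith)
  have hsum_le : ∑ S ∈ P.powerset, (∏ p ∈ S, (k : ℝ) / (p - k)) *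
      divisorMain P (linWeight R β) c K S ≤ c * Real.exp (2 / D) * ∑ S ∈ P.powerset,
        (∏ p ∈ S, (k : ℝ) / (p - k) * (p / (p - 1)) ^ 2) * truncPoly R 5 f (∏ p ∈ S, p) := by
    rw [mul_sum]
    refine sum_le_sum fun S hS => ?_
    have h := divisorMain_le (by omega : 2 ≤ D) hPD hc hA0 hβ hκ hC₁0 hA hC₁ hR hK
      (mem_powerset.1 hS)
    refine (mul_le_mul_of_nonneg_left h
      (prod_nonneg fun p hp => hu0 p (mem_powerset.1 hS hp))).trans (le_of_eq ?_)
    rw [prod_mul_distrib, prod_pow]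
    ring
  have hprod_le := sum_prod_mul_le hD0 hPD k (by positivity : (0 : ℝ) ≤ 2 * k ^ 2 + 8 * k)
    (v := fun p => (k : ℝ) / (p - k) * (p / (p - 1)) ^ 2)
    (fun p hpP => ⟨mul_nonneg (hu0 p hpP) (sq_nonneg _),
      div_sub_mul_sq_le (hkD.trans_lt (hPD p hpP))⟩) hdec.toNonnegUpTo
    ((hdec.iterate_copSum (W := W) k).nonneg 1)
    fun m hm => (hdec.iterate_copSum k).anti 1 m one_pos hm
  have hiter_abs := (abs_le.1 (abs_iterate_copSum_truncPoly_one_sub_le hc hc1 hA0 hA hR k 5 f)).2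
  rw [← hℓd] at hiter_abs
  have hsum : ∑ j ∈ range 5, f j * ((j.factorial : ℝ) / (j + k).factorial) =
      ℓ * M / k.factorial + c * ℓ ^ 2 * divisorConst k β κ := by
    simp only [sum_range_succ, sum_range_zero, hf, innerCoeff, divisorConst, ← hM]
    norm_num [Nat.factorial]
    simp only [add_comm 1 k, add_comm 2 k, add_comm 3 k, add_comm 4 k]
    norm_num [Nat.factorial]
    field_simp
    ring
  have habs : ∑ j ∈ range 5, |f j| ≤ ℓ ^ 2 * N := by
    have e : ∑ j ∈ range 5, |f j| = ℓ * M + c * (ℓ ^ 2 * (κ + (κ * β + 1 / 2) +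
        (κ * β ^ 2 / 3 + 2 * β / 3) + β ^ 2 / 6)) := by
      rw [sum_congr rfl fun j _ => abs_of_nonneg (hf0 j)]
      simp only [sum_range_succ, sum_range_zero, hf, innerCoeff, ← hM]
      ring
    rw [e, hN, mul_add (ℓ ^ 2) M]
    refine add_le_add ?_ (mul_le_of_le_one_left (by positivity) hc1)
    gcongr
    nlinarith
  rw [hsum] at hiter_abs
  have hck : c ^ k ≤ 1 := pow_le_one₀ hc hc1
  have hfac : (1 : ℝ) ≤ k.factorial := by exact_mod_cast k.factorial_pos
  have e1 : (c * ℓ) ^ k * (ℓ * M / k.factorial) ≤ ℓ ^ k * (ℓ * M) := by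
    rw [mul_pow]
    calc _ ≤ 1 * ℓ ^ k * (ℓ * M) := by
          refine mul_le_mul ?_ (div_le_self (by positivity) hfac) (by positivity) (by positivity)
          gcongr
      _ = _ := by ring
  have e2 : k * (1 + A) ^ k * (∑ j ∈ range 5, |f j|) * (ℓ ^ k / ℓ) ≤
      k * (1 + A) ^ k * (ℓ ^ 2 * N) * (ℓ ^ k / ℓ) := by gcongr
  have hiter_le : (copSum W R)^[k] (truncPoly R 5 f) 1 ≤
      ℓ ^ (k + 2) * (c ^ (k + 1) * divisorConst k β κ + (M + k * (1 + A) ^ k * N) / ℓ) := by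
    have : ℓ ^ (k + 2) * (c ^ (k + 1) * divisorConst k β κ + (M + k * (1 + A) ^ k * N) / ℓ) =
        (c * ℓ) ^ k * (c * ℓ ^ 2 * divisorConst k β κ) + ℓ ^ k * (ℓ * M) +
          k * (1 + A) ^ k * (ℓ ^ 2 * N) * (ℓ ^ k / ℓ) := by
      rw [mul_pow]
      field_simp
      ring
    rw [this]
    linarith
  set Q := (M + k * (1 + A) ^ k * N) with hQ
  have hQ0 : 0 ≤ Q := by positivity
  calc _ ≤ c * Real.exp (2 / D) * (Real.exp ((2 * k ^ 2 + 8 * k) / D) *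
        (ℓ ^ (k + 2) * (c ^ (k + 1) * divisorConst k β κ + Q / ℓ))) := by
        refine hsum_le.trans (mul_le_mul_of_nonneg_left (hprod_le.trans ?_) (by positivity))
        gcongr
    _ = Real.exp ((2 * k ^ 2 + 8 * k + 2) / D) * (ℓ ^ (k + 2) *
          (c ^ (k + 2) * divisorConst k β κ + c * (Q / ℓ))) := by
        rw [add_div (2 * (k : ℝ) ^ 2 + 8 * k), Real.exp_add]
        ring
    _ ≤ _ := by
        have : c * (Q / ℓ) ≤ Q / ℓ := mul_le_of_le_one_left (by positivity) hc1
        gcongr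

end Main

lemma div_sub_one_le_two {p : ℕ} (hp : p.Prime) : (p : ℝ) / (p - 1) ≤ 2 := by
  have : (2 : ℝ) ≤ p := by exact_mod_cast hp.two_le
  rw [div_le_iff₀ (by linarith)]
  linarith

lemma div_sub_one_nonneg {p : ℕ} (hp : p.Prime) : 0 ≤ (p : ℝ) / (p - 1) := by
  have : (2 : ℝ) ≤ p := by exact_mod_cast hp.two_le
  exact div_nonneg (by linarith) (by linarith)

lemma prod_div_sub_one_nonneg {S : Finset ℕ} (hS : ∀ p ∈ S, p.Prime) :
    0 ≤ ∏ p ∈ S, (p : ℝ) / (p - 1) := prod_nonneg fun p hp => div_sub_one_nonneg (hS p hp)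

lemma prod_div_sub_one_le {S : Finset ℕ} (hS : ∀ p ∈ S, p.Prime) :
    ∏ p ∈ S, (p : ℝ) / (p - 1) ≤ 2 ^ S.card := by
  rw [← prod_const]
  exact prod_le_prod (fun p hp => div_sub_one_nonneg (hS p hp))
    fun p hp => div_sub_one_le_two (hS p hp)

lemma prod_inv_sub_one_nonneg {S : Finset ℕ} (hS : ∀ p ∈ S, p.Prime) :
    0 ≤ ∏ p ∈ S, ((p : ℝ) - 1)⁻¹ := prod_nonneg fun p hp => inv_nonneg.2 (by
  have : (2 : ℝ) ≤ p := by exact_mod_cast (hS p hp).two_le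
  linarith)

lemma prod_inv_sub_one_le_one {S : Finset ℕ} (hS : ∀ p ∈ S, p.Prime) :
    ∏ p ∈ S, ((p : ℝ) - 1)⁻¹ ≤ 1 := prod_le_one (fun p hp => inv_nonneg.2 (by
  have : (2 : ℝ) ≤ p := by exact_mod_cast (hS p hp).two_le
  linarith)) fun p hp => inv_le_one_of_one_le₀ (by
  have : (2 : ℝ) ≤ p := by exact_mod_cast (hS p hp).two_le
  linarith)

lemma sieveY_nonneg {W R : ℕ} {Z : ℕ → ℝ} (hZ : NonnegUpTo R Z) {S : Finset ℕ}
    (hS : S ⊆ primesCop W R) : 0 ≤ sieveY (primesCop W R) Z S :=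
  mul_nonneg (prod_div_sub_one_nonneg fun _ hp => (mem_primesCop.1 (hS hp)).2.1)
    (sum_nonneg fun _ hA => mul_nonneg (prod_inv_sub_one_nonneg fun _ hp =>
      (mem_primesCop.1 (sdiff_subset (mem_powerset.1 hA hp))).2.1) (hZ.nonneg _))

/-- The total mass of the sieve weights is at most `R ^ (1 + η)`. -/
lemma errSum_le {W R k : ℕ} {β η : ℝ} (hβ : 0 ≤ β) (hη : 0 ≤ η)
    (hP : ∀ p ∈ primesCop W R, (4 * k + 1 : ℝ) ≤ (p : ℝ) ^ η) :
    SieveSetup.errSum k (primesCop W R) (sieveY (primesCop W R) (linWeight R β)) ≤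
      (1 + β) * (R : ℝ) ^ (1 + η) := by
  rcases Nat.eq_zero_or_pos R with rfl | hR0
  · have : primesCop W 0 = ∅ := by
      ext p
      simp only [mem_primesCop, notMem_empty, iff_false]
      rintro ⟨h1, h2, _⟩
      exact h2.ne_zero (Nat.le_zero.1 h1)
    rw [this]
    have h0 : ((0 : ℕ) : ℝ) ^ (1 + η) = 0 := by
      rw [Nat.cast_zero, Real.zero_rpow (by linarith)]
    rw [h0, mul_zero]
    simp [SieveSetup.errSum, sieveY, linWeight, truncPow]
  set P := primesCop W R with hPd
  have hpr : ∀ p ∈ P, p.Prime := fun p hp => (mem_primesCop.1 hp).2.1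
  have hZ := decUpTo_linWeight R hβ
  have hG : NonnegUpTo R fun b => if b ≤ R then (1 : ℝ) else 0 :=
    ⟨fun b => by split_ifs <;> norm_num, fun b hb => if_neg hb.not_ge⟩
  have hind := sum_powerset_prod_le_sum_cop (W := W) hG
  have hcard : ∑ b ∈ cop W R, (if b ≤ R then (1 : ℝ) else 0) ≤ R := by
    calc _ ≤ ∑ b ∈ cop W R, (1 : ℝ) := sum_le_sum fun b _ => by split_ifs <;> norm_num
      _ = ((cop W R).card : ℝ) := by simp
      _ ≤ R := by
        have : (cop W R).card ≤ (Icc 1 R).card := card_filter_le _ _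
        rw [Nat.card_Icc] at this
        exact_mod_cast this
  calc SieveSetup.errSum k P (sieveY P (linWeight R β)) ≤
        ∑ S ∈ P.powerset, ∑ A ∈ (P \ S).powerset, (4 * k : ℝ) ^ S.card *
          ((1 + β) * if (∏ p ∈ S, p) * ∏ p ∈ A, p ≤ R then 1 else 0) := by
        unfold SieveSetup.errSum
        refine sum_le_sum fun S hS => ?_
        have hS' := mem_powerset.1 hS
        rw [abs_of_nonneg (sieveY_nonneg hZ.toNonnegUpTo hS'), sieveY, mul_sum, sum_mul]
        refine sum_le_sum fun A hA => ?_
        have hAp : ∀ p ∈ A, p.Prime := fun p hp => hpr p (sdiff_subset (mem_powerset.1 hA hp))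
        have hSp : ∀ p ∈ S, p.Prime := fun p hp => hpr p (hS' hp)
        have h1 := prod_div_sub_one_le hSp
        have h2 := prod_inv_sub_one_le_one hAp
        have h3 := prod_div_sub_one_nonneg hSp
        have h4 := prod_inv_sub_one_nonneg hAp
        have h5 := linWeight_le (R := R) hβ ((∏ p ∈ S, p) * ∏ p ∈ A, p)
        have h6 := hZ.nonneg ((∏ p ∈ S, p) * ∏ p ∈ A, p)
        simp only [truncPow, pow_zero] at h5
        calc _ ≤ 2 ^ S.card * (1 * ((1 + β) *
              if (∏ p ∈ S, p) * ∏ p ∈ A, p ≤ R then 1 else 0)) * (2 * k) ^ S.card := by gcongr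
          _ = _ := by
            rw [show (4 * k : ℝ) = 2 * (2 * k) by ring, mul_pow 2 (2 * (k : ℝ))]
            ring
    _ = ∑ U ∈ P.powerset, ∑ S ∈ U.powerset, (4 * k : ℝ) ^ S.card *
          ((1 + β) * if (∏ p ∈ S, p) * ∏ p ∈ U \ S, p ≤ R then 1 else 0) :=
        sum_powerset_sdiff P fun S A => (4 * k : ℝ) ^ S.card *
          ((1 + β) * if (∏ p ∈ S, p) * ∏ p ∈ A, p ≤ R then 1 else 0)
    _ = ∑ U ∈ P.powerset, (4 * k + 1 : ℝ) ^ U.card *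
          ((1 + β) * if ∏ p ∈ U, p ≤ R then 1 else 0) := by
        refine sum_congr rfl fun U _ => ?_
        have : (4 * k + 1 : ℝ) ^ U.card = ∑ S ∈ U.powerset, (4 * k : ℝ) ^ S.card := by
          rw [← sum_pow_mul_eq_add_pow]
          simp
        rw [this, sum_mul]
        refine sum_congr rfl fun S hS => ?_
        rw [mul_comm (∏ p ∈ S, p), prod_sdiff (mem_powerset.1 hS)]
    _ ≤ ∑ U ∈ P.powerset, (R : ℝ) ^ η * ((1 + β) * if ∏ p ∈ U, p ≤ R then 1 else 0) := by
        refine sum_le_sum fun U hU => ?_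
        split_ifs with h
        · refine mul_le_mul_of_nonneg_right ?_ (by positivity)
          calc (4 * k + 1 : ℝ) ^ U.card = ∏ p ∈ U, (4 * k + 1 : ℝ) := by rw [prod_const]
            _ ≤ ∏ p ∈ U, (p : ℝ) ^ η :=
                prod_le_prod (fun _ _ => by positivity) fun p hp => hP p (mem_powerset.1 hU hp)
            _ = (∏ p ∈ U, (p : ℝ)) ^ η :=
                Real.finsetProd_rpow _ _ (fun _ _ => Nat.cast_nonneg _) _
            _ ≤ (R : ℝ) ^ η := by
                rw [← Nat.cast_prod]
                exact Real.rpow_le_rpow (Nat.cast_nonneg _) (by exact_mod_cast h) hη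
        · simp
    _ = (R : ℝ) ^ η * (1 + β) * ∑ U ∈ P.powerset, if ∏ p ∈ U, p ≤ R then 1 else 0 := by
        rw [mul_sum]
        exact sum_congr rfl fun _ _ => by ring
    _ ≤ (R : ℝ) ^ η * (1 + β) * R :=
        mul_le_mul_of_nonneg_left (hind.trans hcard) (by positivity)
    _ = _ := by
        rw [Real.rpow_add (by exact_mod_cast hR0), Real.rpow_one]
        ring

lemma log_mul_truncPow_one_sub_le {R n p : ℕ} (hR : 1 < R) (hn : 0 < n) (hp : 0 < p) :
    Real.log R * (truncPow R 1 n - truncPow R 1 (n * p)) ≤ Real.log p := by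
  have hℓ : 0 < Real.log R := Real.log_pos (by exact_mod_cast hR)
  have hlp : 0 ≤ Real.log (p : ℝ) := Real.log_natCast_nonneg p
  have h := log_mul_relLog_mul hR hn hp
  rcases lt_or_ge R n with h1 | h1
  · rw [truncPow_of_lt h1, truncPow_of_lt (h1.trans_le (Nat.le_mul_of_pos_right n hp))]
    simpa using hlp
  rw [truncPow_of_le h1, pow_one]
  rcases lt_or_ge R (n * p) with h2 | h2
  · rw [truncPow_of_lt h2, sub_zero]
    have h3 : Real.log ((R : ℝ) / (n * p : ℕ)) ≤ 0 := by
      refine Real.log_nonpos (by positivity) (div_le_one_of_le₀ ?_ (Nat.cast_nonneg _))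
      exact_mod_cast h2.le
    rw [log_div_eq_mul_relLog hR] at h3
    linarith
  · rw [truncPow_of_le h2, pow_one, mul_sub, h]
    linarith

lemma truncPow_two_sub_le {R n p : ℕ} (hn : 0 < n) (hp : 0 < p) :
    truncPow R 2 n - truncPow R 2 (n * p) ≤ 2 * (truncPow R 1 n - truncPow R 1 (n * p)) := by
  have hsq : ∀ m, truncPow R 2 m = truncPow R 1 m ^ 2 := fun m => by
    unfold truncPow
    split_ifs <;> simp
  have hle : ∀ m, truncPow R 1 m ≤ 1 := fun m => (truncPow_le_zero 1 m).trans (by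
    unfold truncPow
    split_ifs <;> simp)
  have h := (decUpTo_truncPow R 1).anti n (n * p) hn (Nat.le_mul_of_pos_right n hp)
  rw [hsq, hsq]
  nlinarith [hle n, hle (n * p), truncPow_nonneg (R := R) 1 n]

section

variable {W R : ℕ} {c A β : ℝ}

lemma copSum_linWeight_sub_le (hc : 0 ≤ c) (hA0 : 0 ≤ A) (hβ : 0 ≤ β)
    (hA : ∀ x : ℝ, 0 ≤ x → |copHarm W (Real.exp x) - c * x| ≤ A) (hR : 1 < R) {n p : ℕ}
    (hn : 0 < n) (hp : 0 < p) :
    copSum W R (linWeight R β) n - copSum W R (linWeight R β) (n * p) ≤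
      (1 + β) * (c * Real.log p + 2 * A) := by
  have hnp := Nat.mul_pos hn hp
  have hle : ∀ j m, truncPow R j m ≤ 1 := fun j m => (truncPow_le_zero j m).trans (by
    unfold truncPow
    split_ifs <;> simp)
  have h1 := (abs_le.1 (abs_copSum_truncPow_sub_le hA hR 0 hn)).2
  have h2 := (abs_le.1 (abs_copSum_truncPow_sub_le hA hR 1 hn)).2
  have h3 := (abs_le.1 (abs_copSum_truncPow_sub_le hA hR 0 hnp)).1
  have h4 := (abs_le.1 (abs_copSum_truncPow_sub_le hA hR 1 hnp)).1
  norm_num at h1 h2 h3 h4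
  rw [copSum_linWeight, copSum_linWeight]
  have b1 := mul_le_mul_of_nonneg_left (hle 0 n) hA0
  have b2 := mul_le_mul_of_nonneg_left (hle 1 n) hA0
  have b3 := mul_le_mul_of_nonneg_left (hle 0 (n * p)) hA0
  have b4 := mul_le_mul_of_nonneg_left (hle 1 (n * p)) hA0
  have hℓ : 0 < Real.log R := Real.log_pos (by exact_mod_cast hR)
  have d1 := mul_le_mul_of_nonneg_left (log_mul_truncPow_one_sub_le hR hn hp) hc
  have d2 := mul_le_mul_of_nonneg_left (truncPow_two_sub_le (R := R) hn hp)
    (by positivity : 0 ≤ c * Real.log R / 2)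
  have e1 : copSum W R (truncPow R 0) n - copSum W R (truncPow R 0) (n * p) ≤
      c * Real.log p + 2 * A := by linarith
  have e2 : copSum W R (truncPow R 1) n - copSum W R (truncPow R 1) (n * p) ≤
      c * Real.log p + 2 * A := by linarith
  have e3 := mul_le_mul_of_nonneg_left e2 hβ
  linarith

lemma sieveY_sub_insert {P S : Finset ℕ} {p : ℕ} (Z : ℕ → ℝ) (hp : p ∈ P) (hp1 : 1 < p)
    (hpS : p ∉ S) :
    sieveY P Z S - sieveY P Z (insert p S) = (∏ q ∈ S, (q : ℝ) / (q - 1)) *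
      ∑ B ∈ (P \ insert p S).powerset, (∏ q ∈ B, ((q : ℝ) - 1)⁻¹) *
        (Z ((∏ q ∈ S, q) * ∏ q ∈ B, q) - Z ((∏ q ∈ S, q) * (∏ q ∈ B, q) * p)) := by
  have hins : P \ S = insert p (P \ insert p S) := by
    ext q
    simp only [mem_sdiff, mem_insert]
    by_cases h : q = p
    · subst h; simp [hp, hpS]
    · simp [h]
  have hpn : p ∉ P \ insert p S := by simp
  have hp1' : (p : ℝ) - 1 ≠ 0 := by
    have : (1 : ℝ) < p := by exact_mod_cast hp1
    linarith
  unfold sieveY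
  rw [prod_insert hpS, prod_insert hpS, hins, sum_powerset_insert hpn]
  have e : ∑ B ∈ (P \ insert p S).powerset, (∏ q ∈ insert p B, ((q : ℝ) - 1)⁻¹) *
      Z ((∏ q ∈ S, q) * ∏ q ∈ insert p B, q) = ((p : ℝ) - 1)⁻¹ *
      ∑ B ∈ (P \ insert p S).powerset, (∏ q ∈ B, ((q : ℝ) - 1)⁻¹) *
        Z ((∏ q ∈ S, q) * (∏ q ∈ B, q) * p) := by
    rw [mul_sum]
    refine sum_congr rfl fun B hB => ?_
    have hpB : p ∉ B := fun h => hpn (mem_powerset.1 hB h)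
    rw [prod_insert hpB, prod_insert hpB, mul_left_comm _ p, mul_comm p]
    ring
  have e' : ∑ B ∈ (P \ insert p S).powerset, (∏ q ∈ B, ((q : ℝ) - 1)⁻¹) *
      Z (p * (∏ q ∈ S, q) * ∏ q ∈ B, q) = ∑ B ∈ (P \ insert p S).powerset,
        (∏ q ∈ B, ((q : ℝ) - 1)⁻¹) * Z ((∏ q ∈ S, q) * (∏ q ∈ B, q) * p) :=
    sum_congr rfl fun B _ => by rw [mul_assoc p, mul_comm p]
  rw [e, e']
  simp only [mul_sub, sum_sub_distrib]
  field_simp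
  ring

lemma sieveY_sub_insert_le {D : ℕ} (hD : 2 ≤ D) (hPD : ∀ p ∈ primesCop W R, D < p)
    (hc : 0 ≤ c) (hA0 : 0 ≤ A) (hβ : 0 ≤ β)
    (hA : ∀ x : ℝ, 0 ≤ x → |copHarm W (Real.exp x) - c * x| ≤ A) (hR : 1 < R)
    {S : Finset ℕ} {p : ℕ} (hS : S ⊆ primesCop W R) (hp : p ∈ primesCop W R) (hpS : p ∉ S) :
    0 ≤ sieveY (primesCop W R) (linWeight R β) S -
        sieveY (primesCop W R) (linWeight R β) (insert p S) ∧
    sieveY (primesCop W R) (linWeight R β) S -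
        sieveY (primesCop W R) (linWeight R β) (insert p S) ≤
      (∏ q ∈ S, (q : ℝ) / (q - 1)) * truncPow R 0 (∏ q ∈ S, q) *
        (Real.exp (2 / D) * ((1 + β) * (c * Real.log p + 2 * A))) := by
  set P := primesCop W R with hPd
  have hpr : ∀ p ∈ P, p.Prime := fun p hp => (mem_primesCop.1 hp).2.1
  have hp0 : 0 < p := (hpr p hp).pos
  have hZ := decUpTo_linWeight R hβ
  set r := ∏ q ∈ S, q with hr
  have hr0 : 0 < r := prod_primes_pos fun q hq => hpr q (hS hq)
  have hw := prod_div_sub_one_nonneg fun q hq => hpr q (hS hq)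
  have hlp : 0 ≤ Real.log (p : ℝ) := Real.log_natCast_nonneg p
  rw [sieveY_sub_insert _ hp (hpr p hp).one_lt hpS]
  have hpos : ∀ B ∈ P.powerset, 0 < ∏ q ∈ B, q := fun B hB =>
    prod_primes_pos fun q hq => hpr q (mem_powerset.1 hB hq)
  have hF0 : ∀ n, 0 < n → 0 ≤ linWeight R β n - linWeight R β (n * p) := fun n hn =>
    sub_nonneg.2 (hZ.anti n (n * p) hn (Nat.le_mul_of_pos_right n hp0))
  have hsub : (P \ insert p S).powerset ⊆ P.powerset := powerset_mono.2 sdiff_subset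
  have hinv : ∀ B ∈ P.powerset, 0 ≤ ∏ q ∈ B, ((q : ℝ) - 1)⁻¹ := fun B hB =>
    prod_inv_sub_one_nonneg fun q hq => hpr q (mem_powerset.1 hB hq)
  refine ⟨mul_nonneg hw (sum_nonneg fun B hB => mul_nonneg (hinv B (hsub hB))
    (hF0 _ (Nat.mul_pos hr0 (hpos B (hsub hB))))), ?_⟩
  rcases lt_or_ge R r with hrR | hrR
  · rw [truncPow_of_lt hrR, mul_zero, zero_mul]
    refine le_of_eq (mul_eq_zero_of_right _ (sum_eq_zero fun B hB => ?_))
    have h1 : R < r * ∏ q ∈ B, q :=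
      hrR.trans_le (Nat.le_mul_of_pos_right r (hpos B (hsub hB)))
    rw [hZ.zero _ h1, hZ.zero _ (h1.trans_le (Nat.le_mul_of_pos_right _ hp0))]
    ring
  rw [truncPow_of_le hrR, pow_zero, mul_one]
  set F : ℕ → ℝ := fun h => if h = 0 then 0 else
    linWeight R β (r * h) - linWeight R β (r * h * p) with hF
  have hFN : NonnegUpTo R F := by
    refine ⟨fun h => ?_, fun h hh => ?_⟩
    · simp only [hF]
      split_ifs with h0
      · exact le_rfl
      · exact hF0 _ (Nat.mul_pos hr0 (Nat.pos_of_ne_zero h0))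
    · have h1 : R < r * h := hh.trans_le (Nat.le_mul_of_pos_left h hr0)
      simp only [hF]
      rw [if_neg (by omega), hZ.zero _ h1,
        hZ.zero _ (h1.trans_le (Nat.le_mul_of_pos_right _ hp0)), sub_zero]
  have hB : ∀ m, 0 < m → (copSum W R)^[1] F m ≤ (1 + β) * (c * Real.log p + 2 * A) := by
    intro m hm
    rw [Function.iterate_one]
    refine le_trans (le_of_eq ?_) (copSum_linWeight_sub_le hc hA0 hβ hA hR (Nat.mul_pos hr0 hm) hp0)
    simp only [copSum, ← sum_sub_distrib]
    refine sum_congr rfl fun a ha => ?_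
    have ha0 := (mem_cop.1 ha).1.1
    simp only [hF]
    rw [if_neg (Nat.mul_pos hm ha0).ne', sub_div, mul_assoc r m a, mul_right_comm (r * m) p a,
      mul_assoc r m a]
  have hp2 : ∀ p ∈ P, (3 : ℝ) ≤ p := fun p hp => by
    have := hPD p hp
    exact_mod_cast (by omega : 3 ≤ p)
  have hC := sum_prod_mul_le (by omega : 0 < D) hPD 1 (by norm_num : (0 : ℝ) ≤ 2)
    (v := fun p => ((p : ℝ) - 1)⁻¹) (fun p hp => by
      have h3 := hp2 p hp
      refine ⟨inv_nonneg.2 (by linarith), ?_⟩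
      rw [Nat.cast_one, inv_eq_one_div, div_add_div _ _ (by positivity) (by positivity),
        div_le_div_iff₀ (by linarith) (by positivity)]
      nlinarith [sq_nonneg ((p : ℝ))]) hFN (by positivity) hB
  refine mul_le_mul_of_nonneg_left (le_trans ?_ hC) hw
  refine le_trans (sum_le_sum_of_subset_of_nonneg hsub fun B hB _ => mul_nonneg (hinv B hB)
    (hF0 _ (Nat.mul_pos hr0 (hpos B hB)))) (le_of_eq (sum_congr rfl fun B hB => ?_))
  simp only [hF]
  rw [if_neg (hpos B hB).ne']

lemma sum_mul_sq_truncPow_le {D k : ℕ} (hkD : 2 * k + 2 ≤ D) (hPD : ∀ p ∈ primesCop W R, D < p)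
    (hc : 0 ≤ c) (hc1 : c ≤ 1) (hA0 : 0 ≤ A)
    (hA : ∀ x : ℝ, 0 ≤ x → |copHarm W (Real.exp x) - c * x| ≤ A) (hR : 1 ≤ Real.log R) :
    ∑ S ∈ (primesCop W R).powerset, (∏ p ∈ S, (k : ℝ) / (p - k)) *
        ((∏ q ∈ S, (q : ℝ) / (q - 1)) ^ 2 * truncPow R 0 (∏ q ∈ S, q)) ≤
      Real.exp ((2 * k ^ 2 + 8 * k) / D) * ((1 + k * (1 + A) ^ k) * Real.log R ^ k) := by
  have hdec := decUpTo_truncPow R 0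
  have hR1 := one_lt_of_one_le_log hR
  set ℓ := Real.log R with hℓd
  have hℓ : 0 < ℓ := by linarith
  have step2 := sum_prod_mul_le (by omega : 0 < D) hPD k
    (by positivity : (0 : ℝ) ≤ 2 * k ^ 2 + 8 * k)
    (v := fun p => (k : ℝ) / (p - k) * (p / (p - 1)) ^ 2)
    (fun p hpP => ⟨by
      have h : (2 * k + 2 : ℝ) < p := by exact_mod_cast hkD.trans_lt (hPD p hpP)
      have hk0 : (0 : ℝ) ≤ k := Nat.cast_nonneg k
      exact mul_nonneg (div_nonneg hk0 (by linarith)) (sq_nonneg _),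
      div_sub_mul_sq_le (hkD.trans_lt (hPD p hpP))⟩) hdec.toNonnegUpTo
    ((hdec.iterate_copSum (W := W) k).nonneg 1)
    fun m hm => (hdec.iterate_copSum k).anti 1 m one_pos hm
  have step3 := (abs_le.1 (abs_iterate_copSum_truncPow_sub_le hc hc1 hA0 hA hR k 0 1 one_pos)).2
  rw [truncPow_one hR1, truncPow_one hR1, ← hℓd] at step3
  have hfac : (1 : ℝ) ≤ k.factorial := by exact_mod_cast k.factorial_pos
  have e1 : (c * ℓ) ^ k * ((Nat.factorial 0 : ℝ) / (0 + k).factorial) ≤ ℓ ^ k := by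
    rw [mul_pow, zero_add, Nat.factorial_zero, Nat.cast_one]
    calc _ ≤ 1 * ℓ ^ k * 1 := by
          gcongr
          · exact pow_le_one₀ hc hc1
          · exact div_le_one_of_le₀ hfac (by positivity)
      _ = _ := by ring
  have e2 : k * (1 + A) ^ k * (ℓ ^ k / ℓ) ≤ k * (1 + A) ^ k * ℓ ^ k := by
    gcongr
    exact div_le_self (by positivity) hR
  refine le_trans (le_of_eq (sum_congr rfl fun S _ => ?_)) (step2.trans
    (mul_le_mul_of_nonneg_left ?_ (Real.exp_pos _).le))
  · rw [prod_mul_distrib, prod_pow]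
    ring
  · linarith

end

/-- Union bound for weighted sums. -/
lemma sum_filter_exists_le {ι κ : Type*} (s : Finset ι) (J : Finset κ) (q : κ → ι → Prop)
    [∀ j, DecidablePred (q j)] [DecidablePred fun n => ∃ j ∈ J, q j n] {f : ι → ℝ}
    (hf : ∀ n ∈ s, 0 ≤ f n) :
    ∑ n ∈ s.filter (fun n => ∃ j ∈ J, q j n), f n ≤ ∑ j ∈ J, ∑ n ∈ s.filter (q j), f n := by
  simp only [sum_filter]
  rw [sum_comm]
  refine sum_le_sum fun n hn => ?_
  have h0 : ∀ j ∈ J, 0 ≤ if q j n then f n else 0 := fun j _ => by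
    split_ifs
    exacts [hf n hn, le_rfl]
  split_ifs with h
  · obtain ⟨j, hj, hq⟩ := h
    simpa [hq] using single_le_sum h0 hj
  · exact sum_nonneg h0

namespace SieveSetup

variable {k : ℕ} (s : SieveSetup k) {c A β : ℝ}

lemma exists_sum_filter_prime_dvd_sq_le (hc : 0 ≤ c) (hc1 : c ≤ 1) (hA0 : 0 ≤ A) (hβ : 0 ≤ β)
    (hA : ∀ x : ℝ, 0 ≤ x → |copHarm s.W (Real.exp x) - c * x| ≤ A) :
    ∃ M : ℝ, 0 ≤ M ∧ ∀ R X p : ℕ, ∀ i, 1 ≤ Real.log R → p ∈ primesCop s.W R →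
      ∑ n ∈ (progression X s.W s.n₀).filter (fun n => p ∣ s.L i n),
          s.Λ (primesCop s.W R) (sieveY (primesCop s.W R) (linWeight R β)) n ^ 2 ≤
        (X : ℝ) / s.W * (M * Real.log R ^ k) * (Real.log p ^ 2 / p) +
          errSum k (primesCop s.W R) (sieveY (primesCop s.W R) (linWeight R β)) ^ 2 := by
  set N : ℝ := Real.exp (2 / s.D) * ((1 + β) * (1 + 2 * A)) with hN
  set N' : ℝ := Real.exp ((2 * k ^ 2 + 8 * k) / s.D) * (1 + k * (1 + A) ^ k) with hN'
  refine ⟨N ^ 2 * N', by positivity, fun R X p i hR hp => ?_⟩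
  set P := primesCop s.W R with hP
  set Y := sieveY P (linWeight R β) with hY
  have hpr := (mem_primesCop.1 hp).2.1
  have hD2 : 2 ≤ s.D := le_trans (by omega) s.lt_D
  have hmain := (abs_le.1 (s.abs_sum_sq_sub_le (R := R) Y (mem_primesCop.1 hp).2.2 hpr.pos X i)).2
  have hPp : P.filter (fun q : ℕ => q ∣ p) = {p} := by
    ext q
    simp only [mem_filter, mem_singleton]
    constructor
    · rintro ⟨hq, hqp⟩
      exact (Nat.prime_dvd_prime_iff_eq (mem_primesCop.1 hq).2.1 hpr).1 hqp
    · rintro rfl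
      exact ⟨hp, dvd_rfl⟩
  rw [← hP, hPp] at hmain
  have hlog : 1 ≤ Real.log p := by
    rw [Real.le_log_iff_exp_le (by exact_mod_cast hpr.pos)]
    have h1 := s.lt_of_mem_primesCop hp
    have h2 : (3 : ℝ) ≤ p := by exact_mod_cast (by omega : 3 ≤ p)
    linarith [Real.exp_one_lt_d9]
  have hPD : ∀ q ∈ P, s.D < q := fun q hq => s.lt_of_mem_primesCop hq
  have hterm : ∀ S ∈ (P \ {p}).powerset,
      (∏ q ∈ S, (k : ℝ) / (q - k)) * (∑ F ∈ ({p} : Finset ℕ).powerset,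
        (-1 : ℝ) ^ F.card * Y (S ∪ F)) ^ 2 ≤
      (N * Real.log p) ^ 2 * ((∏ q ∈ S, (k : ℝ) / (q - k)) *
        ((∏ q ∈ S, (q : ℝ) / (q - 1)) ^ 2 * truncPow R 0 (∏ q ∈ S, q))) := by
    intro S hS
    have hSP : S ⊆ P := (mem_powerset.1 hS).trans sdiff_subset
    have hpS : p ∉ S := fun h => by simpa using mem_powerset.1 hS h
    obtain ⟨h0, h1⟩ := sieveY_sub_insert_le hD2 hPD hc hA0 hβ hA (one_lt_of_one_le_log hR)
      hSP hp hpS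
    have e : ∑ F ∈ ({p} : Finset ℕ).powerset, (-1 : ℝ) ^ F.card * Y (S ∪ F) =
        Y S - Y (insert p S) := by
      rw [← insert_empty_eq p, sum_powerset_insert (notMem_empty p)]
      simp [union_comm S, sub_eq_add_neg]
    rw [e, mul_left_comm]
    refine mul_le_mul_of_nonneg_left ?_ (s.prod_u_nonneg (mem_powerset.2 hSP))
    have hw := prod_div_sub_one_nonneg fun q hq => (mem_primesCop.1 (hSP hq)).2.1
    have ht : truncPow R 0 (∏ q ∈ S, q) ^ 2 = truncPow R 0 (∏ q ∈ S, q) := by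
      unfold truncPow
      split_ifs <;> simp
    calc (Y S - Y (insert p S)) ^ 2
        ≤ ((∏ q ∈ S, (q : ℝ) / (q - 1)) * truncPow R 0 (∏ q ∈ S, q) * (N * Real.log p)) ^ 2 := by
          refine pow_le_pow_left₀ h0 (h1.trans ?_) 2
          refine mul_le_mul_of_nonneg_left ?_ (mul_nonneg hw (truncPow_nonneg 0 _))
          rw [hN, mul_assoc, mul_assoc]
          gcongr
          nlinarith
      _ = _ := by
          rw [mul_pow, mul_pow _ (truncPow _ _ _), ht]
          ring
  have hsum : ∑ S ∈ (P \ {p}).powerset,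
      (∏ q ∈ S, (k : ℝ) / (q - k)) * (∑ F ∈ ({p} : Finset ℕ).powerset,
        (-1 : ℝ) ^ F.card * Y (S ∪ F)) ^ 2 ≤
      (N * Real.log p) ^ 2 * (N' * Real.log R ^ k) := by
    refine (sum_le_sum hterm).trans ?_
    rw [← mul_sum]
    refine mul_le_mul_of_nonneg_left ?_ (sq_nonneg _)
    have h := sum_mul_sq_truncPow_le s.lt_D hPD hc hc1 hA0 hA hR
    rw [← mul_assoc] at h
    refine le_trans ?_ h
    refine sum_le_sum_of_subset_of_nonneg (powerset_mono.2 sdiff_subset) fun S hS _ => ?_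
    exact mul_nonneg (s.prod_u_nonneg hS) (mul_nonneg (sq_nonneg _) (truncPow_nonneg 0 _))
  have h2 := mul_le_mul_of_nonneg_left hsum
    (by positivity : (0 : ℝ) ≤ X / (s.W * p))
  have e2 : (X : ℝ) / (s.W * p) * ((N * Real.log p) ^ 2 * (N' * Real.log R ^ k)) =
      (X : ℝ) / s.W * (N ^ 2 * N' * Real.log R ^ k) * (Real.log p ^ 2 / p) := by
    rw [← div_div]; ring
  linarith

lemma exists_sum_filter_smooth_sq_le (hc : 0 ≤ c) (hc1 : c ≤ 1) (hA0 : 0 ≤ A) (hβ : 0 ≤ β)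
    (hA : ∀ x : ℝ, 0 ≤ x → |copHarm s.W (Real.exp x) - c * x| ≤ A) :
    ∃ M : ℝ, 0 ≤ M ∧ ∀ R X z : ℕ, 1 ≤ Real.log R → 0 < z →
      ∑ n ∈ (progression X s.W s.n₀).filter
          (fun n => ∃ p ∈ (primesCop s.W R).filter (· ≤ z), ∃ i, p ∣ s.L i n),
          s.Λ (primesCop s.W R) (sieveY (primesCop s.W R) (linWeight R β)) n ^ 2 ≤
        (X : ℝ) / s.W * (M * Real.log R ^ k) * (Real.log z * (Real.log z + M)) +
          k * z * errSum k (primesCop s.W R) (sieveY (primesCop s.W R) (linWeight R β)) ^ 2 := by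
  obtain ⟨M, hM0, hM⟩ := s.exists_sum_filter_prime_dvd_sq_le hc hc1 hA0 hβ hA
  obtain ⟨C₁, hC₁0, hC₁⟩ := exists_sum_log_div_sub_one_le
  refine ⟨k * M + C₁, by positivity, fun R X z hR hz => ?_⟩
  set P := primesCop s.W R with hP
  set err := errSum k P (sieveY P (linWeight R β)) with herr
  have hlz : 0 ≤ Real.log (z : ℝ) := Real.log_natCast_nonneg z
  have hℓ : 0 ≤ Real.log (R : ℝ) := Real.log_natCast_nonneg R
  have hpr : ∀ p ∈ P.filter (· ≤ z), p.Prime := fun p hp =>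
    (mem_primesCop.1 (mem_filter.1 hp).1).2.1
  have hlogsum : ∑ p ∈ P.filter (· ≤ z), Real.log p ^ 2 / (p : ℝ) ≤
      Real.log z * (Real.log z + C₁) := by
    have h := hC₁ (P.filter (· ≤ z)) hpr (Real.log z) hlz
    rw [filter_true_of_mem] at h
    · refine le_trans ?_ (mul_le_mul_of_nonneg_left h hlz)
      rw [mul_sum]
      refine sum_le_sum fun p hp => ?_
      have hp1 : (1 : ℝ) < p := by exact_mod_cast (hpr p hp).one_lt
      have hpz : Real.log p ≤ Real.log z :=
        Real.log_le_log (by linarith) (by exact_mod_cast (mem_filter.1 hp).2)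
      have hlp : 0 ≤ Real.log (p : ℝ) := Real.log_natCast_nonneg p
      rw [pow_two, ← mul_div_assoc]
      gcongr
      · nlinarith
    · intro p hp
      exact Real.log_le_log (by exact_mod_cast (hpr p hp).pos)
        (by exact_mod_cast (mem_filter.1 hp).2)
  have hcard : ((P.filter (· ≤ z)).card : ℝ) ≤ z := by
    have : P.filter (· ≤ z) ⊆ Icc 1 z := fun p hp => mem_Icc.2
      ⟨(hpr p hp).pos, (mem_filter.1 hp).2⟩
    have := card_le_card this
    rw [Nat.card_Icc, Nat.add_sub_cancel] at this
    exact_mod_cast this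
  calc _ ≤ ∑ p ∈ P.filter (· ≤ z), ∑ n ∈ (progression X s.W s.n₀).filter
          (fun n => ∃ i, p ∣ s.L i n), s.Λ P (sieveY P (linWeight R β)) n ^ 2 :=
        sum_filter_exists_le _ _ (fun p n => ∃ i, p ∣ s.L i n) fun _ _ => sq_nonneg _
    _ ≤ ∑ p ∈ P.filter (· ≤ z), ∑ i : Fin k, ∑ n ∈ (progression X s.W s.n₀).filter
          (fun n => p ∣ s.L i n), s.Λ P (sieveY P (linWeight R β)) n ^ 2 := by
        refine sum_le_sum fun p _ => ?_
        have h := sum_filter_exists_le (progression X s.W s.n₀) univ (fun i n => p ∣ s.L i n)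
          (f := fun n => s.Λ P (sieveY P (linWeight R β)) n ^ 2) fun _ _ => sq_nonneg _
        simpa using h
    _ ≤ ∑ p ∈ P.filter (· ≤ z), ∑ i : Fin k, ((X : ℝ) / s.W * (M * Real.log R ^ k) *
          (Real.log p ^ 2 / p) + err ^ 2) :=
        sum_le_sum fun p hp => sum_le_sum fun i _ => hM R X p i hR (mem_filter.1 hp).1
    _ = (X : ℝ) / s.W * (k * M * Real.log R ^ k) *
          (∑ p ∈ P.filter (· ≤ z), Real.log p ^ 2 / (p : ℝ)) +
          k * (P.filter (· ≤ z)).card * err ^ 2 := by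
        simp only [sum_const, card_univ, Fintype.card_fin, nsmul_eq_mul, mul_add, sum_add_distrib,
          mul_sum]
        congr 1
        · exact sum_congr rfl fun p _ => by ring
        · ring
    _ ≤ _ := by
        have hkM : (0 : ℝ) ≤ k * M := by positivity
        gcongr
        · linarith
        · refine hlogsum.trans ?_
          gcongr
          linarith

end SieveSetup

lemma truncPow_le_one {R : ℕ} (j m : ℕ) : truncPow R j m ≤ 1 := (truncPow_le_zero j m).trans (by
  unfold truncPow
  split_ifs <;> simp)

section

variable {W R : ℕ} {c A β : ℝ}

lemma copSum_linWeight_le (hc : 0 ≤ c) (hc1 : c ≤ 1) (hA0 : 0 ≤ A) (hβ : 0 ≤ β)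
    (hA : ∀ x : ℝ, 0 ≤ x → |copHarm W (Real.exp x) - c * x| ≤ A) (hR : 1 ≤ Real.log R) {m : ℕ}
    (hm : 0 < m) :
    copSum W R (linWeight R β) m ≤ (1 + β) * ((1 + A) * Real.log R) := by
  have hR1 := one_lt_of_one_le_log hR
  have h : ∀ j : ℕ, copSum W R (truncPow R j) m ≤ (1 + A) * Real.log R := fun j => by
    have h1 := (abs_le.1 (abs_copSum_truncPow_sub_le hA hR1 j hm)).2
    have h2 : A * truncPow R j m ≤ A * 1 := mul_le_mul_of_nonneg_left (truncPow_le_one j m) hA0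
    have h3 : c * Real.log R / (j + 1) * truncPow R (j + 1) m ≤ 1 * Real.log R * 1 := by
      have hj : (1 : ℝ) ≤ j + 1 := by linarith [(Nat.cast_nonneg j : (0 : ℝ) ≤ j)]
      refine mul_le_mul ?_ (truncPow_le_one _ m) (truncPow_nonneg _ _) (by linarith)
      exact (div_le_self (by positivity) hj).trans (by gcongr)
    nlinarith
  rw [copSum_linWeight]
  have := mul_le_mul_of_nonneg_left (h 1) hβ
  linarith [h 0]

lemma sieveY_le {D : ℕ} (hD : 2 ≤ D) (hPD : ∀ p ∈ primesCop W R, D < p) (hc : 0 ≤ c)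
    (hc1 : c ≤ 1) (hA0 : 0 ≤ A) (hβ : 0 ≤ β)
    (hA : ∀ x : ℝ, 0 ≤ x → |copHarm W (Real.exp x) - c * x| ≤ A) (hR : 1 ≤ Real.log R)
    {S : Finset ℕ} (hS : S ⊆ primesCop W R) :
    sieveY (primesCop W R) (linWeight R β) S ≤
      (∏ q ∈ S, (q : ℝ) / (q - 1)) * truncPow R 0 (∏ q ∈ S, q) *
        (Real.exp (2 / D) * ((1 + β) * ((1 + A) * Real.log R))) := by
  set P := primesCop W R with hP
  have hpr : ∀ p ∈ P, p.Prime := fun p hp => (mem_primesCop.1 hp).2.1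
  have hZ := decUpTo_linWeight R hβ
  set r := ∏ q ∈ S, q with hr
  have hr0 : 0 < r := prod_primes_pos fun q hq => hpr q (hS hq)
  have hpos : ∀ B ∈ P.powerset, 0 < ∏ q ∈ B, q := fun B hB =>
    prod_primes_pos fun q hq => hpr q (mem_powerset.1 hB hq)
  have hinv : ∀ B ∈ P.powerset, 0 ≤ ∏ q ∈ B, ((q : ℝ) - 1)⁻¹ := fun B hB =>
    prod_inv_sub_one_nonneg fun q hq => hpr q (mem_powerset.1 hB hq)
  have hsub : (P \ S).powerset ⊆ P.powerset := powerset_mono.2 sdiff_subset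
  unfold sieveY
  rw [mul_assoc]
  refine mul_le_mul_of_nonneg_left ?_ (prod_div_sub_one_nonneg fun q hq => hpr q (hS hq))
  rcases lt_or_ge R r with hrR | hrR
  · rw [truncPow_of_lt hrR, zero_mul]
    refine le_of_eq (sum_eq_zero fun B hB => ?_)
    rw [hZ.zero _ (hrR.trans_le (Nat.le_mul_of_pos_right r (hpos B (hsub hB)))), mul_zero]
  rw [truncPow_of_le hrR, pow_zero, one_mul]
  have hC := sum_prod_mul_le (by omega : 0 < D) hPD 1 (by norm_num : (0 : ℝ) ≤ 2)
    (v := fun p => ((p : ℝ) - 1)⁻¹) (fun p hp => by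
      have h3 : (3 : ℝ) ≤ p := by
        have := hPD p hp
        exact_mod_cast (by omega : 3 ≤ p)
      refine ⟨inv_nonneg.2 (by linarith), ?_⟩
      rw [Nat.cast_one, inv_eq_one_div, div_add_div _ _ (by positivity) (by positivity),
        div_le_div_iff₀ (by linarith) (by positivity)]
      nlinarith [sq_nonneg ((p : ℝ))]) hZ.toNonnegUpTo
      (by positivity : 0 ≤ (1 + β) * ((1 + A) * Real.log R))
      fun m hm => copSum_linWeight_le hc hc1 hA0 hβ hA hR hm
  refine le_trans (sum_le_sum fun B hB => mul_le_mul_of_nonneg_left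
    (hZ.anti _ _ (hpos B (hsub hB)) (Nat.le_mul_of_pos_left _ hr0)) (hinv B (hsub hB))) ?_
  exact (sum_le_sum_of_subset_of_nonneg hsub fun B hB _ => mul_nonneg (hinv B hB)
    (hZ.nonneg _)).trans hC

end

namespace SieveSetup

variable {k : ℕ} (s : SieveSetup k) {c A β : ℝ}

lemma exists_abs_Λ_le (hc : 0 ≤ c) (hc1 : c ≤ 1) (hA0 : 0 ≤ A) (hβ : 0 ≤ β)
    (hA : ∀ x : ℝ, 0 ≤ x → |copHarm s.W (Real.exp x) - c * x| ≤ A) :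
    ∃ M : ℝ, 0 ≤ M ∧ ∀ R n : ℕ, 1 ≤ Real.log R →
      |s.Λ (primesCop s.W R) (sieveY (primesCop s.W R) (linWeight R β)) n| ≤
        M * 4 ^ ((primesCop s.W R).filter fun p => ∃ i, p ∣ s.L i n).card *
          Real.log R ^ (k + 1) := by
  set N : ℝ := Real.exp (2 / s.D) * ((1 + β) * (1 + A)) with hN
  set N' : ℝ := Real.exp ((2 * k ^ 2 + 8 * k) / s.D) * (1 + k * (1 + A) ^ k) with hN'
  refine ⟨N * N', by positivity, fun R n hR => ?_⟩
  set P := primesCop s.W R with hP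
  set Y := sieveY P (linWeight R β) with hY
  set T := P.filter fun p => ∃ i, p ∣ s.L i n with hT
  have hTP : T ⊆ P := filter_subset _ _
  have hD2 : 2 ≤ s.D := le_trans (by omega) s.lt_D
  have hPD : ∀ q ∈ P, s.D < q := fun q hq => s.lt_of_mem_primesCop hq
  have hpr : ∀ p ∈ P, p.Prime := fun p hp => (mem_primesCop.1 hp).2.1
  have hdec := decUpTo_truncPow R 0
  set g : Finset ℕ → ℝ := fun S => (∏ q ∈ S, (k : ℝ) / (q - k)) *
    ((∏ q ∈ S, (q : ℝ) / (q - 1)) ^ 2 * truncPow R 0 (∏ q ∈ S, q)) with hg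
  have hterm : ∀ S ∈ (P \ T).powerset, ∀ F ∈ T.powerset,
      |Y (S ∪ F) * ∏ p ∈ S ∪ F, s.ψ p n| ≤ g S * 2 ^ T.card * (N * Real.log R) := by
    intro S hS F hF
    have hSP : S ⊆ P := (mem_powerset.1 hS).trans sdiff_subset
    have hFP : F ⊆ P := (mem_powerset.1 hF).trans hTP
    have hdisj : Disjoint S F :=
      disjoint_of_subset_left (mem_powerset.1 hS)
        (disjoint_of_subset_right (mem_powerset.1 hF) sdiff_disjoint)
    have hψS : ∏ p ∈ S, |s.ψ p n| = ∏ q ∈ S, (k : ℝ) / (q - k) := prod_congr rfl fun p hp => by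
      have h1 := mem_sdiff.1 (mem_powerset.1 hS hp)
      have h2 : ¬ ∃ i, p ∣ s.L i n := fun h => h1.2 (mem_filter.2 ⟨h1.1, h⟩)
      rw [ψ, if_neg h2, abs_of_nonneg (s.u_nonneg h1.1)]
    have hψF : ∏ p ∈ F, |s.ψ p n| = 1 := prod_eq_one fun p hp => by
      rw [ψ, if_pos (mem_filter.1 (mem_powerset.1 hF hp)).2]
      norm_num
    rw [abs_mul, abs_prod, prod_union hdisj, hψS, hψF, mul_one,
      abs_of_nonneg (sieveY_nonneg (decUpTo_linWeight R hβ).toNonnegUpTo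
        (union_subset hSP hFP))]
    have h1 := sieveY_le hD2 hPD hc hc1 hA0 hβ hA hR (union_subset hSP hFP)
    have hwS := prod_div_sub_one_nonneg fun q hq => hpr q (hSP hq)
    have hwS1 : 1 ≤ ∏ q ∈ S, (q : ℝ) / (q - 1) :=
      prod_const_one.symm.le.trans (prod_le_prod (fun _ _ => zero_le_one) fun q hq => by
        have h2 : (1 : ℝ) < q := by exact_mod_cast (hpr q (hSP hq)).one_lt
        rw [one_le_div (by linarith)]
        linarith)
    have hwF := prod_div_sub_one_nonneg fun q hq => hpr q (hFP hq)
    have hwF2 : ∏ q ∈ F, (q : ℝ) / (q - 1) ≤ 2 ^ T.card :=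
      (prod_div_sub_one_le fun q hq => hpr q (hFP hq)).trans
        (pow_le_pow_right₀ (by norm_num) (card_le_card (mem_powerset.1 hF)))
    rw [prod_union hdisj, prod_union hdisj] at h1
    have ht : truncPow R 0 ((∏ q ∈ S, q) * ∏ q ∈ F, q) ≤ truncPow R 0 (∏ q ∈ S, q) :=
      hdec.anti _ _ (prod_primes_pos fun q hq => hpr q (hSP hq))
        (Nat.le_mul_of_pos_right _ (prod_primes_pos fun q hq => hpr q (hFP hq)))
    have h2 : Y (S ∪ F) ≤ (∏ q ∈ S, (q : ℝ) / (q - 1)) ^ 2 * 2 ^ T.card *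
        truncPow R 0 (∏ q ∈ S, q) * (N * Real.log R) := by
      refine h1.trans ?_
      have e : Real.exp (2 / s.D) * ((1 + β) * ((1 + A) * Real.log R)) = N * Real.log R := by
        rw [hN]; ring
      rw [e]
      have h0 := truncPow_nonneg (R := R) 0 ((∏ q ∈ S, q) * ∏ q ∈ F, q)
      gcongr
      nlinarith
    refine (mul_le_mul_of_nonneg_right h2 (s.prod_u_nonneg (mem_powerset.2 hSP))).trans
      (le_of_eq ?_)
    simp only [hg]
    ring
  have hg0 : ∀ S ∈ P.powerset, 0 ≤ g S := fun S hS =>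
    mul_nonneg (s.prod_u_nonneg hS) (mul_nonneg (sq_nonneg _) (truncPow_nonneg 0 _))
  have hgsum : ∑ S ∈ (P \ T).powerset, g S ≤ N' * Real.log R ^ k := by
    have h := sum_mul_sq_truncPow_le s.lt_D hPD hc hc1 hA0 hA hR
    rw [← mul_assoc] at h
    exact (sum_le_sum_of_subset_of_nonneg (powerset_mono.2 sdiff_subset)
      fun S hS _ => hg0 S hS).trans h
  have h4 : (4 : ℝ) ^ T.card = 2 ^ T.card * 2 ^ T.card := by rw [← mul_pow]; norm_num
  unfold Λ
  rw [sum_powerset_eq_sum_sum hTP]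
  calc _ ≤ ∑ S ∈ (P \ T).powerset, ∑ F ∈ T.powerset, g S * 2 ^ T.card * (N * Real.log R) :=
        (abs_sum_le_sum_abs _ _).trans (sum_le_sum fun S hS =>
          (abs_sum_le_sum_abs _ _).trans (sum_le_sum fun F hF => hterm S hS F hF))
    _ = (∑ S ∈ (P \ T).powerset, g S) * (4 ^ T.card * (N * Real.log R)) := by
        rw [sum_mul]
        refine sum_congr rfl fun S _ => ?_
        rw [sum_const, card_powerset, nsmul_eq_mul, h4]
        push_cast
        ring
    _ ≤ N' * Real.log R ^ k * (4 ^ T.card * (N * Real.log R)) := by gcongr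
    _ = _ := by ring

lemma card_filter_exists_dvd_le {R X z m n : ℕ} (hn : n ≤ X) (hz : 0 < z)
    (hX : ∀ i, s.L i X ≤ (z + 1) ^ m)
    (hrough : ¬ ∃ p ∈ (primesCop s.W R).filter (· ≤ z), ∃ i, p ∣ s.L i n) :
    ((primesCop s.W R).filter fun p => ∃ i, p ∣ s.L i n).card ≤ m * k := by
  set T := (primesCop s.W R).filter fun p => ∃ i, p ∣ s.L i n with hT
  have hlt : ∀ p ∈ T, z + 1 ≤ p := fun p hp => by
    by_contra! h
    exact hrough ⟨p, mem_filter.2 ⟨(mem_filter.1 hp).1, by omega⟩, (mem_filter.1 hp).2⟩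
  have hdvd : ∏ p ∈ T, p ∣ ∏ i, s.L i n := by
    refine prod_primes_dvd _ (fun p hp => (mem_primesCop.1 (mem_filter.1 hp).1).2.1.prime)
      fun p hp => ?_
    obtain ⟨i, hi⟩ := (mem_filter.1 hp).2
    exact hi.trans (dvd_prod_of_mem _ (mem_univ i))
  have h1 : (z + 1) ^ T.card ≤ ((z + 1) ^ m) ^ k := calc
    (z + 1) ^ T.card = ∏ p ∈ T, (z + 1) := by rw [prod_const]
    _ ≤ ∏ p ∈ T, p := prod_le_prod' hlt
    _ ≤ ∏ i, s.L i n := Nat.le_of_dvd (prod_pos fun i _ => s.L_pos i n) hdvd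
    _ ≤ ∏ _i : Fin k, (z + 1) ^ m := prod_le_prod' fun i _ => le_trans (by
        unfold L; gcongr) (hX i)
    _ = _ := by simp
  rw [← pow_mul] at h1
  exact (Nat.pow_le_pow_iff_right (by omega)).1 h1

end SieveSetup

lemma card_divisors_of_squarefree {m : ℕ} (hm : Squarefree m) :
    m.divisors.card = 2 ^ m.primeFactorsList.length := by
  rw [Nat.card_divisors hm.ne_zero]
  have h : ∀ p ∈ m.primeFactors, m.factorization p + 1 = 2 := fun p hp => by
    have h1 := (Nat.squarefree_iff_factorization_le_one hm.ne_zero).1 hm p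
    have h2 := (Nat.prime_of_mem_primeFactors hp).factorization_pos_of_dvd hm.ne_zero
      (Nat.dvd_of_mem_primeFactors hp)
    omega
  rw [prod_congr rfl h, prod_const, Nat.primeFactors,
    List.toFinset_card_of_nodup ((Nat.squarefree_iff_nodup_primeFactorsList hm.ne_zero).1 hm)]

/-- If the divisor functions of `k` squarefree numbers have a small sum, then each of these numbers
has few prime factors. -/
lemma length_primeFactorsList_le_of_sum_card_divisors_lt {k G : ℕ} {m : Fin k → ℕ}
    (hm : ∀ i, Squarefree (m i)) (hm1 : ∀ i, 1 < m i)
    (h : ∑ i, (m i).divisors.card + 2 < 2 ^ (G + 1) + 2 * k) (i : Fin k) :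
    (m i).primeFactorsList.length ≤ G := by
  have h2 : ∀ j, 2 ≤ (m j).divisors.card := fun j => by
    have hsub : ({1, m j} : Finset ℕ) ⊆ (m j).divisors := fun d hd => by
      have := hm1 j
      rcases mem_insert.1 hd with rfl | hd
      · exact Nat.mem_divisors.2 ⟨one_dvd _, by omega⟩
      · rw [mem_singleton.1 hd]
        exact Nat.mem_divisors.2 ⟨dvd_rfl, by omega⟩
    simpa [card_pair (hm1 j).ne] using card_le_card hsub
  have h3 : (m i).divisors.card + (k - 1) * 2 ≤ ∑ j, (m j).divisors.card := by
    rw [← add_sum_erase _ _ (mem_univ i)]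
    refine Nat.add_le_add_left ?_ _
    have := card_nsmul_le_sum (univ.erase i) (fun j => (m j).divisors.card) 2 fun j _ => h2 j
    simpa using this
  have hk : 0 < k := Fin.pos i
  rw [card_divisors_of_squarefree (hm i)] at h3
  have h4 : 2 ^ (m i).primeFactorsList.length < 2 ^ (G + 1) := by omega
  have := (Nat.pow_lt_pow_iff_right (by norm_num)).1 h4
  omega

namespace SieveSetup

variable {k : ℕ} (s : SieveSetup k)

lemma L_mono (i : Fin k) {n X : ℕ} (h : n ≤ X) : s.L i n ≤ s.L i X := by
  unfold L; gcongr

lemma card_le_of_exists_sq_dvd {X z E : ℕ} (hz : 0 < z) (hE : ∀ i, s.L i X ≤ E ^ 2) {N : Finset ℕ}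
    (hN : N ⊆ Icc 1 X)
    (hsq : ∀ n ∈ N, ∃ p, p.Prime ∧ s.D < p ∧ z < p ∧ ∃ i, p ^ 2 ∣ s.L i n) :
    (N.card : ℝ) ≤ k * ((X : ℝ) / z + E) := by
  set J := (univ : Finset (Fin k)) ×ˢ (Ioc z E).filter fun p => p.Prime ∧ s.D < p with hJ
  have hsub : N ⊆ J.biUnion fun j => (Icc 1 X).filter fun n => j.2 ^ 2 ∣ s.L j.1 n := by
    intro n hn
    obtain ⟨p, hp, hD, hzp, i, hi⟩ := hsq n hn
    replace hn := hN hn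
    refine mem_biUnion.2 ⟨(i, p), ?_, mem_filter.2 ⟨hn, hi⟩⟩
    simp only [hJ, mem_product, mem_univ, true_and, mem_filter, mem_Ioc]
    refine ⟨⟨hzp, ?_⟩, hp, hD⟩
    have h1 := (Nat.le_of_dvd (s.L_pos i n) hi).trans
      ((s.L_mono i (mem_Icc.1 hn).2).trans (hE i))
    exact (Nat.pow_le_pow_iff_left (by norm_num)).1 h1
  have hcard : ∀ j ∈ J, (((Icc 1 X).filter fun n => j.2 ^ 2 ∣ s.L j.1 n).card : ℝ) ≤
      X * ((j.2 : ℝ) ^ 2)⁻¹ + 1 := by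
    rintro ⟨i, p⟩ hj
    simp only [hJ, mem_product, mem_univ, true_and, mem_filter] at hj
    have hcop : s.W.Coprime (p ^ 2) :=
      Nat.Coprime.pow_right 2 ((primorial_coprime_prime_iff hj.2.1).2 hj.2.2)
    have hp2 : 0 < p ^ 2 := pow_pos hj.2.1.pos 2
    obtain ⟨y, hy⟩ := s.exists_dvd_L_iff hcop i hp2
    have e : ((Icc 1 X).filter fun n => p ^ 2 ∣ s.L i n) = progression X (p ^ 2) y := by
      ext n
      simp [mem_progression, hy]
    have h := (abs_le.1 (abs_card_progression_sub_le (X := X) (b := y) hp2)).2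
    simp only
    rw [e]
    push_cast at h
    rw [← div_eq_mul_inv]
    linarith
  have hinv := sum_inv_sq_le hz (s := (Ioc z E).filter fun p => p.Prime ∧ s.D < p)
    fun p hp => (mem_Ioc.1 (mem_filter.1 hp).1).1
  have hcardJ : (((Ioc z E).filter fun p => p.Prime ∧ s.D < p).card : ℝ) ≤ E := by
    have h1 := card_filter_le (Ioc z E) fun p => p.Prime ∧ s.D < p
    rw [Nat.card_Ioc] at h1
    exact_mod_cast h1.trans (Nat.sub_le _ _)
  calc _ ≤ ((∑ j ∈ J, ((Icc 1 X).filter fun n => j.2 ^ 2 ∣ s.L j.1 n).card : ℕ) : ℝ) := by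
        exact_mod_cast (card_le_card hsub).trans card_biUnion_le
    _ ≤ ∑ j ∈ J, (X * ((j.2 : ℝ) ^ 2)⁻¹ + 1) := by
        push_cast
        exact sum_le_sum hcard
    _ = k * (X * (∑ p ∈ (Ioc z E).filter fun p => p.Prime ∧ s.D < p, ((p : ℝ) ^ 2)⁻¹) +
          ((Ioc z E).filter fun p => p.Prime ∧ s.D < p).card) := by
        rw [hJ, sum_product]
        simp only [sum_const, card_univ, Fintype.card_fin, sum_add_distrib, ← mul_sum, nsmul_eq_mul,
          mul_one]
    _ ≤ _ := by
        have h5 := mul_le_mul_of_nonneg_left hinv (Nat.cast_nonneg X : (0 : ℝ) ≤ X)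
        refine mul_le_mul_of_nonneg_left (add_le_add ?_ hcardJ) (Nat.cast_nonneg k)
        simpa [div_eq_mul_inv] using h5

/-- The weights detect the `n` at which the divisor functions of the forms have a small sum. -/
lemma sieve_inequality {P Q N : Finset ℕ} {Y : Finset ℕ → ℝ} {T B : ℝ} (hT : 0 ≤ T)
    (hB : ∀ n ∈ N, (¬ ∃ p ∈ Q, ∃ i, p ∣ s.L i n) → |s.Λ P Y n| ≤ B) :
    T * ∑ n ∈ N, s.Λ P Y n ^ 2 - ∑ i, ∑ n ∈ N, ((s.L i n).divisors.card : ℝ) * s.Λ P Y n ^ 2 -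
        T * ∑ n ∈ N.filter (fun n => ∃ p ∈ Q, ∃ i, p ∣ s.L i n), s.Λ P Y n ^ 2 ≤
      T * B ^ 2 * ((N.filter fun n => (¬ ∃ p ∈ Q, ∃ i, p ∣ s.L i n) ∧
        (∑ i, ((s.L i n).divisors.card : ℝ)) < T).card : ℝ) := by
  rw [sum_comm, card_filter, Nat.cast_sum, mul_sum, mul_sum, mul_sum, sum_filter,
    ← sum_sub_distrib, ← sum_sub_distrib]
  refine sum_le_sum fun n hn => ?_
  rw [← sum_mul]
  set τ := ∑ i, ((s.L i n).divisors.card : ℝ) with hτ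
  have hτ0 : 0 ≤ τ := sum_nonneg fun _ _ => Nat.cast_nonneg _
  have hsq := sq_nonneg (s.Λ P Y n)
  by_cases hr : ∃ p ∈ Q, ∃ i, p ∣ s.L i n
  · simp only [hr, if_true, not_true, false_and, if_false]
    push_cast
    nlinarith [mul_nonneg hτ0 hsq]
  · have hb := sq_le_sq' (by linarith [abs_le.1 (hB n hn hr)]) (abs_le.1 (hB n hn hr)).2
    by_cases ht : τ < T
    · simp only [hr, if_false, ht, not_false_eq_true, and_self, if_true]
      push_cast
      nlinarith [mul_nonneg hτ0 hsq]
    · simp only [hr, if_false, ht, not_false_eq_true, and_false]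
      push_cast
      nlinarith

end SieveSetup

/-- The number of prime factors in the main theorem. -/
def omegaBound (k : ℕ) : ℕ := Nat.log 2 ((3 * k ^ 2 + 4 * k + 4) / 2)

/-- The bound imposed on the sum of the divisor functions. -/
def divisorBound (k : ℕ) : ℕ := 2 ^ (omegaBound k + 1) + 2 * k - 2

lemma divisorBound_add_two {k : ℕ} : divisorBound k + 2 = 2 ^ (omegaBound k + 1) + 2 * k := by
  have : 2 ^ 1 ≤ 2 ^ (omegaBound k + 1) := Nat.pow_le_pow_right (by norm_num) (by omega)
  unfold divisorBound
  omega

lemma lt_two_pow_omegaBound (k : ℕ) : (3 * k ^ 2 + 4 * k + 4) / 2 < 2 ^ (omegaBound k + 1) :=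
  Nat.lt_pow_succ_log_self (by norm_num) _

lemma polynomial_inequality {k : ℕ} (hk : 0 < k) :
    2 * k * (2 * (k + 2) * (k + 3) * (k + 4) + (12 * k + 1) * (k + 3) * (k + 4) +
        (36 * k ^ 2 + 12 * k) * (k + 4) + 36 * k ^ 2) <
      divisorBound k * (2 * (k + 3) * (k + 4) + 18 * k * (k + 4) + 54 * k ^ 2) := by
  rcases lt_or_ge k 16 with h | h
  · have hq : ∀ k ∈ Ico 1 16, 2 * k * (2 * (k + 2) * (k + 3) * (k + 4) +
        (12 * k + 1) * (k + 3) * (k + 4) + (36 * k ^ 2 + 12 * k) * (k + 4) + 36 * k ^ 2) <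
      divisorBound k * (2 * (k + 3) * (k + 4) + 18 * k * (k + 4) + 54 * k ^ 2) := by
      decide +kernel
    exact hq k (mem_Ico.2 ⟨hk, h⟩)
  · have h1 := lt_two_pow_omegaBound k
    have h2 := divisorBound_add_two (k := k)
    have h3 : 3 * k ^ 2 + 8 * k + 1 ≤ 2 * divisorBound k := by omega
    obtain ⟨m, rfl⟩ := Nat.exists_eq_add_of_le h
    refine Nat.lt_of_mul_lt_mul_left (a := 2) ?_
    rw [← mul_assoc 2 (divisorBound _)]
    refine lt_of_lt_of_le ?_ (Nat.mul_le_mul_right _ h3)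
    ring_nf
    nlinarith [Nat.zero_le m, Nat.zero_le (m ^ 2), Nat.zero_le (m ^ 3), Nat.zero_le (m ^ 4)]

lemma factorial_mul_squareConst (k : ℕ) (β : ℝ) : ((k + 4).factorial : ℝ) * squareConst k β =
    2 * (k + 3) * (k + 4) + 6 * β * (k + 4) + 6 * β ^ 2 := by
  have h : ((k + 2).factorial : ℝ) ≠ 0 := by positivity
  have e3 : ((k + 3).factorial : ℝ) = (k + 3) * (k + 2).factorial := by
    rw [Nat.factorial_succ (k + 2)]; push_cast; ring
  have e4 : ((k + 4).factorial : ℝ) = (k + 4) * ((k + 3) * (k + 2).factorial) := by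
    rw [Nat.factorial_succ (k + 3), Nat.cast_mul, e3]; push_cast; ring
  unfold squareConst
  rw [e4, e3]
  field_simp

lemma factorial_mul_divisorConst (k : ℕ) (β κ : ℝ) :
    ((k + 4).factorial : ℝ) * divisorConst k β κ =
      κ * (k + 2) * (k + 3) * (k + 4) + (2 * κ * β + 1) * (k + 3) * (k + 4) +
        (2 * κ * β ^ 2 + 4 * β) * (k + 4) + 4 * β ^ 2 := by
  have h : ((k + 1).factorial : ℝ) ≠ 0 := by positivity
  have e2 : ((k + 2).factorial : ℝ) = (k + 2) * (k + 1).factorial := by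
    rw [Nat.factorial_succ (k + 1)]; push_cast; ring
  have e3 : ((k + 3).factorial : ℝ) = (k + 3) * ((k + 2) * (k + 1).factorial) := by
    rw [Nat.factorial_succ (k + 2), Nat.cast_mul, e2]; push_cast; ring
  have e4 : ((k + 4).factorial : ℝ) = (k + 4) * ((k + 3) * ((k + 2) * (k + 1).factorial)) := by
    rw [Nat.factorial_succ (k + 3), Nat.cast_mul, e3]; push_cast; ring
  unfold divisorConst
  rw [e4, e3, e2]
  field_simp

lemma two_mul_divisorConst_lt {k : ℕ} (hk : 0 < k) :
    2 * k * divisorConst k (3 * k) 2 < divisorBound k * squareConst k (3 * k) := by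
  have h0 : (0 : ℝ) < (k + 4).factorial := by positivity
  have h := polynomial_inequality hk
  rw [← Nat.cast_lt (α := ℝ)] at h
  push_cast at h
  refine lt_of_mul_lt_mul_left ?_ h0.le
  rw [mul_left_comm, mul_left_comm _ (divisorBound k : ℝ), factorial_mul_divisorConst,
    factorial_mul_squareConst]
  calc _ = _ := by ring
    _ < _ := h
    _ = _ := by ring

/-- Elementary combination of the main terms and the error terms of the sieve. -/
lemma exists_combine_main_terms {k : ℕ} {W T C B₁ B₂ e M v₁ v₂ : ℝ} (hW : 0 < W) (hT : 0 ≤ T)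
    (hC : 0 ≤ C) (hM : 0 ≤ M) (hv : 2 * k * e * v₂ < T * v₁) :
    ∃ γ > 0, ∃ δ > 0, ∃ ε > 0, ∃ ℓ₀ : ℝ, 1 ≤ ℓ₀ ∧ ∀ X E r z ℓ y S₁ S₂ S₃ : ℝ, 0 ≤ X → 1 ≤ E →
      X ≤ E ^ 2 → z ≤ E → 0 ≤ r → ℓ₀ ≤ ℓ → 0 ≤ y → y ≤ δ * ℓ → E * r ≤ ε * X →
      X / W * (ℓ ^ (k + 2) * (v₁ - B₁ / ℓ)) - r ≤ S₁ →
      S₂ ≤ k * (2 * (X / W) * (e * (ℓ ^ (k + 2) * (v₂ + B₂ / ℓ))) + (2 * X * C / E + 2 * E) * r) →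
      S₃ ≤ X / W * (M * ℓ ^ k) * (y * (y + M)) + k * z * r →
      γ * X * ℓ ^ (k + 2) ≤ T * S₁ - S₂ - T * S₃ := by
  set ρ := T * v₁ - 2 * k * e * v₂ with hρd
  have hρ : 0 < ρ := sub_pos.2 hv
  set N₁ := T + k * (2 * C + 2) + T * k + 1 with hN₁
  have hN₁0 : 0 < N₁ := by positivity
  set N₂ := |T * B₁ + 2 * k * e * B₂| with hN₂
  set N₃ := T * M * (1 + M) + 1 with hN₃
  have hN₃0 : 0 < N₃ := by positivity
  refine ⟨ρ / (4 * W), by positivity, min 1 (ρ / (4 * N₃)), by positivity,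
    ρ / (4 * N₁ * W), by positivity, max 1 (4 * N₂ / ρ), le_max_left _ _, ?_⟩
  intro X E r z ℓ y S₁ S₂ S₃ hX hE hXE hz hr hℓ₀ hy hyδ hEr h1 h2 h3
  have hℓ1 : 1 ≤ ℓ := (le_max_left _ _).trans hℓ₀
  have hℓ : 0 < ℓ := by linarith
  have hℓN : N₂ / ℓ ≤ ρ / 4 := by
    have := (div_le_iff₀ hρ).1 ((le_max_right _ _).trans hℓ₀)
    rw [div_le_iff₀ hℓ]
    linarith
  set δ := min 1 (ρ / (4 * N₃)) with hδd
  have hδ1 : δ ≤ 1 := min_le_left _ _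
  have hδ0 : 0 < δ := by positivity
  have hδN : δ * N₃ ≤ ρ / 4 := by
    have := (le_div_iff₀ (by positivity)).1 (min_le_right 1 (ρ / (4 * N₃)))
    linarith
  set Q := X / W with hQ
  have hQ0 : 0 ≤ Q := by positivity
  have hp1 : 1 ≤ ℓ ^ (k + 2) := one_le_pow₀ hℓ1
  have hEr0 : 0 ≤ E * r := by positivity
  have herr : N₁ * (E * r) ≤ ρ / 4 * Q := by
    calc N₁ * (E * r) ≤ N₁ * (ρ / (4 * N₁ * W) * X) := by gcongr
      _ = ρ / 4 * Q := by rw [hQ]; field_simp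
  have hXE' : 2 * X * C / E + 2 * E ≤ (2 * C + 2) * E := by
    have : 2 * X * C / E ≤ 2 * C * E := by
      rw [div_le_iff₀ (by linarith)]
      nlinarith
    linarith
  have hrE : r ≤ E * r := le_mul_of_one_le_left hr hE
  have e1 : (2 * X * C / E + 2 * E) * r ≤ (2 * C + 2) * (E * r) := by
    rw [← mul_assoc]; gcongr
  have e3 : z * r ≤ E * r := by gcongr
  have m3 : Q * (M * ℓ ^ k) * (y * (y + M)) ≤ Q * ℓ ^ (k + 2) * (δ * (M * (1 + M))) := by
    have h5 : y * (y + M) ≤ (δ * ℓ) * ((1 + M) * ℓ) := by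
      refine mul_le_mul hyδ ?_ (by positivity) (by positivity)
      nlinarith
    calc _ ≤ Q * (M * ℓ ^ k) * ((δ * ℓ) * ((1 + M) * ℓ)) := by gcongr
      _ = _ := by ring
  have hmain : Q * ℓ ^ (k + 2) * (ρ - (T * B₁ + 2 * k * e * B₂) / ℓ - T * (δ * (M * (1 + M)))) -
      (T + k * (2 * C + 2) + T * k) * (E * r) ≤ T * S₁ - S₂ - T * S₃ := by
    have t1 := mul_le_mul_of_nonneg_left h1 hT
    have t3 := mul_le_mul_of_nonneg_left h3 hT
    have t3' := mul_le_mul_of_nonneg_left m3 hT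
    have t4 := mul_le_mul_of_nonneg_left hrE hT
    have t5 := mul_le_mul_of_nonneg_left e1 (Nat.cast_nonneg k : (0 : ℝ) ≤ k)
    have t6 := mul_le_mul_of_nonneg_left e3 (by positivity : 0 ≤ T * k)
    have id1 : Q * ℓ ^ (k + 2) * (ρ - (T * B₁ + 2 * k * e * B₂) / ℓ - T * (δ * (M * (1 + M)))) =
        T * (Q * (ℓ ^ (k + 2) * (v₁ - B₁ / ℓ))) -
          k * (2 * Q * (e * (ℓ ^ (k + 2) * (v₂ + B₂ / ℓ)))) -
          T * (Q * ℓ ^ (k + 2) * (δ * (M * (1 + M)))) := by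
      rw [hρd]; ring
    rw [id1]
    linarith
  have hbr : ρ / 2 ≤ ρ - (T * B₁ + 2 * k * e * B₂) / ℓ - T * (δ * (M * (1 + M))) := by
    have h6 : (T * B₁ + 2 * k * e * B₂) / ℓ ≤ N₂ / ℓ := by
      gcongr
      exact le_abs_self _
    have h7 : T * (δ * (M * (1 + M))) ≤ δ * N₃ := by
      have h71 : T * (δ * (M * (1 + M))) = δ * N₃ - δ := by rw [hN₃]; ring
      linarith
    linarith
  have h8 : ρ / 4 * Q ≤ ρ / 4 * (Q * ℓ ^ (k + 2)) := by
    gcongr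
    exact le_mul_of_one_le_right hQ0 hp1
  have h9 : Q * ℓ ^ (k + 2) * (ρ / 2) ≤ _ :=
    mul_le_mul_of_nonneg_left hbr (by positivity : 0 ≤ Q * ℓ ^ (k + 2))
  have h10 : (T + k * (2 * C + 2) + T * k) * (E * r) ≤ N₁ * (E * r) := by
    gcongr; linarith
  have id2 : ρ / (4 * W) * X * ℓ ^ (k + 2) = ρ / 4 * (Q * ℓ ^ (k + 2)) := by
    rw [hQ]; field_simp
  rw [id2]
  linarith

namespace SieveSetup

variable {k : ℕ} (s : SieveSetup k)

lemma exists_copHarm_bounds : ∃ c c₀ C A : ℝ, 0 < c ∧ c ≤ 1 ∧ 0 ≤ C ∧ 0 ≤ A ∧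
    (∀ y : ℝ, 0 < y → |copHarm s.W y - c * Real.log y - c₀| ≤ C / y) ∧
    ∀ x : ℝ, 0 ≤ x → |copHarm s.W (Real.exp x) - c * x| ≤ A := by
  obtain ⟨c, c₀, C, hc, hc1, hC, h⟩ := exists_copHarm_asymp
    ((range (s.D + 1)).filter Nat.Prime) fun p hp => (mem_filter.1 hp).2
  refine ⟨c, c₀, C, |c₀| + C, hc, hc1, hC, by positivity, h, fun x hx => ?_⟩
  have h1 := h (Real.exp x) (Real.exp_pos x)
  rw [Real.log_exp] at h1
  have h2 : C / Real.exp x ≤ C := div_le_self hC (Real.one_le_exp hx)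
  have h3 := abs_add_le (copHarm s.W (Real.exp x) - c * x - c₀) c₀
  rw [sub_add_cancel] at h3
  have h4 : |copHarm s.W (Real.exp x) - c * x - c₀| ≤ C := h1.trans h2
  linarith

lemma sum_sq_ge {R X : ℕ} (Y : Finset ℕ → ℝ) :
    (X : ℝ) / s.W * (∑ S ∈ (primesCop s.W R).powerset, (∏ p ∈ S, (k : ℝ) / (p - k)) * Y S ^ 2) -
        errSum k (primesCop s.W R) Y ^ 2 ≤
      ∑ n ∈ progression X s.W s.n₀, s.Λ (primesCop s.W R) Y n ^ 2 := by
  have h := (abs_le.1 (s.abs_sum_sq_sub_le (R := R) (e := 1) Y (Nat.coprime_one_right _) one_pos X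
    ⟨0, s.k_pos⟩)).1
  have hf : (primesCop s.W R).filter (· ∣ 1) = ∅ :=
    filter_eq_empty_iff.2 fun p hp hd => (mem_primesCop.1 hp).2.1.one_lt.ne' (Nat.dvd_one.1 hd)
  rw [hf] at h
  simp only [one_dvd, filter_true, sdiff_empty, powerset_empty, sum_singleton, card_empty, pow_zero,
    union_empty, one_mul, Nat.cast_one, mul_one] at h
  linarith

lemma exists_sieve_lower_bound {T : ℕ} {β κ : ℝ} (hβ : 0 ≤ β) (hκ : 1 ≤ κ)
    (hnum : 2 * k * Real.exp ((2 * k ^ 2 + 8 * k + 2) / s.D) * divisorConst k β κ <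
      T * squareConst k β) :
    ∃ γ > 0, ∃ δ > 0, ∃ ε > 0, ∃ ℓ₀ N M : ℝ, 1 ≤ ℓ₀ ∧ 0 ≤ M ∧ ∀ R E X z m : ℕ, 0 < z → z ≤ E →
      (X : ℝ) ≤ (E : ℝ) ^ 2 → (∀ i, s.L i X ≤ E ^ 2) → (∀ i, s.L i X ≤ (z + 1) ^ m) →
      ℓ₀ ≤ Real.log R → Real.log z ≤ δ * Real.log R → Real.log E + N ≤ κ * Real.log R →
      E * errSum k (primesCop s.W R) (sieveY (primesCop s.W R) (linWeight R β)) ^ 2 ≤ ε * X →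
      γ * X * Real.log R ^ (k + 2) ≤ T * (M * 4 ^ (m * k) * Real.log R ^ (k + 1)) ^ 2 *
        (((progression X s.W s.n₀).filter fun n =>
          (¬ ∃ p ∈ (primesCop s.W R).filter (· ≤ z), ∃ i, p ∣ s.L i n) ∧
          (∑ i, ((s.L i n).divisors.card : ℝ)) < T).card : ℝ) := by
  obtain ⟨c, c₀, C, A, hc, hc1, hC, hA0, hharm, hA⟩ := s.exists_copHarm_bounds
  obtain ⟨C₁, hC₁0, hC₁⟩ := exists_sum_log_div_sub_one_le
  obtain ⟨C₂, -, hC₂⟩ := exists_sum_log_div_sq_le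
  obtain ⟨B₁, hB₁⟩ := exists_le_sum_sieveY_sq k hc.le hc1 hA0 hβ hA
  obtain ⟨B₂, hB₂⟩ := exists_sum_mul_divisorMain_le k hc.le hc1 hA0 hβ hκ hC₁0 hA hC₁
  obtain ⟨M, hM0, hM⟩ := s.exists_sum_filter_smooth_sq_le hc.le hc1 hA0 hβ hA
  obtain ⟨M', hM'0, hM'⟩ := s.exists_abs_Λ_le hc.le hc1 hA0 hβ hA
  set e := Real.exp ((2 * k ^ 2 + 8 * k + 2) / s.D) with he
  have hv : 2 * k * e * (c ^ (k + 2) * divisorConst k β κ) <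
      T * (c ^ (k + 2) * squareConst k β) := by
    rw [mul_left_comm, mul_left_comm (T : ℝ)]
    exact mul_lt_mul_of_pos_left hnum (by positivity)
  have hW : (0 : ℝ) < s.W := by exact_mod_cast s.W_pos
  obtain ⟨γ, hγ, δ, hδ, ε, hε, ℓ₀, hℓ₀1, hcomb⟩ := exists_combine_main_terms (B₁ := B₁) (B₂ := B₂)
    hW (Nat.cast_nonneg T) hC hM0 hv
  refine ⟨γ, hγ, δ, hδ, ε, hε, ℓ₀, c₀ / c + C₂, M', hℓ₀1, hM'0, ?_⟩
  intro R E X z m hz hzE hXE hLE hLz hℓ hlz hlE herr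
  have hR : 1 ≤ Real.log R := hℓ₀1.trans hℓ
  set P := primesCop s.W R with hP
  set Y := sieveY P (linWeight R β) with hY
  have hPD : ∀ q ∈ P, s.D < q := fun q hq => s.lt_of_mem_primesCop hq
  have hkD : ∀ q ∈ P, k < q := fun q hq => by
    have h1 := hPD q hq
    have h2 := s.lt_D
    omega
  refine le_trans (hcomb X E (errSum k P Y ^ 2) z (Real.log R) (Real.log z) _ _ _
    (Nat.cast_nonneg X) (by exact_mod_cast hz.trans_le hzE) hXE (by exact_mod_cast hzE)
    (sq_nonneg _) hℓ (Real.log_natCast_nonneg z) hlz herr ?_ ?_ (hM R X z hR hz))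
    (s.sieve_inequality (N := progression X s.W s.n₀) (Nat.cast_nonneg T) fun n hn hrough => ?_)
  · refine le_trans ?_ (s.sum_sq_ge Y)
    gcongr
    exact hB₁ R hR hkD
  · have hS : ∀ i ∈ (univ : Finset (Fin k)), _ := fun i _ =>
      s.sum_card_divisors_mul_sq_le (R := R) (hz.trans_le hzE) hc.le hC hharm hC₂
        (decUpTo_linWeight R hβ) i (hLE i)
    refine (sum_le_card_nsmul _ _ _ hS).trans ?_
    rw [card_univ, Fintype.card_fin, nsmul_eq_mul]
    have hK : c * Real.log E + c₀ + c * C₂ ≤ c * κ * Real.log R := by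
      have := mul_le_mul_of_nonneg_left hlE hc.le
      have e1 : c * (Real.log E + (c₀ / c + C₂)) = c * Real.log E + c₀ + c * C₂ := by
        field_simp
        ring
      linarith
    have h := hB₂ R s.D hR s.lt_D hPD _ hK
    gcongr
  · refine (hM' R n hR).trans ?_
    gcongr
    · norm_num
    · exact s.card_filter_exists_dvd_le (mem_progression.1 hn).1.2 hz hLz hrough

end SieveSetup

open Filter in
lemma eventually_mul_rpow_mul_log_pow_le (C : ℝ) {r ε : ℝ} (hr : r < 1) (k : ℕ) (hε : 0 < ε) :
    ∀ᶠ x : ℝ in atTop, C * x ^ r * Real.log x ^ k ≤ ε * x := by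
  have h := (isLittleO_log_rpow_rpow_atTop (k : ℝ) (sub_pos.2 hr)).bound
    (show 0 < ε / (|C| + 1) by positivity)
  filter_upwards [h, eventually_ge_atTop 1] with x hx hx1
  have hx0 : 0 < x := by linarith
  rw [Real.rpow_natCast, Real.norm_of_nonneg (pow_nonneg (Real.log_nonneg hx1) _),
    Real.norm_of_nonneg (by positivity)] at hx
  calc C * x ^ r * Real.log x ^ k ≤ (|C| + 1) * x ^ r * (ε / (|C| + 1) * x ^ (1 - r)) := by
        gcongr
        · exact pow_nonneg (Real.log_nonneg hx1) _
        · linarith [le_abs_self C]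
    _ = ε * (x ^ r * x ^ (1 - r)) := by field_simp
    _ = ε * x := by rw [← Real.rpow_add hx0]; simp

lemma half_le_natFloor {x : ℝ} (hx : 1 ≤ x) : x / 2 ≤ (⌊x⌋₊ : ℝ) := by
  have h1 := Nat.lt_floor_add_one x
  have h2 : (1 : ℝ) ≤ ⌊x⌋₊ := by exact_mod_cast (Nat.one_le_floor_iff x).2 hx
  linarith

/-- The level of the sieve. -/
noncomputable def sieveLevel (α : ℝ) (X : ℕ) : ℕ := ⌊(X : ℝ) ^ α⌋₊

/-- The length of the divisor sum. -/
def divisorLength (a X : ℕ) : ℕ := Nat.sqrt (a * X) + 1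

lemma mul_le_divisorLength_sq (a X : ℕ) : a * X ≤ divisorLength a X ^ 2 := by
  rw [pow_two]
  exact (Nat.lt_succ_sqrt (a * X)).le

lemma divisorLength_le {a X : ℕ} (ha : 0 < a) (hX : 0 < X) :
    (divisorLength a X : ℝ) ≤ 2 * a * (X : ℝ) ^ (1 / 2 : ℝ) := by
  have h1 : (Nat.sqrt (a * X) : ℝ) ≤ a * (X : ℝ) ^ (1 / 2 : ℝ) := by
    have h2 : (Nat.sqrt (a * X) : ℝ) ≤ √((a * X : ℕ) : ℝ) := Real.nat_sqrt_le_real_sqrt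
    refine h2.trans ?_
    rw [← Real.sqrt_eq_rpow, Nat.cast_mul, Real.sqrt_mul (Nat.cast_nonneg a)]
    gcongr
    rw [Real.sqrt_le_left (by positivity)]
    have : (1 : ℝ) ≤ a := by exact_mod_cast ha
    nlinarith
  have h3 : (1 : ℝ) ≤ a * (X : ℝ) ^ (1 / 2 : ℝ) := by
    have h4 : (1 : ℝ) ≤ a := by exact_mod_cast ha
    have h5 : (1 : ℝ) ≤ (X : ℝ) ^ (1 / 2 : ℝ) :=
      Real.one_le_rpow (by exact_mod_cast hX) (by norm_num)
    nlinarith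
  unfold divisorLength
  push_cast
  linarith

section

variable {α : ℝ} {X : ℕ}

lemma sieveLevel_pos (hα : 0 ≤ α) (hX : 0 < X) : 0 < sieveLevel α X :=
  Nat.floor_pos.2 (Real.one_le_rpow (by exact_mod_cast hX) hα)

lemma sieveLevel_le : (sieveLevel α X : ℝ) ≤ (X : ℝ) ^ α := Nat.floor_le (by positivity)

lemma le_sieveLevel (hα : 0 ≤ α) (hX : 0 < X) : (X : ℝ) ^ α / 2 ≤ sieveLevel α X :=
  half_le_natFloor (Real.one_le_rpow (by exact_mod_cast hX) hα)

lemma log_sieveLevel_le (hα : 0 ≤ α) (hα1 : α ≤ 1) (hX : 0 < X) :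
    Real.log (sieveLevel α X) ≤ Real.log X := by
  have hX1 : (1 : ℝ) ≤ X := by exact_mod_cast hX
  refine Real.log_le_log (by exact_mod_cast sieveLevel_pos hα hX) (sieveLevel_le.trans ?_)
  exact (Real.rpow_le_rpow_of_exponent_le hX1 hα1).trans (Real.rpow_one _).le

lemma le_log_sieveLevel (hα : 0 ≤ α) (hX : 0 < X) :
    α * Real.log X - Real.log 2 ≤ Real.log (sieveLevel α X) := by
  have hX0 : (0 : ℝ) < X := by exact_mod_cast hX
  have h := Real.log_le_log (by positivity) (le_sieveLevel hα hX)
  rwa [Real.log_div (by positivity) (by norm_num), Real.log_rpow hX0] at h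

end

open Filter in
lemma eventually_const_le_log_sieveLevel {α : ℝ} (hα : 0 < α) (ℓ₀ : ℝ) :
    ∀ᶠ X : ℕ in atTop, ℓ₀ ≤ Real.log (sieveLevel α X) := by
  have h := (Real.tendsto_log_atTop.comp tendsto_natCast_atTop_atTop).eventually_ge_atTop
    ((ℓ₀ + Real.log 2) / α)
  filter_upwards [h, eventually_gt_atTop 0] with X hX hX0
  have h1 : ℓ₀ + Real.log 2 ≤ Real.log X * α := (div_le_iff₀ hα).1 hX
  linarith [le_log_sieveLevel hα.le hX0]

open Filter in
lemma eventually_log_divisorLength_le {α κ : ℝ} {a : ℕ} (ha : 0 < a) (hα : 0 < α) (hκ : 0 ≤ κ)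
    (h : 1 / 2 < κ * α) (N : ℝ) :
    ∀ᶠ X : ℕ in atTop, Real.log (divisorLength a X) + N ≤ κ * Real.log (sieveLevel α X) := by
  have h1 := (Real.tendsto_log_atTop.comp tendsto_natCast_atTop_atTop).eventually_ge_atTop
    ((N + Real.log (2 * a) + κ * Real.log 2) / (κ * α - 1 / 2))
  filter_upwards [h1, eventually_gt_atTop 0] with X hX hX0
  have hX0' : (0 : ℝ) < X := by exact_mod_cast hX0
  have ha' : (0 : ℝ) < a := by exact_mod_cast ha
  have h2 := (div_le_iff₀ (sub_pos.2 h)).1 hX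
  simp only [Function.comp] at h2
  have h3 := Real.log_le_log (by unfold divisorLength; positivity) (divisorLength_le ha hX0)
  rw [Real.log_mul (by positivity) (by positivity), Real.log_rpow hX0'] at h3
  have h4 := mul_le_mul_of_nonneg_left (le_log_sieveLevel hα.le hX0) hκ
  linarith

open Filter in
lemma eventually_mul_le_rpow_sieveLevel {α : ℝ} (hα : 0 ≤ α) (h : 1 < 6 * α) (a : ℕ) :
    ∀ᶠ X : ℕ in atTop, (a * X : ℝ) ≤ (sieveLevel α X : ℝ) ^ 6 := by
  have h1 : ∀ᶠ X : ℕ in atTop, 64 * (a : ℝ) ≤ (X : ℝ) ^ (6 * α - 1) :=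
    ((tendsto_rpow_atTop (sub_pos.2 h)).comp tendsto_natCast_atTop_atTop).eventually_ge_atTop _
  filter_upwards [h1, eventually_gt_atTop 0] with X hX hX0
  have hX0' : (0 : ℝ) < X := by exact_mod_cast hX0
  calc (a * X : ℝ) = 64 * a * X / 64 := by ring
    _ ≤ (X : ℝ) ^ (6 * α - 1) * X / 64 := by gcongr
    _ = ((X : ℝ) ^ α / 2) ^ 6 := by
        rw [Real.rpow_sub_one hX0'.ne', div_pow, ← Real.rpow_mul_natCast hX0'.le]
        push_cast
        rw [mul_comm α, div_mul_cancel₀ _ hX0'.ne']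
        norm_num
    _ ≤ _ := by
        gcongr
        exact le_sieveLevel hα hX0

namespace SieveSetup

variable {k : ℕ} (s : SieveSetup k)

/-- The number of `n ≤ X` at which all forms have at most `omegaBound k` prime factors. -/
def goodCount (X : ℕ) : ℕ :=
  ((Icc 1 X).filter fun n => ∀ i, (s.L i n).primeFactorsList.length ≤ omegaBound k).card

lemma card_le_goodCount_add {R E X z : ℕ} (hz : 0 < z) (hzR : z ≤ R) (hE : ∀ i, s.L i X ≤ E ^ 2) :
    (((progression X s.W s.n₀).filter fun n =>
        (¬ ∃ p ∈ (primesCop s.W R).filter (· ≤ z), ∃ i, p ∣ s.L i n) ∧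
        (∑ i, ((s.L i n).divisors.card : ℝ)) < divisorBound k).card : ℝ) ≤
      s.goodCount X + k * ((X : ℝ) / z + E) := by
  set N := (progression X s.W s.n₀).filter fun n =>
    (¬ ∃ p ∈ (primesCop s.W R).filter (· ≤ z), ∃ i, p ∣ s.L i n) ∧
    (∑ i, ((s.L i n).divisors.card : ℝ)) < divisorBound k with hN
  have hNX : N ⊆ Icc 1 X := fun n hn =>
    mem_Icc.2 (mem_progression.1 (mem_filter.1 hn).1).1
  set q : ℕ → Prop := fun n => ∀ i, (s.L i n).primeFactorsList.length ≤ omegaBound k with hq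
  have hsplit := card_filter_add_card_filter_not (s := N) q
  have h1 : (N.filter q).card ≤ s.goodCount X := card_le_card (filter_subset_filter _ hNX)
  have h2 := s.card_le_of_exists_sq_dvd (N := N.filter fun n => ¬ q n) hz hE
    ((filter_subset _ _).trans hNX) fun n hn => by
      obtain ⟨hnN, hnq⟩ := mem_filter.1 hn
      obtain ⟨hnp, hrough, hsum⟩ := mem_filter.1 hnN
      by_contra hcon
      refine hnq (length_primeFactorsList_le_of_sum_card_divisors_lt (fun i => ?_) (fun i => ?_) ?_)
      · rw [Nat.squarefree_iff_prime_squarefree]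
        intro p hp hpp
        have hpL : p ∣ s.L i n := (dvd_mul_right p p).trans hpp
        have hcop := (s.coprime_L hnp i).coprime_dvd_right hpL
        have hD : s.D < p := (primorial_coprime_prime_iff hp).1 hcop
        refine hcon ⟨p, hp, hD, ?_, i, by rwa [pow_two]⟩
        by_contra! hpz
        exact hrough ⟨p, mem_filter.2 ⟨mem_primesCop.2 ⟨hpz.trans hzR, hp, hcop⟩, hpz⟩, i, hpL⟩
      · have h3 := Nat.mul_pos (s.a_pos i) (mem_progression.1 hnp).1.1
        have h4 := s.b_pos i
        unfold L
        omega
      · have h5 : ∑ i, (s.L i n).divisors.card < divisorBound k := by exact_mod_cast hsum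
        have h6 := divisorBound_add_two (k := k)
        omega
  rw [← hsplit]
  push_cast
  have h1' : ((N.filter q).card : ℝ) ≤ s.goodCount X := by exact_mod_cast h1
  linarith

set_option maxHeartbeats 2000000 in
open Filter in
lemma exists_le_goodCount {θ β : ℝ} (hθ : 0 < θ) (hθ1 : θ ≤ 1) (hβ : 0 ≤ β)
    (hη : ∀ p : ℕ, s.D < p → (4 * k + 1 : ℝ) ≤ (p : ℝ) ^ (θ / 4))
    (hnum : 2 * k * Real.exp ((2 * k ^ 2 + 8 * k + 2) / s.D) * divisorConst k β (2 + 2 * θ) <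
      divisorBound k * squareConst k β) :
    ∃ γ > 0, ∀ᶠ X : ℕ in atTop, γ * X / Real.log X ^ k ≤ s.goodCount X := by
  obtain ⟨γ, hγ, δ, hδ, ε, hε, ℓ₀, N, M, hℓ₀, hM, hmain⟩ :=
    s.exists_sieve_lower_bound hβ (by linarith : 1 ≤ 2 + 2 * θ) hnum
  set α : ℝ := 1 / (4 + 3 / 2 * θ) with hα
  have hα0 : 0 < α := by positivity
  have hα2 : α ≤ 1 / 2 := by
    rw [hα]
    gcongr
    linarith
  set δ' := min δ 1 with hδ'
  have hδ'0 : 0 < δ' := by positivity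
  set m := ⌈6 / δ'⌉₊ with hm
  obtain ⟨a, ha0, ha⟩ : ∃ a : ℕ, 0 < a ∧ ∀ i, s.a i + s.b i ≤ a :=
    ⟨∑ i, (s.a i + s.b i) + 1, by omega, fun i =>
      (single_le_sum (f := fun i => s.a i + s.b i) (fun _ _ => Nat.zero_le _)
        (mem_univ i)).trans (Nat.le_succ _)⟩
  set B : ℝ := divisorBound k * (M * 4 ^ (m * k)) ^ 2 + 1 with hB
  have hB0 : 0 < B := by positivity
  set r : ℝ := 1 / 2 + 2 * (α * (1 + θ / 4)) with hr
  have hr1 : r < 1 := by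
    have : α * (4 + 3 / 2 * θ) = 1 := by rw [hα]; field_simp
    nlinarith
  have hcast := tendsto_natCast_atTop_atTop (R := ℝ)
  refine ⟨γ / (2 * B), by positivity, ?_⟩
  filter_upwards [eventually_const_le_log_sieveLevel hα0 ℓ₀,
    eventually_log_divisorLength_le ha0 hα0 (by linarith : 0 ≤ 2 + 2 * θ)
      (by rw [hα, mul_one_div, lt_div_iff₀ (by positivity)]; linarith) N,
    eventually_mul_le_rpow_sieveLevel hα0.le
      (by rw [hα, mul_one_div, lt_div_iff₀ (by positivity)]; linarith) a,
    hcast.eventually (eventually_mul_rpow_mul_log_pow_le (2 * a * (1 + β) ^ 2) hr1 0 hε),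
    hcast.eventually (eventually_mul_rpow_mul_log_pow_le (k * 4)
      (by nlinarith : 1 - α * δ' < 1) k (by positivity : 0 < γ / (4 * B))),
    hcast.eventually (eventually_mul_rpow_mul_log_pow_le (k * (2 * a))
      (by norm_num : (1 / 2 : ℝ) < 1) k (by positivity : 0 < γ / (4 * B))),
    eventually_gt_atTop 1] with X h1 h2 h3 h4 h5 h6 hX1
  have hX0 : 0 < X := by omega
  have hX0' : (0 : ℝ) < X := by exact_mod_cast hX0
  have hX1' : (1 : ℝ) ≤ X := by exact_mod_cast hX0
  set R := sieveLevel α X with hR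
  set E := divisorLength a X with hE
  set z := ⌊(R : ℝ) ^ δ'⌋₊ with hz
  have hR0 : 0 < R := sieveLevel_pos hα0.le hX0
  have hR1 : (1 : ℝ) ≤ R := by exact_mod_cast hR0
  have hzR' : (z : ℝ) ≤ (R : ℝ) ^ δ' := Nat.floor_le (by positivity)
  have hRδ1 : 1 ≤ (R : ℝ) ^ δ' := Real.one_le_rpow hR1 hδ'0.le
  have hz0 : 0 < z := Nat.floor_pos.2 hRδ1
  have hzR : z ≤ R := by
    have h7 := hzR'.trans ((Real.rpow_le_rpow_of_exponent_le hR1 (min_le_right δ 1)).trans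
      (Real.rpow_one _).le)
    exact_mod_cast h7
  have hEle := divisorLength_le ha0 hX0
  have haX : (a * X : ℝ) ≤ (E : ℝ) ^ 2 := by exact_mod_cast mul_le_divisorLength_sq a X
  have hXE : (X : ℝ) ≤ (E : ℝ) ^ 2 := by
    have : (1 : ℝ) ≤ a := by exact_mod_cast ha0
    nlinarith
  have hL : ∀ i, s.L i X ≤ a * X := fun i => by
    have h8 := Nat.mul_le_mul_right X (ha i)
    have h9 := Nat.le_mul_of_pos_right (s.b i) hX0
    unfold L
    rw [add_mul] at h8
    omega
  have hRE : R ≤ E := by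
    have h7 : (R : ℝ) ^ 2 ≤ (E : ℝ) ^ 2 := by
      refine le_trans ?_ hXE
      calc (R : ℝ) ^ 2 ≤ ((X : ℝ) ^ α) ^ 2 := by
            gcongr
            exact sieveLevel_le
        _ = (X : ℝ) ^ (α * 2) := by
            rw [← Real.rpow_mul_natCast hX0'.le]; norm_num
        _ ≤ (X : ℝ) ^ (1 : ℝ) := Real.rpow_le_rpow_of_exponent_le hX1' (by linarith)
        _ = X := Real.rpow_one _
    exact_mod_cast (pow_le_pow_iff_left₀ (by positivity) (by positivity) two_ne_zero).1 h7
  have hLz : ∀ i, s.L i X ≤ (z + 1) ^ m := fun i => by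
    have h7 : (a * X : ℝ) ≤ ((z + 1 : ℕ) : ℝ) ^ m := by
      refine h3.trans ?_
      calc (R : ℝ) ^ 6 = (R : ℝ) ^ (6 : ℝ) := by norm_cast
        _ ≤ (R : ℝ) ^ (δ' * m) := by
            refine Real.rpow_le_rpow_of_exponent_le hR1 ?_
            have := (div_le_iff₀ hδ'0).1 (Nat.le_ceil (6 / δ'))
            linarith
        _ = ((R : ℝ) ^ δ') ^ m := Real.rpow_mul_natCast (by positivity) _ _
        _ ≤ _ := by
            gcongr
            push_cast
            exact (Nat.lt_floor_add_one _).le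
    exact (hL i).trans (by exact_mod_cast h7)
  have hLE : ∀ i, s.L i X ≤ E ^ 2 := fun i => (hL i).trans (mul_le_divisorLength_sq a X)
  have hlz : Real.log z ≤ δ * Real.log R := by
    refine (Real.log_le_log (by exact_mod_cast hz0) hzR').trans ?_
    rw [Real.log_rpow (by linarith)]
    exact mul_le_mul_of_nonneg_right (min_le_left _ _) (Real.log_natCast_nonneg R)
  have herr : E * errSum k (primesCop s.W R) (sieveY (primesCop s.W R) (linWeight R β)) ^ 2 ≤
      ε * X := by
    have h7 := errSum_le (W := s.W) (R := R) (k := k) hβ (by positivity : 0 ≤ θ / 4)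
      fun p hp => hη p (s.lt_of_mem_primesCop hp)
    have h8 : 0 ≤ errSum k (primesCop s.W R) (sieveY (primesCop s.W R) (linWeight R β)) :=
      sum_nonneg fun _ _ => by positivity
    rw [pow_zero, mul_one] at h4
    refine le_trans ?_ h4
    calc _ ≤ 2 * a * (X : ℝ) ^ (1 / 2 : ℝ) * ((1 + β) * ((X : ℝ) ^ α) ^ (1 + θ / 4)) ^ 2 := by
          gcongr
          refine h7.trans ?_
          gcongr
          exact sieveLevel_le
      _ = _ := by
          rw [hr, Real.rpow_add hX0', ← Real.rpow_mul hX0'.le, mul_pow,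
            ← Real.rpow_mul_natCast hX0'.le]
          push_cast
          rw [mul_comm _ (2 : ℝ)]
          ring
  have hfin := hmain R E X z m hz0 (hzR.trans hRE) hXE hLE hLz h1 hlz h2 herr
  have hcard := s.card_le_goodCount_add hz0 hzR hLE
  set G := (((progression X s.W s.n₀).filter fun n =>
    (¬ ∃ p ∈ (primesCop s.W R).filter (· ≤ z), ∃ i, p ∣ s.L i n) ∧
    (∑ i, ((s.L i n).divisors.card : ℝ)) < divisorBound k).card : ℝ) with hG
  have hG0 : 0 ≤ G := Nat.cast_nonneg _
  set ℓ := Real.log R with hℓ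
  have hℓ0 : 0 < ℓ := by linarith
  have hℓX : ℓ ≤ Real.log X := log_sieveLevel_le hα0.le (by linarith) hX0
  have hlX : 0 < Real.log X := by linarith
  have hlow : γ * X ≤ B * G * Real.log X ^ k := by
    have h7 : γ * X * ℓ ^ (k + 2) ≤ B * G * ℓ ^ k * ℓ ^ (k + 2) := by
      refine hfin.trans ?_
      have e : (divisorBound k : ℝ) * (M * 4 ^ (m * k) * ℓ ^ (k + 1)) ^ 2 * G =
          (B - 1) * G * ℓ ^ k * ℓ ^ (k + 2) := by rw [hB]; ring
      rw [e]
      gcongr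
      linarith
    refine (le_of_mul_le_mul_right h7 (by positivity)).trans ?_
    gcongr
  have hsq : k * ((X : ℝ) / z + E) * Real.log X ^ k ≤ γ / (2 * B) * X := by
    have hzX : (X : ℝ) ^ (α * δ') / 4 ≤ z := by
      refine le_trans ?_ (half_le_natFloor hRδ1)
      have h7 : ((X : ℝ) ^ α / 2) ^ δ' ≤ (R : ℝ) ^ δ' :=
        Real.rpow_le_rpow (by positivity) (le_sieveLevel hα0.le hX0) hδ'0.le
      rw [Real.div_rpow (by positivity) (by norm_num), ← Real.rpow_mul hX0'.le] at h7
      have h8 : (2 : ℝ) ^ δ' ≤ 2 := (Real.rpow_le_rpow_of_exponent_le (by norm_num)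
        (min_le_right δ 1)).trans (Real.rpow_one _).le
      have h9 : (X : ℝ) ^ (α * δ') / 2 ≤ (X : ℝ) ^ (α * δ') / (2 : ℝ) ^ δ' := by gcongr
      linarith
    have hXz : (X : ℝ) / z ≤ 4 * (X : ℝ) ^ (1 - α * δ') := by
      rw [Real.rpow_sub hX0', Real.rpow_one, div_le_iff₀ (by exact_mod_cast hz0)]
      have h10 : (0 : ℝ) < (X : ℝ) ^ (α * δ') := by positivity
      calc (X : ℝ) = 4 * (X / (X : ℝ) ^ (α * δ')) * ((X : ℝ) ^ (α * δ') / 4) := by field_simp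
        _ ≤ _ := by gcongr
    calc k * ((X : ℝ) / z + E) * Real.log X ^ k ≤
        k * (4 * (X : ℝ) ^ (1 - α * δ') + 2 * a * (X : ℝ) ^ (1 / 2 : ℝ)) * Real.log X ^ k := by
          gcongr
      _ = k * 4 * (X : ℝ) ^ (1 - α * δ') * Real.log X ^ k +
          k * (2 * a) * (X : ℝ) ^ (1 / 2 : ℝ) * Real.log X ^ k := by ring
      _ ≤ γ / (4 * B) * X + γ / (4 * B) * X := add_le_add h5 h6
      _ = _ := by field_simp; ring
  rw [div_le_iff₀ (by positivity)]
  have hlow' : γ / B * X ≤ G * Real.log X ^ k := by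
    rw [div_mul_eq_mul_div, div_le_iff₀ hB0]
    linarith
  have h11 : γ / B * X = γ / (2 * B) * X + γ / (2 * B) * X := by field_simp; ring
  have h12 := mul_le_mul_of_nonneg_right hcard (by positivity : 0 ≤ Real.log X ^ k)
  rw [add_mul] at h12
  linarith

end SieveSetup

open Filter in
lemma exists_margin {k : ℕ} (hk : 0 < k) : ∃ t : ℝ, 0 < t ∧ t ≤ 1 ∧
    2 * k * Real.exp t * divisorConst k (3 * k) (2 + 2 * t) <
      divisorBound k * squareConst k (3 * k) := by
  have hcont : Continuous fun t : ℝ =>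
      2 * k * Real.exp t * divisorConst k (3 * k) (2 + 2 * t) := by
    unfold divisorConst
    fun_prop
  have h0 : 2 * k * Real.exp 0 * divisorConst k (3 * k) (2 + 2 * 0) <
      divisorBound k * squareConst k (3 * k) := by
    simpa using two_mul_divisorConst_lt hk
  have h1 := (hcont.tendsto 0).eventually_lt_const h0
  have h2 : ∀ᶠ t : ℝ in nhdsWithin 0 (Set.Ioi 0), t ∈ Set.Ioc (0 : ℝ) 1 :=
    Ioc_mem_nhdsGT one_pos
  obtain ⟨t, ht, ht'⟩ := ((h1.filter_mono nhdsWithin_le_nhds).and h2).exists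
  exact ⟨t, ht'.1, ht'.2, ht⟩

lemma exists_coprime_primorial {k : ℕ} {a b : Fin k → ℕ}
    (hadm : ∀ p : ℕ, p.Prime → ∃ n : ℕ, ∀ i, ¬ p ∣ a i * n + b i) (D : ℕ) :
    ∃ n : ℕ, ∀ i, (primorial D).Coprime (a i * n + b i) := by
  choose! r hr using hadm
  set S := (range (D + 1)).filter Nat.Prime with hS
  have hSp : ∀ p ∈ S, p.Prime := fun p hp => (mem_filter.1 hp).2
  obtain ⟨n, hn⟩ := Nat.chineseRemainderOfFinset r id S (fun p hp => (hSp p hp).ne_zero)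
    fun p hp q hq hpq => (Nat.coprime_primes (hSp p hp) (hSp q hq)).2 hpq
  refine ⟨n, fun i => Nat.Coprime.prod_left fun p hp => ?_⟩
  rw [(hSp p hp).coprime_iff_not_dvd]
  have h1 : a i * n + b i ≡ a i * r p + b i [MOD p] := ((hn p hp).mul_left _).add_right _
  rw [h1.dvd_iff dvd_rfl]
  exact hr p (hSp p hp) i

lemma exists_sieveSetup {k : ℕ} (hk : 0 < k) {a b : Fin k → ℕ} (ha : ∀ i, 0 < a i)
    (hb : ∀ i, 0 < b i) (hdet : ∀ i j, i ≠ j → (a i : ℤ) * b j - a j * b i ≠ 0)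
    (hadm : ∀ p : ℕ, p.Prime → ∃ n : ℕ, ∀ i, ¬ p ∣ a i * n + b i) (D₀ : ℕ) :
    ∃ s : SieveSetup k, s.a = a ∧ s.b = b ∧ D₀ ≤ s.D := by
  set D := D₀ + (2 * k + 2) + ∑ i, a i + ∑ i, ∑ j, ((a i : ℤ) * b j - a j * b i).natAbs with hD
  obtain ⟨n, hn⟩ := exists_coprime_primorial hadm D
  refine ⟨⟨a, b, D, n, hk, ha, hb, by omega, hn, fun i p _ hDp hpa => ?_,
    fun i j hij p _ hDp hpd => ?_⟩, rfl, rfl, by change D₀ ≤ D; omega⟩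
  · have h1 := Nat.le_of_dvd (ha i) hpa
    have h2 := single_le_sum (f := a) (fun _ _ => Nat.zero_le _) (mem_univ i)
    omega
  · have h1 := Nat.le_of_dvd (Int.natAbs_pos.2 (hdet i j hij)) (Int.natCast_dvd.1 hpd)
    have h2 := single_le_sum (f := fun j => ((a i : ℤ) * b j - a j * b i).natAbs)
      (fun _ _ => Nat.zero_le _) (mem_univ j)
    have h3 := single_le_sum (f := fun i => ∑ j, ((a i : ℤ) * b j - a j * b i).natAbs)
      (fun _ _ => Nat.zero_le _) (mem_univ i)
    omega

open Filter in
/-- The lower bound for forms with positive coefficients, no two of them proportional. -/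
lemma exists_le_card_of_nat {k : ℕ} (hk : 0 < k) {a b : Fin k → ℕ} (ha : ∀ i, 0 < a i)
    (hb : ∀ i, 0 < b i) (hdet : ∀ i j, i ≠ j → (a i : ℤ) * b j - a j * b i ≠ 0)
    (hadm : ∀ p : ℕ, p.Prime → ∃ n : ℕ, ∀ i, ¬ p ∣ a i * n + b i) :
    ∃ γ : ℝ, 0 < γ ∧ ∀ᶠ X : ℕ in atTop, γ * X / Real.log X ^ k ≤
      (((Icc 1 X).filter fun n =>
        ∀ i, (a i * n + b i).primeFactorsList.length ≤ omegaBound k).card : ℝ) := by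
  obtain ⟨t, ht0, ht1, ht⟩ := exists_margin hk
  have hev1 := ((tendsto_rpow_atTop (by positivity : 0 < t / 4)).comp
    tendsto_natCast_atTop_atTop).eventually_ge_atTop (4 * k + 1 : ℝ)
  have hev2 := (tendsto_natCast_atTop_atTop (R := ℝ)).eventually_ge_atTop
    ((2 * k ^ 2 + 8 * k + 2) / t)
  obtain ⟨D₀, hD₀⟩ := eventually_atTop.1 (hev1.and hev2)
  obtain ⟨s, rfl, rfl, hsD⟩ := exists_sieveSetup hk ha hb hdet hadm D₀
  have hD0 : (0 : ℝ) < s.D := by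
    have := s.lt_D
    exact_mod_cast (by omega : 0 < s.D)
  refine s.exists_le_goodCount (θ := t) (β := 3 * k) ht0 ht1 (by positivity)
    (fun p hp => (hD₀ p (hsD.trans hp.le)).1) (lt_of_le_of_lt ?_ ht)
  have h1 : (2 * k ^ 2 + 8 * k + 2 : ℝ) / s.D ≤ t := by
    rw [div_le_comm₀ hD0 ht0]
    exact (hD₀ s.D hsD).2
  have h2 : 0 ≤ divisorConst k (3 * k) (2 + 2 * t) := by
    unfold divisorConst
    positivity
  gcongr

lemma eq_of_mul_eq_mul_of_isCoprime {a b c d : ℤ} (ha : 0 < a) (hc : 0 < c) (hab : IsCoprime a b)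
    (hcd : IsCoprime c d) (h : a * d = c * b) : a = c ∧ b = d := by
  have h1 : a ∣ c := hab.dvd_of_dvd_mul_right ⟨d, h.symm⟩
  have h2 : c ∣ a := hcd.dvd_of_dvd_mul_right ⟨b, h⟩
  have h3 : a = c := Int.dvd_antisymm ha.le hc.le h1 h2
  subst h3
  exact ⟨rfl, (mul_left_cancel₀ ha.ne' h).symm⟩

lemma isCoprime_of_forall_prime_not_dvd {a b : ℤ}
    (h : ∀ p : ℕ, p.Prime → ∃ n : ℤ, ¬ (p : ℤ) ∣ a * n + b) : IsCoprime a b := by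
  rw [Int.isCoprime_iff_gcd_eq_one]
  by_contra hne
  obtain ⟨p, hp, hpd⟩ := Nat.exists_prime_and_dvd hne
  obtain ⟨n, hn⟩ := h p hp
  have h1 : (p : ℤ) ∣ (Int.gcd a b : ℤ) := by exact_mod_cast hpd
  exact hn (dvd_add (dvd_mul_of_dvd_left (h1.trans (Int.gcd_dvd_left ..)) _)
    (h1.trans (Int.gcd_dvd_right ..)))

open Filter in
lemma exists_le_card_of_injective {k : ℕ} (hk : 0 < k) {a b : Fin k → ℤ} (ha : ∀ i, 0 < a i)
    (hinj : Function.Injective fun i => (a i, b i))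
    (hfix : ∀ p : ℕ, p.Prime → ∃ n : ℤ, ∀ i, ¬ (p : ℤ) ∣ a i * n + b i) :
    ∃ C : ℝ, 0 < C ∧ ∀ᶠ x : ℝ in atTop, C * x / Real.log x ^ k ≤
      (((Icc 1 ⌊x⌋₊).filter fun n : ℕ =>
        ∀ i, bigOmegaZ (a i * (n : ℤ) + b i) ≤ omegaBound k).card : ℝ) := by
  have hcop : ∀ i, IsCoprime (a i) (b i) := fun i =>
    isCoprime_of_forall_prime_not_dvd fun p hp => (hfix p hp).imp fun n hn => hn i
  obtain ⟨t, hpos⟩ : ∃ t : ℕ, ∀ i, 0 < a i * t + b i := by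
    refine ⟨∑ i, (b i).natAbs + 1, fun i => ?_⟩
    have h1 := single_le_sum (f := fun i => (b i).natAbs) (fun _ _ => Nat.zero_le _) (mem_univ i)
    have h2 := le_mul_of_one_le_left (by positivity : 0 ≤ ((∑ i, (b i).natAbs + 1 : ℕ) : ℤ)) (ha i)
    omega
  have hA : ∀ i, ((a i).toNat : ℤ) = a i := fun i => Int.toNat_of_nonneg (ha i).le
  have hB : ∀ i, ((a i * t + b i).toNat : ℤ) = a i * t + b i := fun i =>
    Int.toNat_of_nonneg (hpos i).le
  have hAB : ∀ i (n : ℕ), (((a i).toNat * n + (a i * t + b i).toNat : ℕ) : ℤ) =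
      a i * ((n + t : ℕ) : ℤ) + b i := fun i n => by
    rw [Nat.cast_add, Nat.cast_mul, hA, hB, Nat.cast_add n t]
    ring
  have hdet : ∀ i j, i ≠ j → ((a i).toNat : ℤ) * (a j * t + b j).toNat -
      (a j).toNat * (a i * t + b i).toNat ≠ 0 := fun i j hij h0 => by
    rw [hA, hA, hB, hB] at h0
    obtain ⟨h1, h2⟩ := eq_of_mul_eq_mul_of_isCoprime (ha i) (ha j) (hcop i) (hcop j)
      (by linear_combination h0)
    exact hij (hinj (Prod.ext h1 h2))
  have hadm : ∀ p : ℕ, p.Prime →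
      ∃ n : ℕ, ∀ i, ¬ p ∣ (a i).toNat * n + (a i * t + b i).toNat := fun p hp => by
    obtain ⟨n, hn⟩ := hfix p hp
    have hp0 : (p : ℤ) ≠ 0 := by exact_mod_cast hp.ne_zero
    refine ⟨((n - t) % p).toNat, fun i hdvd => hn i ?_⟩
    rw [← Int.natCast_dvd_natCast, hAB, Nat.cast_add,
      Int.toNat_of_nonneg (Int.emod_nonneg _ hp0)] at hdvd
    have h1 : (p : ℤ) ∣ (n - t) - (n - t) % p := Int.dvd_self_sub_emod
    have e : a i * n + b i = a i * ((n - t) % p + t) + b i + a i * ((n - t) - (n - t) % p) := by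
      ring
    exact e ▸ dvd_add hdvd (h1.mul_left (a i))
  obtain ⟨γ, hγ, h⟩ := exists_le_card_of_nat hk (fun i => by have := ha i; omega)
    (fun i => by have := hpos i; omega) hdet hadm
  refine ⟨γ / 2, by positivity, ?_⟩
  have hX : Tendsto (fun x : ℝ => ⌊x⌋₊ - t) atTop atTop :=
    (tendsto_sub_atTop_nat t).comp tendsto_nat_floor_atTop
  filter_upwards [hX.eventually h, eventually_ge_atTop (2 * (t + 3) : ℝ)] with x hx hxt
  set X := ⌊x⌋₊ - t with hXdef
  have ht0 : (0 : ℝ) ≤ t := by positivity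
  have hx0 : 0 ≤ x := by linarith
  have hfl : ⌊x⌋₊ = X + t := by
    have : t ≤ ⌊x⌋₊ := Nat.le_floor (by linarith)
    omega
  have hXx : x < X + t + 1 := by
    have := Nat.lt_floor_add_one x
    rw [hfl] at this
    exact_mod_cast this
  have hXle : (X : ℝ) ≤ x := by
    have := Nat.floor_le hx0
    rw [hfl] at this
    push_cast at this
    linarith
  have hX2 : (2 : ℝ) ≤ X := by linarith
  have hlog : 0 < Real.log X := Real.log_pos (by linarith)
  calc γ / 2 * x / Real.log x ^ k ≤ γ * X / Real.log X ^ k := by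
        refine div_le_div₀ (by positivity) (by nlinarith) (by positivity) ?_
        gcongr
    _ ≤ _ := hx
    _ ≤ _ := by
        rw [Nat.cast_le]
        refine card_le_card_of_injOn (· + t) (fun n hn => ?_) fun m _ n _ hmn =>
          Nat.add_right_cancel hmn
        obtain ⟨hn1, hn2⟩ := mem_filter.1 (mem_coe.1 hn)
        rw [mem_Icc] at hn1
        refine mem_coe.2 (mem_filter.2 ⟨mem_Icc.2 ⟨?_, ?_⟩, fun i => ?_⟩)
        · change 1 ≤ n + t
          omega
        · change n + t ≤ ⌊x⌋₊
          omega
        · change bigOmegaZ (a i * ((n + t : ℕ) : ℤ) + b i) ≤ _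
          rw [← hAB, bigOmegaZ, Int.toNat_natCast]
          exact hn2 i

lemma omegaBound_mono : Monotone omegaBound := fun k l h => by
  unfold omegaBound
  gcongr

end AlmostPrime

open AlmostPrime Filter

/-- (Heath–Brown) Let `L i (x) = a i * x + b i` (`1 ≤ i ≤ k`) be linear functions with
integer coefficients, `a i > 0`, having no fixed prime divisor. With
`G_k = ⌊log₂ ⌊(3k² + 4k + 4)/2⌋⌋`, there are `≫ x / (log x)^k` positive integers `n ≤ x`
with `max_i Ω(L i (n)) ≤ G_k`. -/
theorem stmt_13 (k : ℕ) (hk : 0 < k) (a b : Fin k → ℤ)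
    (ha : ∀ i, 0 < a i)
    (hfix : ∀ p : ℕ, p.Prime → ∃ n : ℤ, ∀ i, ¬ (p : ℤ) ∣ (a i * n + b i)) :
    ∃ C : ℝ, 0 < C ∧ ∃ x₀ : ℝ, 0 < x₀ ∧ ∀ x : ℝ, x₀ ≤ x →
      C * x / (Real.log x) ^ k ≤
        (((Finset.Icc 1 ⌊x⌋₊).filter fun n : ℕ => ∀ i,
          bigOmegaZ (a i * (n : ℤ) + b i) ≤ Nat.log 2 ((3 * k ^ 2 + 4 * k + 4) / 2)).card : ℝ) := by
  set S := univ.image fun i => (a i, b i) with hS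
  have hSk : S.card ≤ k := card_image_le.trans (card_fin k).le
  have hS0 : 0 < S.card := card_pos.2 ⟨_, mem_image_of_mem _ (mem_univ ⟨0, hk⟩)⟩
  set f : Fin S.card → ℤ × ℤ := fun j => (S.equivFin.symm j : ℤ × ℤ) with hf
  have hfS : ∀ j, ∃ i, (a i, b i) = f j := fun j => by
    simpa [hS] using mem_image.1 (S.equivFin.symm j).2
  have hSf : ∀ i, ∃ j, f j = (a i, b i) := fun i =>
    ⟨S.equivFin ⟨_, mem_image_of_mem _ (mem_univ i)⟩, by simp [hf]⟩
  obtain ⟨C, hC, h⟩ := exists_le_card_of_injective hS0 (a := fun j => (f j).1)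
    (b := fun j => (f j).2) (fun j => by obtain ⟨i, hi⟩ := hfS j; simpa [← hi] using ha i)
    (fun j l hjl => S.equivFin.symm.injective (Subtype.ext hjl))
    fun p hp => (hfix p hp).imp fun n hn j => by
      obtain ⟨i, hi⟩ := hfS j; simpa [← hi] using hn i
  obtain ⟨x₀, hx₀⟩ := eventually_atTop.1 h
  refine ⟨C, hC, max x₀ (Real.exp 1), by positivity, fun x hx => ?_⟩
  have hx1 : Real.exp 1 ≤ x := (le_max_right _ _).trans hx
  have hx0 : 0 < x := (Real.exp_pos 1).trans_le hx1
  have hlog : 1 ≤ Real.log x := (Real.le_log_iff_exp_le hx0).2 hx1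
  calc C * x / Real.log x ^ k ≤ C * x / Real.log x ^ S.card := by gcongr
    _ ≤ _ := hx₀ x ((le_max_left _ _).trans hx)
    _ ≤ _ := by
        rw [Nat.cast_le]
        refine card_le_card (monotone_filter_right _ fun n _ hn i => ?_)
        obtain ⟨j, hj⟩ := hSf i
        have h1 := (hn j).trans (omegaBound_mono hSk)
        rwa [hj] at h1
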